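/- Semicircle law on small scales. Fix a constant K > 0. There exist constants c0 > 0 (absolute) and C > 0 (depending only on K) with the following property. Let N, d be positive integers with Nd even and d ≥ 3, and let ξ > 0 satisfy ξ·log ξ ≥ c0·(log N)^2 and D ≥ c0·ξ^2. Then for every interval I ⊂ [−K, K], with probability at least 1 − e^{−ξ log ξ} under the uniform model of random d-regular graphs on N vertices, one has |ν(I) − ϱ(I)| ≤ C·( ξ·|I|/√(κ(I) + |I|) · ( D^{−1/2} + (N·|I|)^{−1/2} ) + ξ^2/N ), where |I| denotes the length of I and κ(I) := dist(I, {−2, 2}). -/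

import Mathlib

open MeasureTheory

noncomputable section

/-- The number of elements of a finite type satisfying a predicate. -/
def cardOf {α : Type*} [Fintype α] (p : α → Prop) : ℕ :=
  (@Finset.filter α p (Classical.decPred p) Finset.univ).card

/-- `G` encodes a simple `d`-regular graph on `N` vertices: it is symmetric, has zero
diagonal, and every row has exactly `d` ones. -/
def IsRegGraph (N d : ℕ) (G : Fin N → Fin N → Bool) : Prop :=
  (∀ i j, G i j = G j i) ∧ (∀ i, G i i = false) ∧
    ∀ i, (Finset.univ.filter fun j => G i j = true).card = d

/-- The `{0,1}`-valued adjacency matrix associated to `G`. -/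
def adjOf {N : ℕ} (G : Fin N → Fin N → Bool) : Matrix (Fin N) (Fin N) ℝ :=
  Matrix.of fun i j => if G i j then 1 else 0

/-- The probability of the event `P` under the uniform model of random `d`-regular
graphs on `N` vertices. -/
def unifProb (N d : ℕ) (P : Matrix (Fin N) (Fin N) ℝ → Prop) : ℝ :=
  (cardOf (fun G : Fin N → Fin N → Bool => IsRegGraph N d G ∧ P (adjOf G)) : ℝ) /
  (cardOf (fun G : Fin N → Fin N → Bool => IsRegGraph N d G) : ℝ)

/-- `H := (d-1)^{-1/2} (A - d e e^T)` as a real symmetric matrix, where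
`e = N^{-1/2} (1, ..., 1)^T`. -/
def HmatR (N d : ℕ) (A : Matrix (Fin N) (Fin N) ℝ) : Matrix (Fin N) (Fin N) ℝ :=
  (Real.sqrt ((d : ℝ) - 1))⁻¹ • (A - Matrix.of fun _ _ => (d : ℝ) / (N : ℝ))

/-- `D := min(d, N²/d³)` for the uniform model. -/
def Dunif (N d : ℕ) : ℝ := min (d : ℝ) ((N : ℝ) ^ 2 / (d : ℝ) ^ 3)

/-- The semicircle measure of the interval `[a,b]`. -/
def semicircleMeasure (a b : ℝ) : ℝ :=
  ∫ x in Set.Icc a b, Real.sqrt (max (4 - x ^ 2) 0) / (2 * Real.pi)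

/-- The empirical spectral measure of `[a,b]`: `N⁻¹ · #{α : λ_α ∈ [a,b]}`, where the
`λ_α` are the eigenvalues of the Hermitian matrix `H`. -/
def empiricalMeasure {N : ℕ} {H : Matrix (Fin N) (Fin N) ℝ} (hH : H.IsHermitian)
    (a b : ℝ) : ℝ :=
  (cardOf (fun α : Fin N => hH.eigenvalues α ∈ Set.Icc a b) : ℝ) / (N : ℝ)

/-- `κ(I) := dist(I, {-2, 2})`, the distance from the interval `I = [a,b]` to the
spectral edges `±2`. -/
def kappaDist (a b : ℝ) : ℝ :=
  min (Metric.infDist (-2 : ℝ) (Set.Icc a b)) (Metric.infDist (2 : ℝ) (Set.Icc a b))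

section Resolvent

variable {n : Type*} [Fintype n] [DecidableEq n]

/-- The resolvent of a real matrix `H` that annihilates the constant vector, with the
contribution of the constant vector removed. -/
def projRes (H : Matrix n n ℝ) (z : ℂ) : Matrix n n ℂ :=
  (H.map Complex.ofReal - z • (1 : Matrix n n ℂ))⁻¹ +
    Matrix.of fun _ _ => 1 / ((Fintype.card n : ℂ) * z)

lemma exists_resolvent {H : Matrix n n ℝ} (hH : H.IsHermitian) {z : ℂ} (hz : z.im ≠ 0) :
    ∃ B : Matrix n n ℂ, (H.map Complex.ofReal - z • (1 : Matrix n n ℂ)) * B = 1 ∧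
      B.trace = ∑ α, 1 / ((hH.eigenvalues α : ℂ) - z) := by
  set U : Matrix n n ℝ := (hH.eigenvectorUnitary : Matrix n n ℝ) with hU
  have h1 : U * star U = 1 := Unitary.mul_star_self_of_mem hH.eigenvectorUnitary.2
  have h2 : star U * U = 1 := Unitary.star_mul_self_of_mem hH.eigenvectorUnitary.2
  have hspec : H = U * Matrix.diagonal hH.eigenvalues * star U := by
    have := hH.spectral_theorem
    rw [Unitary.conjStarAlgAut_apply] at this
    exact this
  let f : ℝ →+* ℂ := Complex.ofRealHom
  set V := U.map f with hV
  set V' := (star U).map f with hV'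
  have h1' : V * V' = 1 := by
    rw [hV, hV', ← Matrix.map_mul, h1]
    exact Matrix.map_one f (map_zero f) (map_one f)
  have h2' : V' * V = 1 := by
    rw [hV, hV', ← Matrix.map_mul, h2]
    exact Matrix.map_one f (map_zero f) (map_one f)
  have hspec' : H.map Complex.ofReal =
      V * Matrix.diagonal (fun α => (hH.eigenvalues α : ℂ)) * V' := by
    have : H.map f = (U * Matrix.diagonal hH.eigenvalues * star U).map f := by
      rw [← hspec]
    rw [Matrix.map_mul, Matrix.map_mul, Matrix.diagonal_map (map_zero f)] at this
    exact this
  have hne : ∀ α, (hH.eigenvalues α : ℂ) - z ≠ 0 := by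
    intro α h
    apply hz
    have := congrArg Complex.im h
    simpa using this
  have hsub : H.map Complex.ofReal - z • (1 : Matrix n n ℂ) =
      V * Matrix.diagonal (fun α => (hH.eigenvalues α : ℂ) - z) * V' := by
    have : Matrix.diagonal (fun α => (hH.eigenvalues α : ℂ) - z) =
        Matrix.diagonal (fun α => (hH.eigenvalues α : ℂ)) - z • (1 : Matrix n n ℂ) := by
      ext a b
      by_cases hab : a = b
      · subst hab; simp
      · simp [hab]
    rw [this, Matrix.mul_sub, Matrix.sub_mul, ← hspec']
    congr 1
    rw [Matrix.mul_smul, Matrix.smul_mul, Matrix.mul_one, h1']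
  refine ⟨V * Matrix.diagonal (fun α => 1 / ((hH.eigenvalues α : ℂ) - z)) * V', ?_, ?_⟩
  · rw [hsub]
    calc _ = V * Matrix.diagonal (fun α => (hH.eigenvalues α : ℂ) - z) * (V' * V) *
          Matrix.diagonal (fun α => 1 / ((hH.eigenvalues α : ℂ) - z)) * V' := by
          simp only [Matrix.mul_assoc]
      _ = V * (Matrix.diagonal (fun α => (hH.eigenvalues α : ℂ) - z) *
          Matrix.diagonal (fun α => 1 / ((hH.eigenvalues α : ℂ) - z))) * V' := by
          rw [h2']; simp only [Matrix.mul_assoc, Matrix.one_mul]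
      _ = V * 1 * V' := by
          congr 2
          rw [Matrix.diagonal_mul_diagonal]
          ext a b
          by_cases hab : a = b
          · subst hab; simp [hne]
          · simp [hab]
      _ = 1 := by rw [Matrix.mul_one, h1']
  · rw [Matrix.trace_mul_comm, ← Matrix.mul_assoc, h2', Matrix.one_mul]
    simp [Matrix.trace]

variable {H : Matrix n n ℝ} {z : ℂ}

lemma projRes_mul [Nonempty n] (hH : H.IsHermitian) (hz : z.im ≠ 0) (hrow : ∀ i, ∑ j, H i j = 0) :
    (H.map Complex.ofReal - z • (1 : Matrix n n ℂ)) * projRes H z =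
      1 - Matrix.of fun _ _ => 1 / (Fintype.card n : ℂ) := by
  obtain ⟨B, hB, -⟩ := exists_resolvent hH hz
  rw [projRes, Matrix.inv_eq_right_inv hB, Matrix.mul_add, hB]
  suffices h : (H.map Complex.ofReal - z • (1 : Matrix n n ℂ)) *
      (Matrix.of fun _ _ => 1 / ((Fintype.card n : ℂ) * z)) =
      -(Matrix.of fun _ _ => 1 / (Fintype.card n : ℂ)) by
    rw [h, ← sub_eq_add_neg]
  ext i j
  have hrow' : ∑ j, (H i j : ℂ) = 0 := by exact_mod_cast hrow i
  have hz0 : z ≠ 0 := by rintro rfl; simp at hz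
  have hc : (Fintype.card n : ℂ) ≠ 0 := by exact_mod_cast Fintype.card_ne_zero
  simp only [Matrix.mul_apply, Matrix.sub_apply, Matrix.map_apply, Matrix.smul_apply,
    Matrix.of_apply, Matrix.neg_apply, ← Finset.sum_mul, Finset.sum_sub_distrib, hrow', smul_eq_mul,
    ← Finset.mul_sum, Matrix.one_apply, Finset.sum_ite_eq, Finset.mem_univ, if_true]
  field_simp
  ring

lemma sub_isSymm {m : Type*} [DecidableEq m] {H : Matrix m m ℝ} (hH : H.IsHermitian) :
    (H.map Complex.ofReal - z • (1 : Matrix m m ℂ)).transpose =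
      H.map Complex.ofReal - z • (1 : Matrix m m ℂ) := by
  ext i j
  have := hH.apply i j
  simp only [star_trivial] at this
  simp [this, Matrix.one_apply, eq_comm]

lemma projRes_symm (hH : H.IsHermitian) (i j : n) : projRes H z i j = projRes H z j i := by
  have : ((H.map Complex.ofReal - z • (1 : Matrix n n ℂ))⁻¹).transpose =
      (H.map Complex.ofReal - z • (1 : Matrix n n ℂ))⁻¹ := by
    rw [Matrix.transpose_nonsing_inv, sub_isSymm hH]
  have h := congrFun (congrFun this j) i
  rw [Matrix.transpose_apply] at h
  simp [projRes, h]

lemma projRes_conj (H : Matrix n n ℝ) (z : ℂ) (i j : n) :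
    (starRingEnd ℂ) (projRes H z i j) = projRes H ((starRingEnd ℂ) z) i j := by
  have h1 : (H.map Complex.ofReal - z • (1 : Matrix n n ℂ)).map (starRingEnd ℂ) =
      H.map Complex.ofReal - ((starRingEnd ℂ) z) • (1 : Matrix n n ℂ) := by
    ext a b
    by_cases hab : a = b
    · subst hab; simp
    · simp [hab]
  have h2 : ∀ M : Matrix n n ℂ, (M⁻¹).map (starRingEnd ℂ) = (M.map (starRingEnd ℂ))⁻¹ := by
    intro M
    have := Matrix.conjTranspose_nonsing_inv M
    have h3 := Matrix.transpose_nonsing_inv (M.map (starRingEnd ℂ))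
    have e : (M.map (starRingEnd ℂ)).transpose = M.conjTranspose := rfl
    rw [e, ← this] at h3
    have := congrArg Matrix.transpose h3
    rw [Matrix.transpose_transpose] at this
    rw [this]; rfl
  have h := congrFun (congrFun (h2 (H.map Complex.ofReal - z • (1 : Matrix n n ℂ))) i) j
  rw [h1, Matrix.map_apply] at h
  simp [projRes, h]

lemma projRes_col_sum [Nonempty n] (hH : H.IsHermitian) (hz : z.im ≠ 0)
    (hrow : ∀ i, ∑ j, H i j = 0) (j : n) : ∑ k, projRes H z k j = 0 := by
  have h := projRes_mul hH hz hrow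
  have hz0 : z ≠ 0 := by rintro rfl; simp at hz
  have hc : (Fintype.card n : ℂ) ≠ 0 := by exact_mod_cast Fintype.card_ne_zero
  have hcol : ∀ k, ∑ i, (H i k : ℂ) = 0 := by
    intro k
    have : ∑ i, H i k = 0 := by
      rw [← hrow k]
      refine Finset.sum_congr rfl fun i _ => ?_
      have := hH.apply k i
      simpa using this
    exact_mod_cast this
  have h1 : ∑ i : n, ((H.map Complex.ofReal - z • (1 : Matrix n n ℂ)) * projRes H z) i j =
      - z * ∑ k, projRes H z k j := by
    simp only [Matrix.mul_apply]
    rw [Finset.sum_comm]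
    simp only [← Finset.sum_mul, Matrix.sub_apply, Matrix.map_apply, Finset.sum_sub_distrib, hcol,
      Matrix.smul_apply, smul_eq_mul, ← Finset.mul_sum, Matrix.one_apply, Finset.sum_ite_eq',
      Finset.mem_univ, if_true]
    ring
  have h2 : ∑ i : n, ((H.map Complex.ofReal - z • (1 : Matrix n n ℂ)) * projRes H z) i j = 0 := by
    rw [h]
    simp [Matrix.one_apply, hc]
  rw [h2] at h1
  simpa [hz0] using h1.symm

lemma mul_projRes_apply [Nonempty n] (hH : H.IsHermitian) (hz : z.im ≠ 0)
    (hrow : ∀ i, ∑ j, H i j = 0) (i j : n) :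
    ∑ k, (H i k : ℂ) * projRes H z k j =
      (if i = j then 1 else 0) - 1 / (Fintype.card n : ℂ) + z * projRes H z i j := by
  have h := congrFun (congrFun (projRes_mul hH hz hrow) i) j
  rw [Matrix.sub_mul, Matrix.sub_apply, Matrix.smul_mul, Matrix.one_mul] at h
  simp only [Matrix.mul_apply, Matrix.map_apply, Matrix.smul_apply, smul_eq_mul, Matrix.sub_apply,
    Matrix.of_apply, Matrix.one_apply] at h
  linear_combination h

lemma projRes_trace [Nonempty n] (hH : H.IsHermitian) (hz : z.im ≠ 0) :
    ∑ i, projRes H z i i = ∑ α, 1 / ((hH.eigenvalues α : ℂ) - z) + 1 / z := by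
  obtain ⟨B, hB, hB'⟩ := exists_resolvent hH hz
  have hz0 : z ≠ 0 := by rintro rfl; simp at hz
  have hc : (Fintype.card n : ℂ) ≠ 0 := by exact_mod_cast Fintype.card_ne_zero
  rw [projRes, Matrix.inv_eq_right_inv hB, ← hB']
  simp only [Matrix.add_apply, Finset.sum_add_distrib, Matrix.trace, Matrix.diag_apply]
  simp only [Matrix.of_apply, Finset.sum_const, Finset.card_univ, nsmul_eq_mul]
  field_simp

/-- The resolvent identity, for two matrices and two spectral parameters. -/
lemma projRes_sub [Nonempty n] {H' : Matrix n n ℝ} {z' : ℂ} (hH : H.IsHermitian)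
    (hH' : H'.IsHermitian) (hz : z.im ≠ 0) (hz' : z'.im ≠ 0)
    (hrow : ∀ i, ∑ j, H i j = 0) (hrow' : ∀ i, ∑ j, H' i j = 0) :
    projRes H' z' - projRes H z =
      projRes H z * ((z' - z) • (1 : Matrix n n ℂ) - (H' - H).map Complex.ofReal) *
        projRes H' z' := by
  have key : ∀ {K K' : Matrix n n ℝ} {w w' : ℂ}, K.IsHermitian → K'.IsHermitian → w.im ≠ 0 →
      w'.im ≠ 0 → (∀ i, ∑ j, K i j = 0) → (∀ i, ∑ j, K' i j = 0) →
      projRes K w * (K'.map Complex.ofReal - w' • (1 : Matrix n n ℂ)) * projRes K' w' =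
        projRes K w := by
    intro K K' w w' hK hK' hw hw' hr hr'
    rw [Matrix.mul_assoc, projRes_mul hK' hw' hr', Matrix.mul_sub, Matrix.mul_one, sub_eq_self]
    ext i j
    simp only [Matrix.mul_apply, Matrix.of_apply, ← Finset.sum_mul, Matrix.zero_apply]
    have : ∑ k, projRes K w i k = 0 := by
      rw [← projRes_col_sum hK hw hr i]
      exact Finset.sum_congr rfl fun k _ => projRes_symm hK i k
    rw [this, zero_mul]
  have e1 := key hH hH' hz hz' hrow hrow'
  have e2 : projRes H z * (H.map Complex.ofReal - z • (1 : Matrix n n ℂ)) * projRes H' z' =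
      projRes H' z' := by
    have := congrArg Matrix.transpose (key hH' hH hz' hz hrow' hrow)
    have s1 : (projRes H' z').transpose = projRes H' z' := by
      ext i j; exact projRes_symm hH' j i
    have s2 : (projRes H z).transpose = projRes H z := by
      ext i j; exact projRes_symm hH j i
    rw [Matrix.transpose_mul, Matrix.transpose_mul, s1, s2, sub_isSymm hH, ← Matrix.mul_assoc]
      at this
    exact this
  have e3 : ((z' - z) • (1 : Matrix n n ℂ) - (H' - H).map Complex.ofReal) =
      (H.map Complex.ofReal - z • (1 : Matrix n n ℂ)) -
        (H'.map Complex.ofReal - z' • (1 : Matrix n n ℂ)) := by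
    ext i j
    simp
    ring
  rw [e3, Matrix.mul_sub, Matrix.sub_mul, e1, e2]

lemma projRes_sub_of_param [Nonempty n] {z' : ℂ} (hH : H.IsHermitian) (hz : z.im ≠ 0)
    (hz' : z'.im ≠ 0) (hrow : ∀ i, ∑ j, H i j = 0) (i j : n) :
    projRes H z' i j - projRes H z i j =
      (z' - z) * ∑ k, projRes H z i k * projRes H z' k j := by
  have h := congrFun (congrFun (projRes_sub hH hH hz hz' hrow hrow) i) j
  have e : (H - H).map Complex.ofReal = 0 := by
    ext a b; simp
  rw [e, sub_zero, Matrix.mul_smul, Matrix.mul_one, Matrix.smul_mul] at h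
  simpa [Matrix.mul_apply] using h

/-- The Ward identity. -/
lemma ward_identity [Nonempty n] (hH : H.IsHermitian) (hz : z.im ≠ 0)
    (hrow : ∀ i, ∑ j, H i j = 0) (j : n) :
    ∑ k, ‖projRes H z k j‖ ^ 2 = (projRes H z j j).im / z.im := by
  have hz' : ((starRingEnd ℂ) z).im ≠ 0 := by simpa using hz
  have h := projRes_sub_of_param hH hz' hz hrow j j
  rw [← projRes_conj] at h
  have h2 : ∑ k, projRes H ((starRingEnd ℂ) z) j k * projRes H z k j =
      ((∑ k, ‖projRes H z k j‖ ^ 2 : ℝ) : ℂ) := by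
    push_cast
    refine Finset.sum_congr rfl fun k _ => ?_
    rw [projRes_symm hH j k, ← projRes_conj, Complex.conj_mul']
  rw [h2] at h
  have h3 := congrArg Complex.im h
  rw [Complex.im_mul_ofReal] at h3
  simp only [Complex.sub_im, Complex.conj_im] at h3
  rw [eq_div_iff hz]
  linarith

lemma sq_norm_le_of_ward [Nonempty n] (hH : H.IsHermitian) (hz : 0 < z.im)
    (hrow : ∀ i, ∑ j, H i j = 0) (i j : n) :
    ‖projRes H z i j‖ ^ 2 ≤ (projRes H z j j).im / z.im := by
  rw [← ward_identity hH hz.ne' hrow j]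
  exact Finset.single_le_sum (f := fun k => ‖projRes H z k j‖ ^ 2)
    (fun k _ => sq_nonneg _) (Finset.mem_univ i)

lemma projRes_norm_le [Nonempty n] (hH : H.IsHermitian) (hz : 0 < z.im)
    (hrow : ∀ i, ∑ j, H i j = 0) (i j : n) : ‖projRes H z i j‖ ≤ 1 / z.im := by
  have h1 := sq_norm_le_of_ward hH hz hrow j j
  have h2 := sq_norm_le_of_ward hH hz hrow i j
  have h3 : (projRes H z j j).im ≤ ‖projRes H z j j‖ :=
    (le_abs_self _).trans (Complex.abs_im_le_norm _)
  rw [le_div_iff₀ hz] at h1 h2 ⊢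
  have h4 : ‖projRes H z j j‖ * z.im ≤ 1 := by
    by_contra! hc
    have h0 : 0 < ‖projRes H z j j‖ := by
      by_contra! h5
      nlinarith
    nlinarith
  have h5 : (‖projRes H z i j‖ * z.im) ^ 2 ≤ 1 ^ 2 := by
    calc _ = ‖projRes H z i j‖ ^ 2 * z.im * z.im := by ring
      _ ≤ ‖projRes H z j j‖ * z.im := by gcongr; linarith
      _ ≤ 1 ^ 2 := by linarith
  exact le_of_sq_le_sq h5 (by norm_num)

lemma sum_mul_le_of_ward [Nonempty n] {H' : Matrix n n ℝ} {z' : ℂ} (hH : H.IsHermitian)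
    (hH' : H'.IsHermitian) (hz : 0 < z.im) (hz' : 0 < z'.im) (hrow : ∀ i, ∑ j, H i j = 0)
    (hrow' : ∀ i, ∑ j, H' i j = 0) (i j : n) :
    ∑ k, ‖projRes H z k i‖ * ‖projRes H' z' k j‖ ≤
      √((projRes H z i i).im / z.im) * √((projRes H' z' j j).im / z'.im) := by
  rw [← ward_identity hH hz.ne' hrow i, ← ward_identity hH' hz'.ne' hrow' j]
  exact Real.sum_mul_le_sqrt_mul_sqrt _ _ _

/-- Halving the imaginary part of the spectral parameter at most doubles the entries. -/
lemma projRes_half [Nonempty n] (hH : H.IsHermitian) (hrow : ∀ i, ∑ j, H i j = 0)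
    {E η γ : ℝ} (hη : 0 < η) (h : ∀ i, ‖projRes H ⟨E, 2 * η⟩ i i‖ ≤ γ) (i j : n) :
    ‖projRes H ⟨E, η⟩ i j - projRes H ⟨E, 2 * η⟩ i j‖ ≤ γ := by
  set z : ℂ := ⟨E, 2 * η⟩ with hzdef
  set w : ℂ := ⟨E, η⟩ with hwdef
  have hz : 0 < z.im := by simp [hzdef, hη]
  have hw : 0 < w.im := by simp [hwdef, hη]
  have hzη : z.im = 2 * η := rfl
  have hwη : w.im = η := rfl
  have hwz : w - z = -(η : ℂ) * Complex.I := by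
    apply Complex.ext <;> simp [hzdef, hwdef] ; ring
  let a : n → ℝ := fun j => √((projRes H z j j).im / z.im)
  let b : n → ℝ := fun j => √((projRes H w j j).im / w.im)
  have hdiff : ∀ i j, ‖projRes H w i j - projRes H z i j‖ ≤ η * (a i * b j) := by
    intro i j
    rw [projRes_sub_of_param hH hz.ne' hw.ne' hrow i j, hwz, norm_mul]
    have : ‖-(η : ℂ) * Complex.I‖ = η := by simp [abs_of_pos hη]
    rw [this]
    refine mul_le_mul_of_nonneg_left ?_ hη.le
    refine (norm_sum_le _ _).trans ((le_of_eq ?_).trans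
      (sum_mul_le_of_ward hH hH hz hw hrow hrow i j))
    refine Finset.sum_congr rfl fun k _ => ?_
    rw [norm_mul, projRes_symm hH i k]
  have ha0 : ∀ j, 0 ≤ a j := fun j => Real.sqrt_nonneg _
  have hb0 : ∀ j, 0 ≤ b j := fun j => Real.sqrt_nonneg _
  have haa : ∀ j, a j ^ 2 * (2 * η) = (projRes H z j j).im := by
    intro j
    have : 0 ≤ (projRes H z j j).im / z.im :=
      (sq_nonneg _).trans (sq_norm_le_of_ward hH hz hrow j j)
    rw [Real.sq_sqrt this, ← hzη, div_mul_cancel₀ _ hz.ne']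
  have hbb : ∀ j, b j ^ 2 * η = (projRes H w j j).im := by
    intro j
    have : 0 ≤ (projRes H w j j).im / w.im :=
      (sq_nonneg _).trans (sq_norm_le_of_ward hH hw hrow j j)
    rw [Real.sq_sqrt this, ← hwη, div_mul_cancel₀ _ hw.ne']
  have hab : ∀ j, b j ≤ 2 * a j := by
    intro j
    have h1 := (Complex.abs_im_le_norm _).trans (hdiff j j)
    rw [Complex.sub_im, ← haa, ← hbb] at h1
    have h2 := (le_abs_self _).trans h1
    have h3 : b j ^ 2 ≤ 2 * a j ^ 2 + a j * b j := by
      refine le_of_mul_le_mul_right ?_ hη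
      linarith
    have := ha0 j
    have := hb0 j
    by_contra! hc
    nlinarith
  have haγ : ∀ j, a j ^ 2 * (2 * η) ≤ γ := by
    intro j
    rw [haa]
    exact ((le_abs_self _).trans (Complex.abs_im_le_norm _)).trans (h j)
  calc _ ≤ η * (a i * b j) := hdiff i j
    _ ≤ η * (a i * (2 * a j)) := by
        have := ha0 i
        gcongr
        exact hab j
    _ ≤ γ := by nlinarith [haγ i, haγ j, mul_nonneg hη.le (sq_nonneg (a i - a j))]

lemma sum_norm_le_of_ward [Nonempty n] (hH : H.IsHermitian) (hz : 0 < z.im)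
    (hrow : ∀ i, ∑ j, H i j = 0) {γ : ℝ} (j : n) (h : ‖projRes H z j j‖ ≤ γ) :
    ∑ k, ‖projRes H z k j‖ ≤ Fintype.card n * √(γ / (Fintype.card n * z.im)) := by
  have hc : (0 : ℝ) < Fintype.card n := by exact_mod_cast Fintype.card_pos
  have h1 := Finset.sum_mul_sq_le_sq_mul_sq Finset.univ (fun _ => (1 : ℝ))
    (fun k => ‖projRes H z k j‖)
  simp only [one_mul, one_pow, Finset.sum_const, Finset.card_univ, nsmul_eq_mul, mul_one] at h1
  rw [ward_identity hH hz.ne' hrow] at h1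
  have h2 : (projRes H z j j).im / z.im ≤ γ / z.im := by
    gcongr
    exact ((le_abs_self _).trans (Complex.abs_im_le_norm _)).trans h
  have h3 : (∑ k, ‖projRes H z k j‖) ^ 2 ≤
      (Fintype.card n * √(γ / (Fintype.card n * z.im))) ^ 2 := by
    have h0 : 0 ≤ γ := (norm_nonneg _).trans h
    rw [mul_pow, Real.sq_sqrt (by positivity)]
    refine h1.trans ((mul_le_mul_of_nonneg_left h2 hc.le).trans (le_of_eq ?_))
    field_simp
  exact le_of_sq_le_sq h3 (by positivity)

end Resolvent

section Switching

variable {N d : ℕ} {G : Fin N → Fin N → Bool}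

/-- The resolvent `projRes` of the rescaled adjacency matrix of a graph. -/
def graphRes (d : ℕ) (G : Fin N → Fin N → Bool) (z : ℂ) : Matrix (Fin N) (Fin N) ℂ :=
  projRes (HmatR N d (adjOf G)) z

lemma sum_adjOf (hG : IsRegGraph N d G) (i : Fin N) : ∑ j, adjOf G i j = d := by
  have := hG.2.2 i
  simp only [adjOf, Matrix.of_apply]
  rw [Finset.sum_boole]
  exact_mod_cast this

lemma sum_adjOf_col (hG : IsRegGraph N d G) (j : Fin N) : ∑ i, adjOf G i j = d := by
  rw [← sum_adjOf hG j]
  refine Finset.sum_congr rfl fun i _ => ?_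
  simp [adjOf, hG.1 i j]

lemma HmatR_isHermitian (hG : IsRegGraph N d G) : (HmatR N d (adjOf G)).IsHermitian := by
  ext i j
  simp [HmatR, adjOf, hG.1 i j]

lemma HmatR_row_sum (hN : 0 < N) (hG : IsRegGraph N d G) (i : Fin N) :
    ∑ j, HmatR N d (adjOf G) i j = 0 := by
  have hN' : (N : ℝ) ≠ 0 := by exact_mod_cast hN.ne'
  simp only [HmatR, Matrix.smul_apply, Matrix.sub_apply, Matrix.of_apply, smul_eq_mul,
    ← Finset.mul_sum, Finset.sum_sub_distrib, sum_adjOf hG i]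
  simp
  right
  field_simp
  simp

/-- The set of ordered pairs whose adjacency is changed by a switching. -/
def switchSet (i k p q x y : Fin N) : Bool :=
  ((x = i ∨ x = p) ∧ (y = k ∨ y = q)) ∨ ((x = k ∨ x = q) ∧ (y = i ∨ y = p))

/-- Replace the edges `ik` and `pq` by `iq` and `pk`. -/
def switch (G : Fin N → Fin N → Bool) (i k p q : Fin N) : Fin N → Fin N → Bool :=
  fun x y => xor (G x y) (switchSet i k p q x y)

/-- The switching of the edges `ik` and `pq` is admissible. -/
def Switchable (G : Fin N → Fin N → Bool) (i k p q : Fin N) : Prop :=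
  G i k = true ∧ G p q = true ∧ G i q = false ∧ G p k = false ∧ i ≠ q ∧ p ≠ k

lemma Switchable.ne (hG : IsRegGraph N d G) {i k p q : Fin N} (h : Switchable G i k p q) :
    i ≠ k ∧ p ≠ q ∧ i ≠ p ∧ k ≠ q := by
  obtain ⟨h1, h2, h3, h4, -, -⟩ := h
  have hd := hG.2.1
  refine ⟨?_, ?_, ?_, ?_⟩ <;> rintro rfl <;> simp_all

lemma switch_switch (G : Fin N → Fin N → Bool) (i k p q : Fin N) :
    switch (switch G i k p q) i q p k = G := by
  funext x y
  have : switchSet i q p k x y = switchSet i k p q x y := by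
    simp only [switchSet, or_comm (a := y = k), or_comm (a := x = k)]
  simp [switch, this]

lemma adjOf_switch (hG : IsRegGraph N d G) {i k p q : Fin N} (h : Switchable G i k p q)
    (x y : Fin N) : adjOf (switch G i k p q) x y = adjOf G x y +
      (((if x = i then 1 else 0) - (if x = p then 1 else 0)) *
        ((if y = q then 1 else 0) - (if y = k then 1 else 0)) +
      ((if x = q then 1 else 0) - (if x = k then 1 else 0)) *
        ((if y = i then 1 else 0) - (if y = p then 1 else 0))) := by
  obtain ⟨n1, n2, n3, n4⟩ := h.ne hG
  obtain ⟨h1, h2, h3, h4, n5, n6⟩ := h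
  have h1' := hG.1 i k
  have h2' := hG.1 p q
  have h3' := hG.1 i q
  have h4' := hG.1 p k
  rw [h1] at h1'
  rw [h2] at h2'
  rw [h3] at h3'
  rw [h4] at h4'
  simp only [adjOf, switch, switchSet, Matrix.of_apply]
  by_cases x1 : x = i
  · subst x1
    by_cases y1 : y = k
    · subst y1; simp_all
    by_cases y2 : y = q
    · subst y2; simp_all
    simp_all
  by_cases x2 : x = p
  · subst x2
    by_cases y1 : y = k
    · subst y1; simp_all
    by_cases y2 : y = q
    · subst y2; simp_all
    simp_all
  by_cases x3 : x = k
  · subst x3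
    by_cases y1 : y = i
    · subst y1; simp_all
    by_cases y2 : y = p
    · subst y2; simp_all
    simp_all
  by_cases x4 : x = q
  · subst x4
    by_cases y1 : y = i
    · subst y1; simp_all
    by_cases y2 : y = p
    · subst y2; simp_all
    simp_all
  simp_all

lemma IsRegGraph.switch (hG : IsRegGraph N d G) {i k p q : Fin N} (h : Switchable G i k p q) :
    IsRegGraph N d (switch G i k p q) := by
  obtain ⟨n1, n2, n3, n4⟩ := h.ne hG
  refine ⟨fun x y => ?_, fun x => ?_, fun x => ?_⟩
  · have : switchSet i k p q x y = switchSet i k p q y x := by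
      simp only [switchSet]
      congr 1
      rw [or_comm, and_comm, and_comm (a := x = i ∨ x = p)]
    simp only [_root_.switch, hG.1 x y, this]
  · have h5 := h.2.2.2.2.1
    have h6 := h.2.2.2.2.2
    have : switchSet i k p q x x = false := by
      simp only [switchSet, decide_eq_false_iff_not]
      grind
    simp [_root_.switch, hG.2.1 x, this]
  · have h1 : ∑ y, adjOf (_root_.switch G i k p q) x y = d := by
      simp only [adjOf_switch hG h, Finset.sum_add_distrib, sum_adjOf hG, ← Finset.mul_sum,
        Finset.sum_sub_distrib]
      simp
    simp only [adjOf, Matrix.of_apply] at h1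
    rw [Finset.sum_boole] at h1
    exact_mod_cast h1

lemma Switchable.symm (hG : IsRegGraph N d G) {i k p q : Fin N} (h : Switchable G i k p q) :
    Switchable (switch G i k p q) i q p k := by
  obtain ⟨n1, n2, n3, n4⟩ := h.ne hG
  obtain ⟨h1, h2, h3, h4, n5, n6⟩ := h
  refine ⟨?_, ?_, ?_, ?_, n1, n2⟩ <;> simp_all [switch, switchSet]

lemma mul_vecMulVec_mul_apply (A B : Matrix (Fin N) (Fin N) ℂ) (a b c e x y : Fin N) :
    (A * Matrix.vecMulVec (Pi.single a 1 - Pi.single b 1 : Fin N → ℂ)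
      (Pi.single c 1 - Pi.single e 1 : Fin N → ℂ) * B) x y =
      (A x a - A x b) * (B c y - B e y) := by
  rw [Matrix.mul_vecMulVec, Matrix.vecMulVec_mul, Matrix.mulVec_sub, Matrix.sub_vecMul]
  simp [Matrix.vecMulVec_apply]

lemma graphRes_switch_sub (hN : 0 < N) (hG : IsRegGraph N d G) {i k p q : Fin N}
    (h : Switchable G i k p q) {z : ℂ} (hz : z.im ≠ 0) (x y : Fin N) :
    graphRes d (switch G i k p q) z x y - graphRes d G z x y =
      -((√((d : ℝ) - 1))⁻¹ : ℝ) *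
        ((graphRes d G z x i - graphRes d G z x p) *
            (graphRes d (switch G i k p q) z q y - graphRes d (switch G i k p q) z k y) +
          (graphRes d G z x q - graphRes d G z x k) *
            (graphRes d (switch G i k p q) z i y - graphRes d (switch G i k p q) z p y)) := by
  have : Nonempty (Fin N) := ⟨⟨0, hN⟩⟩
  have hG' := hG.switch h
  have key := congrFun (congrFun (projRes_sub (HmatR_isHermitian hG) (HmatR_isHermitian hG') hz hz
    (HmatR_row_sum hN hG) (HmatR_row_sum hN hG')) x) y
  have e : (z - z) • (1 : Matrix (Fin N) (Fin N) ℂ) -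
      (HmatR N d (adjOf (switch G i k p q)) - HmatR N d (adjOf G)).map Complex.ofReal =
      -(((√((d : ℝ) - 1))⁻¹ : ℝ) : ℂ) •
        (Matrix.vecMulVec (Pi.single i 1 - Pi.single p 1) (Pi.single q 1 - Pi.single k 1) +
         Matrix.vecMulVec (Pi.single q 1 - Pi.single k 1) (Pi.single i 1 - Pi.single p 1)) := by
    ext a b
    simp only [HmatR, Matrix.sub_apply, Matrix.smul_apply, Matrix.map_apply, Matrix.of_apply,
      adjOf_switch hG h, smul_eq_mul, sub_self, zero_mul, Matrix.add_apply, Matrix.vecMulVec_apply,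
      Pi.sub_apply, Pi.single_apply]
    push_cast [apply_ite Complex.ofReal]
    ring
  rw [e, Matrix.sub_apply, Matrix.mul_smul, Matrix.smul_mul, Matrix.smul_apply, smul_eq_mul,
    Matrix.mul_add, Matrix.add_mul, Matrix.add_apply, mul_vecMulVec_mul_apply,
    mul_vecMulVec_mul_apply] at key
  exact key

lemma sum_adjOf_mul_graphRes (hN : 0 < N) (hd : 2 ≤ d) (hG : IsRegGraph N d G) {z : ℂ}
    (hz : z.im ≠ 0) (i j : Fin N) :
    ∑ k, (adjOf G i k : ℂ) * graphRes d G z k j = (√((d : ℝ) - 1) : ℝ) *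
      ((if i = j then 1 else 0) - 1 / (N : ℂ) + z * graphRes d G z i j) := by
  have : Nonempty (Fin N) := ⟨⟨0, hN⟩⟩
  have h := mul_projRes_apply (HmatR_isHermitian hG) hz (HmatR_row_sum hN hG) i j
  have h0 := projRes_col_sum (HmatR_isHermitian hG) hz (HmatR_row_sum hN hG) j
  rw [Fintype.card_fin] at h
  unfold graphRes
  rw [← h]
  have hq : ((√((d : ℝ) - 1) : ℝ) : ℂ) ≠ 0 := by
    have : (2 : ℝ) ≤ d := by exact_mod_cast hd
    exact Complex.ofReal_ne_zero.2 (Real.sqrt_pos.2 (by linarith)).ne'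
  have hH : ∀ k, (adjOf G i k : ℂ) = (√((d : ℝ) - 1) : ℝ) * (HmatR N d (adjOf G) i k : ℂ) +
      (d : ℂ) / N := by
    intro k
    simp only [HmatR, Matrix.smul_apply, Matrix.sub_apply, Matrix.of_apply, smul_eq_mul]
    push_cast
    field_simp
    ring
  simp only [hH, add_mul, Finset.sum_add_distrib, ← Finset.mul_sum, h0, mul_zero, add_zero,
    mul_assoc]

instance (G : Fin N → Fin N → Bool) (i k p q : Fin N) : Decidable (Switchable G i k p q) :=
  inferInstanceAs (Decidable (_ ∧ _))

lemma norm_switch_bilinear_le {r a b a' b' c e c' e' : ℂ} {ρ α β : ℝ} (hr : ‖r‖ ≤ ρ)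
    (h1 : ‖a‖ ≤ α) (h2 : ‖b‖ ≤ α) (h3 : ‖a'‖ ≤ α) (h4 : ‖b'‖ ≤ α)
    (h5 : ‖c‖ ≤ β) (h6 : ‖e‖ ≤ β) (h7 : ‖c'‖ ≤ β) (h8 : ‖e'‖ ≤ β) :
    ‖r * ((a - b) * (c - e) + (a' - b') * (c' - e'))‖ ≤ ρ * (8 * α * β) := by
  have hα : 0 ≤ α := (norm_nonneg _).trans h1
  have hβ : 0 ≤ β := (norm_nonneg _).trans h5
  have hρ : 0 ≤ ρ := (norm_nonneg _).trans hr
  rw [norm_mul]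
  refine mul_le_mul hr ?_ (norm_nonneg _) hρ
  refine (norm_add_le _ _).trans ?_
  rw [norm_mul, norm_mul]
  have e1 : ‖a - b‖ ≤ 2 * α := (norm_sub_le _ _).trans (by linarith)
  have e2 : ‖a' - b'‖ ≤ 2 * α := (norm_sub_le _ _).trans (by linarith)
  have e3 : ‖c - e‖ ≤ 2 * β := (norm_sub_le _ _).trans (by linarith)
  have e4 : ‖c' - e'‖ ≤ 2 * β := (norm_sub_le _ _).trans (by linarith)
  calc _ ≤ 2 * α * (2 * β) + 2 * α * (2 * β) := by gcongr
    _ = _ := by ring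

lemma graphRes_switch_bound (hN : 0 < N) (hG : IsRegGraph N d G) {i k p q : Fin N}
    (h : Switchable G i k p q) {z : ℂ} (hz : z.im ≠ 0) (hd : 128 ≤ √((d : ℝ) - 1))
    (hR : ∀ x y, ‖graphRes d G z x y‖ ≤ 8) (x y : Fin N) :
    ‖graphRes d (switch G i k p q) z x y‖ ≤ 16 ∧
      ‖graphRes d (switch G i k p q) z x y - graphRes d G z x y‖ ≤ 1024 / √((d : ℝ) - 1) := by
  have : Nonempty (Fin N) := ⟨⟨0, hN⟩⟩
  have hd0 : 0 < √((d : ℝ) - 1) := by linarith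
  obtain ⟨⟨x0, y0⟩, hmax⟩ := Finite.exists_max
    (fun w : Fin N × Fin N => ‖graphRes d (switch G i k p q) z w.1 w.2‖)
  set M := ‖graphRes d (switch G i k p q) z x0 y0‖ with hM
  have hM' : ∀ a b, ‖graphRes d (switch G i k p q) z a b‖ ≤ M := fun a b => hmax (a, b)
  have hr : ‖-(((√((d : ℝ) - 1))⁻¹ : ℝ) : ℂ)‖ ≤ (√((d : ℝ) - 1))⁻¹ := by
    rw [norm_neg, Complex.norm_real, Real.norm_of_nonneg (by positivity)]
  have hdiff : ∀ a b, ‖graphRes d (switch G i k p q) z a b - graphRes d G z a b‖ ≤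
      (√((d : ℝ) - 1))⁻¹ * (8 * 8 * M) := by
    intro a b
    rw [graphRes_switch_sub hN hG h hz a b]
    exact norm_switch_bilinear_le hr (hR _ _) (hR _ _) (hR _ _) (hR _ _) (hM' _ _) (hM' _ _)
      (hM' _ _) (hM' _ _)
  have hM0 : 0 ≤ M := norm_nonneg _
  have hM16 : M ≤ 16 := by
    have h1 := hdiff x0 y0
    have h2 : M ≤ ‖graphRes d G z x0 y0‖ +
        ‖graphRes d (switch G i k p q) z x0 y0 - graphRes d G z x0 y0‖ := by
      have := norm_add_le (graphRes d G z x0 y0)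
        (graphRes d (switch G i k p q) z x0 y0 - graphRes d G z x0 y0)
      rwa [add_sub_cancel] at this
    have h3 : (√((d : ℝ) - 1))⁻¹ ≤ 128⁻¹ := by gcongr
    have h4 : (√((d : ℝ) - 1))⁻¹ * (8 * 8 * M) ≤ 128⁻¹ * (8 * 8 * M) := by gcongr
    have := hR x0 y0
    linarith
  refine ⟨(hM' x y).trans hM16, (hdiff x y).trans ?_⟩
  rw [div_eq_inv_mul]
  gcongr
  linarith

end Switching

section Expansion

variable {N d : ℕ} {G : Fin N → Fin N → Bool}

/-- The sum over an edge `ik` at `i` and an oriented edge `pq`. -/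
def edgeSum (G : Fin N → Fin N → Bool) (i : Fin N) (f : Fin N → Fin N → Fin N → ℂ) : ℂ :=
  ∑ k, ∑ p, ∑ q, (adjOf G i k : ℂ) * (adjOf G p q : ℂ) * f k p q

lemma adjOf_nonneg (G : Fin N → Fin N → Bool) (i j : Fin N) : 0 ≤ adjOf G i j := by
  simp only [adjOf, Matrix.of_apply]
  split_ifs <;> norm_num

lemma norm_adjOf (G : Fin N → Fin N → Bool) (i j : Fin N) : ‖(adjOf G i j : ℂ)‖ = adjOf G i j := by
  rw [Complex.norm_real, Real.norm_of_nonneg (adjOf_nonneg G i j)]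

lemma edgeSum_add (i : Fin N) (f g : Fin N → Fin N → Fin N → ℂ) :
    edgeSum G i (fun k p q => f k p q + g k p q) = edgeSum G i f + edgeSum G i g := by
  simp only [edgeSum, mul_add, Finset.sum_add_distrib]

lemma edgeSum_sub (i : Fin N) (f g : Fin N → Fin N → Fin N → ℂ) :
    edgeSum G i (fun k p q => f k p q - g k p q) = edgeSum G i f - edgeSum G i g := by
  simp only [edgeSum, mul_sub, Finset.sum_sub_distrib]

lemma edgeSum_const_mul (i : Fin N) (c : ℂ) (f : Fin N → Fin N → Fin N → ℂ) :
    edgeSum G i (fun k p q => c * f k p q) = c * edgeSum G i f := by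
  simp only [edgeSum, mul_left_comm _ c, ← Finset.mul_sum]

lemma sum_adjOf_complex (hG : IsRegGraph N d G) (i : Fin N) : ∑ j, (adjOf G i j : ℂ) = d := by
  exact_mod_cast sum_adjOf hG i

lemma sum_adjOf_col_complex (hG : IsRegGraph N d G) (j : Fin N) :
    ∑ i, (adjOf G i j : ℂ) = d := by
  exact_mod_cast sum_adjOf_col hG j

lemma edgeSum_mul (i : Fin N) (f : Fin N → ℂ) (g : Fin N → Fin N → ℂ) :
    edgeSum G i (fun k p q => f k * g p q) =
      (∑ k, (adjOf G i k : ℂ) * f k) * ∑ p, ∑ q, (adjOf G p q : ℂ) * g p q := by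
  rw [edgeSum, Finset.sum_mul]
  refine Finset.sum_congr rfl fun k _ => ?_
  rw [Finset.mul_sum]
  refine Finset.sum_congr rfl fun p _ => ?_
  rw [Finset.mul_sum]
  refine Finset.sum_congr rfl fun q _ => ?_
  ring

lemma sum_sum_adjOf_fst (hG : IsRegGraph N d G) (g : Fin N → ℂ) :
    ∑ p, ∑ q, (adjOf G p q : ℂ) * g p = d * ∑ p, g p := by
  simp only [← Finset.sum_mul, sum_adjOf_complex hG, Finset.mul_sum]

lemma sum_sum_adjOf_snd (hG : IsRegGraph N d G) (g : Fin N → ℂ) :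
    ∑ p, ∑ q, (adjOf G p q : ℂ) * g q = d * ∑ q, g q := by
  rw [Finset.sum_comm]
  simp only [← Finset.sum_mul, sum_adjOf_col_complex hG, Finset.mul_sum]

lemma norm_edgeSum_le (i : Fin N) (f : Fin N → Fin N → Fin N → ℂ) :
    ‖edgeSum G i f‖ ≤ ∑ k, ∑ p, ∑ q, adjOf G i k * adjOf G p q * ‖f k p q‖ := by
  refine (norm_sum_le _ _).trans (Finset.sum_le_sum fun k _ => ?_)
  refine (norm_sum_le _ _).trans (Finset.sum_le_sum fun p _ => ?_)
  refine (norm_sum_le _ _).trans (Finset.sum_le_sum fun q _ => ?_)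
  rw [norm_mul, norm_mul, norm_adjOf, norm_adjOf]

lemma norm_edgeSum_le_snd (hG : IsRegGraph N d G) (i : Fin N) {f : Fin N → Fin N → Fin N → ℂ}
    {c : Fin N → Fin N → ℝ} {B : ℝ} (hf : ∀ k p q, ‖f k p q‖ ≤ c k q) (hc : ∀ k, ∑ q, c k q ≤ B) :
    ‖edgeSum G i f‖ ≤ d * (d * B) := by
  refine (norm_edgeSum_le i f).trans ?_
  calc _ ≤ ∑ k, ∑ p, ∑ q, adjOf G i k * (adjOf G p q * c k q) := by
        refine Finset.sum_le_sum fun k _ => Finset.sum_le_sum fun p _ => Finset.sum_le_sum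
          fun q _ => ?_
        rw [mul_assoc]
        have := adjOf_nonneg G i k
        have := adjOf_nonneg G p q
        gcongr
        exact hf k p q
    _ = ∑ k, adjOf G i k * (d * ∑ q, c k q) := by
        refine Finset.sum_congr rfl fun k _ => ?_
        rw [Finset.sum_comm]
        simp only [← Finset.mul_sum, ← Finset.sum_mul, sum_adjOf_col hG]
    _ ≤ ∑ k, adjOf G i k * (d * B) := by
        refine Finset.sum_le_sum fun k _ => ?_
        have := adjOf_nonneg G i k
        gcongr
        exact hc k
    _ = _ := by rw [← Finset.sum_mul, sum_adjOf hG]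

lemma norm_edgeSum_le_fst (hG : IsRegGraph N d G) (i : Fin N) {f : Fin N → Fin N → Fin N → ℂ}
    {c : Fin N → Fin N → ℝ} {B : ℝ} (hf : ∀ k p q, ‖f k p q‖ ≤ c k p) (hc : ∀ k, ∑ p, c k p ≤ B) :
    ‖edgeSum G i f‖ ≤ d * (d * B) := by
  have h : edgeSum G i f = edgeSum G i fun k p q => f k q p := by
    refine Finset.sum_congr rfl fun k _ => ?_
    rw [Finset.sum_comm]
    refine Finset.sum_congr rfl fun p _ => Finset.sum_congr rfl fun q _ => ?_
    simp only [adjOf, Matrix.of_apply, hG.1 q p]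
  rw [h]
  exact norm_edgeSum_le_snd hG i (fun k p q => hf k q p) hc

/-- The antisymmetric observable attached to a switching. -/
def switchObs (d : ℕ) (G : Fin N → Fin N → Bool) (z : ℂ) (i j k p q : Fin N) : ℂ :=
  graphRes d G z k j - graphRes d (switch G i k p q) z q j

/-- The first-order approximation of `switchObs` in terms of the unswitched graph. -/
def switchObsApprox (d : ℕ) (G : Fin N → Fin N → Bool) (z : ℂ) (i j k p q : Fin N) : ℂ :=
  graphRes d G z k j - graphRes d G z q j + (((√((d : ℝ) - 1))⁻¹ : ℝ) : ℂ) *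
    ((graphRes d G z q i - graphRes d G z q p) * (graphRes d G z q j - graphRes d G z k j) +
     (graphRes d G z q q - graphRes d G z q k) * (graphRes d G z i j - graphRes d G z p j))

lemma switchObs_sub_approx (hN : 0 < N) (hG : IsRegGraph N d G) {i k p q : Fin N}
    (h : Switchable G i k p q) {z : ℂ} (hz : z.im ≠ 0) (hd : 128 ≤ √((d : ℝ) - 1))
    (hR : ∀ x y, ‖graphRes d G z x y‖ ≤ 8) (j : Fin N) :
    ‖switchObs d G z i j k p q - switchObsApprox d G z i j k p q‖ ≤
      65536 / √((d : ℝ) - 1) ^ 2 := by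
  have hd0 : 0 < √((d : ℝ) - 1) := by linarith
  have hb := fun x y => (graphRes_switch_bound hN hG h hz hd hR x y).2
  have h1 := graphRes_switch_sub hN hG h hz q j
  have e : switchObs d G z i j k p q - switchObsApprox d G z i j k p q =
      (((√((d : ℝ) - 1))⁻¹ : ℝ) : ℂ) *
      ((graphRes d G z q i - graphRes d G z q p) *
        ((graphRes d (switch G i k p q) z q j - graphRes d G z q j) -
          (graphRes d (switch G i k p q) z k j - graphRes d G z k j)) +
      (graphRes d G z q q - graphRes d G z q k) *
        ((graphRes d (switch G i k p q) z i j - graphRes d G z i j) -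
          (graphRes d (switch G i k p q) z p j - graphRes d G z p j))) := by
    rw [switchObs, switchObsApprox]
    linear_combination -h1
  rw [e]
  have hr : ‖(((√((d : ℝ) - 1))⁻¹ : ℝ) : ℂ)‖ ≤ (√((d : ℝ) - 1))⁻¹ := by
    rw [Complex.norm_real, Real.norm_of_nonneg (by positivity)]
  refine (norm_switch_bilinear_le hr (hR _ _) (hR _ _) (hR _ _) (hR _ _) (hb _ _) (hb _ _)
      (hb _ _) (hb _ _)).trans (le_of_eq ?_)
  field_simp
  norm_num

lemma norm_switchObsApprox_le (hd : 128 ≤ √((d : ℝ) - 1)) {z : ℂ}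
    (hR : ∀ x y, ‖graphRes d G z x y‖ ≤ 8) (i j k p q : Fin N) :
    ‖switchObsApprox d G z i j k p q‖ ≤ 20 := by
  have hd0 : 0 < √((d : ℝ) - 1) := by linarith
  have hr : ‖(((√((d : ℝ) - 1))⁻¹ : ℝ) : ℂ)‖ ≤ 128⁻¹ := by
    rw [Complex.norm_real, Real.norm_of_nonneg (by positivity)]
    gcongr
  refine (norm_add_le _ _).trans ?_
  have h1 := norm_switch_bilinear_le hr (hR q i) (hR q p) (hR q q) (hR q k) (hR q j) (hR k j)
      (hR i j) (hR p j)
  have h2 := norm_sub_le (graphRes d G z k j) (graphRes d G z q j)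
  have := hR k j
  have := hR q j
  linarith

lemma sum_not_switchable_le (hG : IsRegGraph N d G) (i : Fin N) (hd : 1 ≤ d) :
    ∑ k, ∑ p, ∑ q, adjOf G i k * adjOf G p q *
      (adjOf G i q + adjOf G p k + (if i = q then 1 else 0) + (if p = k then 1 else 0)) ≤
      4 * (d : ℝ) ^ 3 := by
  have hd' : (1 : ℝ) ≤ d := by exact_mod_cast hd
  simp only [mul_add, Finset.sum_add_distrib]
  have h1 : ∑ k, ∑ p, ∑ q, adjOf G i k * adjOf G p q * adjOf G i q = (d : ℝ) ^ 3 := by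
    calc _ = ∑ k, adjOf G i k * ∑ q, (∑ p, adjOf G p q) * adjOf G i q := by
          refine Finset.sum_congr rfl fun k _ => ?_
          rw [Finset.sum_comm, Finset.mul_sum]
          refine Finset.sum_congr rfl fun q _ => ?_
          rw [Finset.sum_mul, Finset.mul_sum]
          exact Finset.sum_congr rfl fun p _ => by ring
      _ = _ := by
          simp only [sum_adjOf_col hG, ← Finset.mul_sum, ← Finset.sum_mul, sum_adjOf hG]
          ring
  have h2 : ∑ k, ∑ p, ∑ q, adjOf G i k * adjOf G p q * adjOf G p k = (d : ℝ) ^ 3 := by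
    calc _ = ∑ k, adjOf G i k * ∑ p, (∑ q, adjOf G p q) * adjOf G p k := by
          refine Finset.sum_congr rfl fun k _ => ?_
          rw [Finset.mul_sum]
          refine Finset.sum_congr rfl fun q _ => ?_
          rw [Finset.sum_mul, Finset.mul_sum]
          exact Finset.sum_congr rfl fun p _ => by ring
      _ = _ := by
          simp only [sum_adjOf_col hG, ← Finset.mul_sum, ← Finset.sum_mul, sum_adjOf hG]
          ring
  have h3 : ∑ k, ∑ p, ∑ q, adjOf G i k * adjOf G p q * (if i = q then 1 else 0) =
      (d : ℝ) ^ 2 := by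
    simp only [mul_ite, mul_one, mul_zero, Finset.sum_ite_eq, Finset.mem_univ, if_true,
      ← Finset.mul_sum, sum_adjOf_col hG, ← Finset.sum_mul, sum_adjOf hG]
    ring
  have h4 : ∑ k, ∑ p, ∑ q, adjOf G i k * adjOf G p q * (if p = k then 1 else 0) =
      (d : ℝ) ^ 2 := by
    simp only [mul_ite, mul_one, mul_zero]
    calc _ = ∑ k, adjOf G i k * ∑ q, adjOf G k q := by
          refine Finset.sum_congr rfl fun k _ => ?_
          rw [Finset.sum_comm, Finset.mul_sum]
          exact Finset.sum_congr rfl fun q _ => by simp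
      _ = _ := by
          simp only [sum_adjOf hG, ← Finset.sum_mul]
          ring
  rw [h1, h2, h3, h4]
  nlinarith [mul_le_mul_of_nonneg_left hd' (sq_nonneg (d : ℝ))]

/-- The normalized trace of `graphRes`. -/
def graphS (d : ℕ) (G : Fin N → Fin N → Bool) (z : ℂ) : ℂ :=
  (1 / (N : ℂ)) * ∑ k, graphRes d G z k k

/-- The sum of `switchObs` over all admissible switchings at `i`. -/
def switchSum (d : ℕ) (G : Fin N → Fin N → Bool) (z : ℂ) (i j : Fin N) : ℂ :=
  ∑ k, ∑ p, ∑ q, if Switchable G i k p q then switchObs d G z i j k p q else 0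

lemma switchSum_sub_edgeSum (hN : 0 < N) (hG : IsRegGraph N d G) {z : ℂ} (hz : z.im ≠ 0)
    (hd : 128 ≤ √((d : ℝ) - 1)) (hd1 : 1 ≤ d) (hR : ∀ x y, ‖graphRes d G z x y‖ ≤ 8)
    (i j : Fin N) :
    ‖switchSum d G z i j - edgeSum G i (switchObsApprox d G z i j)‖ ≤
      d * (N * d) * (65536 / √((d : ℝ) - 1) ^ 2) + 20 * (4 * (d : ℝ) ^ 3) := by
  have hd0 : 0 < √((d : ℝ) - 1) := by linarith
  have h1 : ∀ k p q, ‖(if Switchable G i k p q then switchObs d G z i j k p q else 0) -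
      (adjOf G i k : ℂ) * (adjOf G p q : ℂ) * switchObsApprox d G z i j k p q‖ ≤
      adjOf G i k * adjOf G p q * (65536 / √((d : ℝ) - 1) ^ 2) +
      20 * (adjOf G i k * adjOf G p q *
      (adjOf G i q + adjOf G p k + (if i = q then 1 else 0) + (if p = k then 1 else 0))) := by
    intro k p q
    have a1 := adjOf_nonneg G i k
    have a2 := adjOf_nonneg G p q
    have a3 := adjOf_nonneg G i q
    have a4 := adjOf_nonneg G p k
    have a5 : (0 : ℝ) ≤ if i = q then 1 else 0 := by split_ifs <;> norm_num
    have a6 : (0 : ℝ) ≤ if p = k then 1 else 0 := by split_ifs <;> norm_num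
    by_cases h : Switchable G i k p q
    · have e1 : adjOf G i k = 1 := by simp [adjOf, h.1]
      have e2 : adjOf G p q = 1 := by simp [adjOf, h.2.1]
      rw [if_pos h, e1, e2]
      have := switchObs_sub_approx hN hG h hz hd hR j
      simp only [Complex.ofReal_one, one_mul]
      linarith
    · rw [if_neg h, zero_sub, norm_neg, norm_mul, norm_mul, norm_adjOf, norm_adjOf]
      have h2 := norm_switchObsApprox_le hd hR i j k p q
      have h3 : adjOf G i k * adjOf G p q ≤ adjOf G i k * adjOf G p q *
          (adjOf G i q + adjOf G p k + (if i = q then 1 else 0) + (if p = k then 1 else 0)) := by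
        by_cases g1 : G i k = true
        · by_cases g2 : G p q = true
          · have : 1 ≤ adjOf G i q + adjOf G p k + (if i = q then 1 else 0) +
                (if p = k then (1 : ℝ) else 0) := by
              by_cases g3 : G i q = true
              · have : adjOf G i q = 1 := by simp [adjOf, g3]
                linarith
              by_cases g4 : G p k = true
              · have : adjOf G p k = 1 := by simp [adjOf, g4]
                linarith
              by_cases g5 : i = q
              · rw [if_pos g5] at a5 ⊢
                linarith
              by_cases g6 : p = k
              · rw [if_pos g6] at a6 ⊢
                linarith
              exact absurd ⟨g1, g2, by simpa using g3, by simpa using g4, g5, g6⟩ h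
            exact le_mul_of_one_le_right (by positivity) this
          · have : adjOf G p q = 0 := by simp [adjOf, g2]
            simp [this]
        · have : adjOf G i k = 0 := by simp [adjOf, g1]
          simp [this]
      calc _ ≤ adjOf G i k * adjOf G p q * 20 := by gcongr
        _ ≤ 0 + 20 * (adjOf G i k * adjOf G p q * (adjOf G i q + adjOf G p k +
            (if i = q then 1 else 0) + (if p = k then 1 else 0))) := by linarith
        _ ≤ _ := by gcongr; positivity
  have h2 : switchSum d G z i j - edgeSum G i (switchObsApprox d G z i j) =
      ∑ k, ∑ p, ∑ q, ((if Switchable G i k p q then switchObs d G z i j k p q else 0) -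
      (adjOf G i k : ℂ) * (adjOf G p q : ℂ) * switchObsApprox d G z i j k p q) := by
    simp only [switchSum, edgeSum, Finset.sum_sub_distrib]
  rw [h2]
  calc _ ≤ ∑ k, ∑ p, ∑ q, (adjOf G i k * adjOf G p q * (65536 / √((d : ℝ) - 1) ^ 2) +
      20 * (adjOf G i k * adjOf G p q *
      (adjOf G i q + adjOf G p k + (if i = q then 1 else 0) + (if p = k then 1 else 0)))) := by
        refine (norm_sum_le _ _).trans (Finset.sum_le_sum fun k _ => ?_)
        refine (norm_sum_le _ _).trans (Finset.sum_le_sum fun p _ => ?_)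
        exact (norm_sum_le _ _).trans (Finset.sum_le_sum fun q _ => h1 k p q)
    _ ≤ _ := by
        simp only [Finset.sum_add_distrib]
        refine add_le_add (le_of_eq ?_) ?_
        · simp only [← Finset.sum_mul, ← Finset.mul_sum, sum_adjOf hG]
          simp only [Finset.sum_const, Finset.card_univ, Fintype.card_fin, nsmul_eq_mul,
            ← Finset.mul_sum, sum_adjOf hG]
          ring
        · simp only [← Finset.mul_sum]
          exact mul_le_mul_of_nonneg_left (by
            simpa only [← Finset.mul_sum] using sum_not_switchable_le hG i hd1) (by norm_num)

lemma edgeSum_approx (hN : 0 < N) (hG : IsRegGraph N d G) {z : ℂ} (hz : 0 < z.im)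
    (hR : ∀ x y, ‖graphRes d G z x y‖ ≤ 8) (i j : Fin N) :
    ∃ B : ℂ, ‖B‖ ≤ 40 * (d * (d * (N * √(8 / (N * z.im))))) ∧
    edgeSum G i (switchObsApprox d G z i j) =
      (∑ k, (adjOf G i k : ℂ) * graphRes d G z k j) * (d * N) + (((√((d : ℝ) - 1))⁻¹ : ℝ) : ℂ) *
        (B + (∑ k, (adjOf G i k : ℂ) * graphRes d G z k j) *
          (∑ p, ∑ q, (adjOf G p q : ℂ) * graphRes d G z q p) +
          graphRes d G z i j * (d * (d * (N * graphS d G z)))) := by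
  have : Nonempty (Fin N) := ⟨⟨0, hN⟩⟩
  have hNC : (N : ℂ) ≠ 0 := by exact_mod_cast hN.ne'
  set R := graphRes d G z with hRdef
  have hcol : ∀ j, ∑ k, R k j = 0 :=
    projRes_col_sum (HmatR_isHermitian hG) hz.ne' (HmatR_row_sum hN hG)
  have hward : ∀ j, ∑ k, ‖R k j‖ ≤ N * √(8 / (N * z.im)) := by
    intro j
    have := sum_norm_le_of_ward (HmatR_isHermitian hG) hz (HmatR_row_sum hN hG) j (hR j j)
    rwa [Fintype.card_fin] at this
  set β := N * √(8 / (N * z.im)) with hβ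
  have hb : ∀ j, ∑ k, 8 * ‖R k j‖ ≤ 8 * β := by
    intro j
    rw [← Finset.mul_sum]
    exact mul_le_mul_of_nonneg_left (hward j) (by norm_num)
  have hmul : ∀ a b c e, ‖R a b * R c e‖ ≤ 8 * ‖R a b‖ := by
    intro a b c e
    rw [norm_mul, mul_comm]
    exact mul_le_mul_of_nonneg_right (hR _ _) (norm_nonneg _)
  have hmul' : ∀ a b c e, ‖R a b * R c e‖ ≤ 8 * ‖R c e‖ := by
    intro a b c e
    rw [norm_mul]
    exact mul_le_mul_of_nonneg_right (hR _ _) (norm_nonneg _)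
  have b1 : ‖edgeSum G i fun k p q => R q i * R q j‖ ≤ d * (d * (8 * β)) :=
    norm_edgeSum_le_snd hG i (c := fun _ q => 8 * ‖R q i‖) (fun k p q => hmul _ _ _ _)
      (fun _ => hb i)
  have b2 : ‖edgeSum G i fun k p q => R q p * R q j‖ ≤ d * (d * (8 * β)) :=
    norm_edgeSum_le_snd hG i (c := fun _ q => 8 * ‖R q j‖) (fun k p q => hmul' _ _ _ _)
      (fun _ => hb j)
  have b3 : ‖edgeSum G i fun k p q => R q q * R p j‖ ≤ d * (d * (8 * β)) :=
    norm_edgeSum_le_fst hG i (c := fun _ p => 8 * ‖R p j‖) (fun k p q => hmul' _ _ _ _)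
      (fun _ => hb j)
  have b4 : ‖edgeSum G i fun k p q => R q k * R i j‖ ≤ d * (d * (8 * β)) :=
    norm_edgeSum_le_snd hG i (c := fun k q => 8 * ‖R q k‖) (fun k p q => hmul _ _ _ _)
      (fun k => hb k)
  have b5 : ‖edgeSum G i fun k p q => R q k * R p j‖ ≤ d * (d * (8 * β)) :=
    norm_edgeSum_le_fst hG i (c := fun _ p => 8 * ‖R p j‖) (fun k p q => hmul' _ _ _ _)
      (fun _ => hb j)
  refine ⟨edgeSum G i (fun k p q => R q i * R q j) - edgeSum G i (fun k p q => R q p * R q j) -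
    edgeSum G i (fun k p q => R q q * R p j) - edgeSum G i (fun k p q => R q k * R i j) +
    edgeSum G i (fun k p q => R q k * R p j), ?_, ?_⟩
  · refine (norm_add_le _ _).trans ?_
    have n1 := norm_sub_le (edgeSum G i (fun k p q => R q i * R q j) -
      edgeSum G i (fun k p q => R q p * R q j) -
      edgeSum G i (fun k p q => R q q * R p j)) (edgeSum G i (fun k p q => R q k * R i j))
    have n2 := norm_sub_le (edgeSum G i (fun k p q => R q i * R q j) -
      edgeSum G i (fun k p q => R q p * R q j)) (edgeSum G i (fun k p q => R q q * R p j))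
    have n3 := norm_sub_le (edgeSum G i (fun k p q => R q i * R q j))
      (edgeSum G i (fun k p q => R q p * R q j))
    nlinarith
  · have e1 : edgeSum G i (fun k p q => R k j * 1) =
        (∑ k, (adjOf G i k : ℂ) * R k j) * (d * N) := by
      rw [edgeSum_mul i (fun k => R k j) (fun _ _ => 1), sum_sum_adjOf_fst hG fun _ => 1]
      simp
    have e2 : edgeSum G i (fun k p q => 1 * R q j) = 0 := by
      rw [edgeSum_mul i (fun k => 1) (fun _ q => R q j), sum_sum_adjOf_snd hG fun q => R q j, hcol]
      simp
    have e3 : edgeSum G i (fun k p q => R k j * (R q p - R q i)) =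
        (∑ k, (adjOf G i k : ℂ) * R k j) * (∑ p, ∑ q, (adjOf G p q : ℂ) * R q p) := by
      rw [edgeSum_mul i (fun k => R k j) (fun p q => R q p - R q i)]
      simp only [mul_sub, Finset.sum_sub_distrib]
      rw [sum_sum_adjOf_snd hG fun q => R q i, hcol]
      ring
    have e4 : edgeSum G i (fun k p q => R i j * (1 * R q q)) =
        R i j * (d * (d * (N * graphS d G z))) := by
      rw [edgeSum_const_mul, edgeSum_mul i (fun k => 1) (fun _ q => R q q),
        sum_sum_adjOf_snd hG fun q => R q q]
      simp only [mul_one, sum_adjOf_complex hG, graphS, ← hRdef]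
      field_simp
    have e5 : edgeSum G i (fun k p q => R k j * 1 - 1 * R q j) =
        (∑ k, (adjOf G i k : ℂ) * R k j) * (d * N) := by
      rw [edgeSum_sub, e1, e2, sub_zero]
    rw [← e5, ← e3, ← e4, ← edgeSum_sub, ← edgeSum_sub, ← edgeSum_sub, ← edgeSum_add, ← edgeSum_add,
      ← edgeSum_add, ← edgeSum_const_mul, ← edgeSum_add]
    congr 1
    funext k p q
    simp only [switchObsApprox, ← hRdef]
    ring

/-- To leading order the switching observable sums to the self-consistent equation. -/
lemma switchSum_expansion (hN : 0 < N) (hG : IsRegGraph N d G) {z : ℂ} (hz : 0 < z.im)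
    (hd : 128 ≤ √((d : ℝ) - 1)) (hR : ∀ x y, ‖graphRes d G z x y‖ ≤ 8)
    (hzR : ∀ x y, ‖z‖ * ‖graphRes d G z x y‖ ≤ 24) {ε : ℝ} (h1 : (√(d : ℝ))⁻¹ ≤ ε)
    (h2 : √(d : ℝ) ^ 3 / N ≤ ε) (i j : Fin N) :
    ‖switchSum d G z i j / ((√((d : ℝ) - 1) : ℝ) * N * d) -
      ((if i = j then 1 else 0) + (z + graphS d G z) * graphRes d G z i j)‖ ≤
      530000 * ((√(N * z.im))⁻¹ + ε) := by
  set Q := √((d : ℝ) - 1) with hQ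
  set x := √(d : ℝ) with hx
  have hQ0 : 0 < Q := by linarith
  have hd1 : (128 : ℝ) ≤ d - 1 := by
    by_contra! hc
    have : Q ≤ √128 := Real.sqrt_le_sqrt hc.le
    have h' : √(128 : ℝ) < 128 := by
      rw [Real.sqrt_lt' (by norm_num)]; norm_num
    linarith
  have hd2 : 2 ≤ d := by
    have : (2 : ℝ) ≤ d := by linarith
    exact_mod_cast this
  have hQ2 : Q ^ 2 = d - 1 := Real.sq_sqrt (by linarith)
  have hx2 : x ^ 2 = d := Real.sq_sqrt (by linarith)
  have hx0 : 0 < x := Real.sqrt_pos.2 (by linarith)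
  have hx1 : 1 ≤ x := Real.one_le_sqrt.2 (by linarith)
  have hxQ : x ≤ 2 * Q := by
    refine le_of_sq_le_sq ?_ (by positivity)
    nlinarith
  have hNR : (0 : ℝ) < N := by exact_mod_cast hN
  have hN1 : (1 : ℝ) ≤ N := by exact_mod_cast hN
  have hd0 : (0 : ℝ) < d := by linarith
  have hNC : (N : ℂ) ≠ 0 := by exact_mod_cast hN.ne'
  have hdC : (d : ℂ) ≠ 0 := by exact_mod_cast (by omega : d ≠ 0)
  have hQC : (Q : ℂ) ≠ 0 := Complex.ofReal_ne_zero.2 hQ0.ne'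
  obtain ⟨B, hB, hES⟩ := edgeSum_approx hN hG hz hR i j
  have hdiff := switchSum_sub_edgeSum hN hG hz.ne' hd (by omega) hR i j
  set X := ∑ k, (adjOf G i k : ℂ) * graphRes d G z k j with hX
  set Y := ∑ p, ∑ q, (adjOf G p q : ℂ) * graphRes d G z q p with hY
  set s := graphS d G z with hs
  set R := graphRes d G z with hRdef
  set S := switchSum d G z i j with hS
  set ES := edgeSum G i (switchObsApprox d G z i j) with hESdef
  rw [← hQ] at hES hdiff
  have hone : ∀ a b : Fin N, ‖((if a = b then 1 else 0 : ℂ)) - 1 / (N : ℂ) + z * R a b‖ ≤ 26 := by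
    intro a b
    have t1 : ‖(if a = b then 1 else 0 : ℂ)‖ ≤ 1 := by split_ifs <;> simp
    have t2 : ‖1 / (N : ℂ)‖ ≤ 1 := by
      rw [norm_div, norm_one, Complex.norm_natCast]
      exact (div_le_one hNR).2 hN1
    have t3 := hzR a b
    rw [← norm_mul] at t3
    exact (norm_add_le _ _).trans (by
      have := norm_sub_le ((if a = b then 1 else 0 : ℂ)) (1 / (N : ℂ))
      linarith)
  have hX1 : X = Q * ((if i = j then 1 else 0) - 1 / (N : ℂ) + z * R i j) :=
    sum_adjOf_mul_graphRes hN hd2 hG hz.ne' i j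
  have hXn : ‖X‖ ≤ Q * 26 := by
    rw [hX1, norm_mul, Complex.norm_real, Real.norm_of_nonneg hQ0.le]
    exact mul_le_mul_of_nonneg_left (hone i j) hQ0.le
  have hYn : ‖Y‖ ≤ N * (Q * 26) := by
    refine (norm_sum_le _ _).trans ?_
    calc _ ≤ ∑ p : Fin N, Q * 26 := by
          refine Finset.sum_le_sum fun p _ => ?_
          rw [sum_adjOf_mul_graphRes hN hd2 hG hz.ne' p p, norm_mul, Complex.norm_real,
            Real.norm_of_nonneg hQ0.le]
          exact mul_le_mul_of_nonneg_left (hone p p) hQ0.le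
      _ = _ := by simp
  have hsn : ‖s‖ ≤ 8 := by
    rw [hs, graphS, norm_mul, norm_div, norm_one, Complex.norm_natCast]
    have : ‖∑ k, R k k‖ ≤ N * 8 := by
      refine (norm_sum_le _ _).trans ((Finset.sum_le_sum fun k _ => hR k k).trans (le_of_eq ?_))
      simp
    calc _ ≤ 1 / (N : ℝ) * (N * 8) := by gcongr
      _ = 8 := by field_simp
  have key : S / (Q * N * d) - ((if i = j then 1 else 0) + (z + s) * R i j) =
      (S - ES) / (Q * N * d) + (-(1 / (N : ℂ)) + (B / (Q ^ 2 * N * d) + (X * Y / (Q ^ 2 * N * d) +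
        s * R i j / Q ^ 2))) := by
    have hQC2 : (Q : ℂ) ^ 2 = d - 1 := by exact_mod_cast congrArg Complex.ofReal hQ2
    rw [hES]
    push_cast
    have hXq : X / Q = ((if i = j then 1 else 0) - 1 / (N : ℂ) + z * R i j) := by
      rw [hX1]; field_simp
    have e : s * R i j / (Q : ℂ) ^ 2 = s * R i j * (d / (Q : ℂ) ^ 2 - 1) := by
      rw [div_sub_one (pow_ne_zero 2 hQC), hQC2]
      ring
    rw [e]
    have hX1' : X = Q * (X / Q) := by field_simp
    field_simp
    rw [hX1]
    field_simp
    ring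
  rw [key]
  have hQNd : ‖((Q : ℂ) * N * d)‖ = Q * N * d := by
    simp [abs_of_pos hQ0]
  have hQNd2 : ‖((Q : ℂ) ^ 2 * N * d)‖ = Q ^ 2 * N * d := by
    simp
  have hQ2n : ‖(Q : ℂ) ^ 2‖ = Q ^ 2 := by simp
  have n1 : ‖(S - ES) / (Q * N * d)‖ ≤ 524288 * ε + 160 * ε := by
    rw [norm_div, hQNd]
    calc _ ≤ (d * (N * d) * (65536 / Q ^ 2) + 20 * (4 * (d : ℝ) ^ 3)) / (Q * N * d) := by gcongr
      _ = 65536 * (d / Q ^ 3) + 80 * (d ^ 2 / (Q * N)) := by field_simp; ring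
      _ ≤ 65536 * (8 * x⁻¹) + 80 * (2 * (x ^ 3 / N)) := by
          rw [← hx2]
          gcongr
          · rw [div_le_iff₀ (by positivity)]
            have : x ^ 3 ≤ (2 * Q) ^ 3 := by gcongr
            calc x ^ 2 = x⁻¹ * x ^ 3 := by field_simp
              _ ≤ x⁻¹ * (2 * Q) ^ 3 := by gcongr
              _ = _ := by ring
          · rw [div_le_iff₀ (by positivity)]
            calc (x ^ 2) ^ 2 = x ^ 3 * x := by ring
              _ ≤ x ^ 3 * (2 * Q) := by gcongr
              _ = _ := by field_simp
      _ ≤ _ := by linarith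
  have n2 : ‖-(1 / (N : ℂ))‖ ≤ ε := by
    rw [norm_neg, norm_div, norm_one, Complex.norm_natCast]
    refine le_trans ?_ h2
    gcongr
    exact one_le_pow₀ hx1
  have hinv : 1 / (d : ℝ) ≤ ε := by
    refine le_trans ?_ h1
    rw [← hx2, one_div]
    gcongr
    nlinarith
  have hQd : (d : ℝ) ≤ 2 * Q ^ 2 := by rw [hQ2]; linarith
  have n3 : ‖B / (Q ^ 2 * N * d)‖ ≤ 240 * (√(N * z.im))⁻¹ := by
    rw [norm_div, hQNd2]
    have hsq : √(8 / (N * z.im)) ≤ 3 * (√(N * z.im))⁻¹ := by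
      rw [Real.sqrt_div (by norm_num), div_eq_mul_inv]
      gcongr
      rw [Real.sqrt_le_left (by norm_num)]
      norm_num
    calc _ ≤ 40 * (d * (d * (N * √(8 / (N * z.im))))) / (Q ^ 2 * N * d) := by gcongr
      _ = 40 * (d / Q ^ 2) * √(8 / (N * z.im)) := by field_simp
      _ ≤ 40 * 2 * (3 * (√(N * z.im))⁻¹) := by
          gcongr
          rw [div_le_iff₀ (by positivity)]
          linarith
      _ = _ := by ring
  have n4 : ‖X * Y / (Q ^ 2 * N * d)‖ ≤ 676 * ε := by
    rw [norm_div, norm_mul, hQNd2]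
    calc _ ≤ Q * 26 * (N * (Q * 26)) / (Q ^ 2 * N * d) := by gcongr
      _ = 676 * (1 / d) := by field_simp; norm_num
      _ ≤ _ := by gcongr
  have n5 : ‖s * R i j / (Q : ℂ) ^ 2‖ ≤ 128 * ε := by
    rw [norm_div, norm_mul, hQ2n]
    calc _ ≤ 8 * 8 / Q ^ 2 := by
          gcongr
          exact hR i j
      _ ≤ 128 * (1 / d) := by
          rw [div_le_iff₀ (by positivity)]
          calc (8 * 8 : ℝ) = 64 * (1 / d) * d := by field_simp; norm_num
            _ ≤ 64 * (1 / d) * (2 * Q ^ 2) := by gcongr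
            _ = _ := by ring
      _ ≤ _ := by gcongr
  have a1 := norm_add_le ((S - ES) / (Q * N * d)) (-(1 / (N : ℂ)) + (B / (Q ^ 2 * N * d) +
    (X * Y / (Q ^ 2 * N * d) + s * R i j / Q ^ 2)))
  have a2 := norm_add_le (-(1 / (N : ℂ))) (B / (Q ^ 2 * N * d) +
    (X * Y / (Q ^ 2 * N * d) + s * R i j / Q ^ 2))
  have a3 := norm_add_le (B / (Q ^ 2 * N * d)) (X * Y / (Q ^ 2 * N * d) + s * R i j / Q ^ 2)
  have a4 := norm_add_le (X * Y / (Q ^ 2 * N * d)) (s * R i j / (Q : ℂ) ^ 2)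
  have hε : 0 ≤ ε := le_trans (by positivity) h1
  have hw : 0 ≤ (√(N * z.im))⁻¹ := by positivity
  linarith

end Expansion

section ExchangeablePairs

lemma abs_exp_sub_exp_le (x y : ℝ) :
    |Real.exp x - Real.exp y| ≤ |x - y| * Real.exp |x - y| * Real.exp x := by
  have h1 : Real.exp x - Real.exp y = Real.exp x * (1 - Real.exp (y - x)) := by
    rw [mul_sub, ← Real.exp_add]; ring_nf
  rw [h1, abs_mul, abs_of_pos (Real.exp_pos x), mul_comm]
  refine mul_le_mul_of_nonneg_right ?_ (Real.exp_pos x).le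
  set w := y - x with hw
  have hwx : |x - y| = |w| := by rw [hw, abs_sub_comm]
  rw [hwx]
  have e1 := Real.add_one_le_exp w
  have e2 := Real.add_one_le_exp (-w)
  have e3 : Real.exp w ≤ Real.exp |w| := Real.exp_le_exp.2 (le_abs_self w)
  have e4 : (1 : ℝ) ≤ Real.exp |w| := Real.one_le_exp (abs_nonneg w)
  have e5 : Real.exp w * Real.exp (-w) = 1 := by rw [← Real.exp_add]; simp
  have e6 := Real.exp_pos w
  rw [abs_le]
  constructor
  · rcases le_or_gt 0 w with h | h
    · rw [abs_of_nonneg h] at *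
      nlinarith
    · have : Real.exp w ≤ 1 := Real.exp_le_one_iff.2 h.le
      have : 0 ≤ |w| * Real.exp |w| := by positivity
      linarith
  · have : -w ≤ |w| := neg_le_abs w
    have : 0 ≤ |w| := abs_nonneg w
    nlinarith

variable {α β : Type*} [DecidableEq α]

/-- The contribution of a single exchangeable pair to the exponential moment. -/
lemma abs_mul_exp_min_sub_le {f x y θ t L p q : ℝ} (hθ : 0 < θ) (hp : 0 ≤ p) (hq : 0 ≤ q)
    (hL : θ * |x - y| ≤ L) (h : |f| * |x - y| ≤ p + q) :
    f * (Real.exp (θ * min x t) - Real.exp (θ * min y t)) ≤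
      θ * Real.exp L * (p * Real.exp (θ * min x t) + q * Real.exp (θ * min y t)) := by
  have hmin : |θ * min x t - θ * min y t| ≤ θ * |x - y| := by
    rw [← mul_sub, abs_mul, abs_of_pos hθ]
    refine mul_le_mul_of_nonneg_left ?_ hθ.le
    have := abs_min_sub_min_le_max x t y t
    simpa using this
  set X := θ * min x t
  set Y := θ * min y t
  set m := min (Real.exp X) (Real.exp Y) with hm
  have hm0 : 0 ≤ m := le_min (Real.exp_pos _).le (Real.exp_pos _).le
  have h1 : |Real.exp X - Real.exp Y| ≤ |X - Y| * Real.exp |X - Y| * m := by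
    have h2 := abs_exp_sub_exp_le X Y
    have h3 := abs_exp_sub_exp_le Y X
    rw [abs_sub_comm, abs_sub_comm Y X] at h3
    rcases min_choice (Real.exp X) (Real.exp Y) with h4 | h4 <;> rw [hm, h4] <;> assumption
  calc _ ≤ |f| * |Real.exp X - Real.exp Y| := by
        rw [← abs_mul]; exact le_abs_self _
    _ ≤ |f| * (|X - Y| * Real.exp |X - Y| * m) := by gcongr
    _ ≤ |f| * (θ * |x - y| * Real.exp L * m) := by
        gcongr
        exact hmin.trans hL
    _ = θ * Real.exp L * (|f| * |x - y| * m) := by ring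
    _ ≤ θ * Real.exp L * ((p + q) * m) := by gcongr
    _ = θ * Real.exp L * (p * m + q * m) := by ring
    _ ≤ _ := by
        gcongr
        · exact min_le_left _ _
        · exact min_le_right _ _

/-- An exponential moment bound for a function satisfying an approximate exchangeable-pair
identity on a set `Ω`. -/
lemma exchangeable_sum_le {𝒢 Ω : Finset α} {E : Finset β} {τ : β → β} {src : β → α}
    (hτ : ∀ e ∈ E, τ e ∈ E) (hττ : ∀ e ∈ E, τ (τ e) = e) (hsrc : ∀ e ∈ E, src e ∈ 𝒢)
    {F Z : β → ℝ} (hF : ∀ e ∈ E, F (τ e) = -F e) (hZ : ∀ e ∈ E, 0 ≤ Z e) {u : α → ℝ}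
    {c B M θ t b v L : ℝ} (hc : 0 < c) (hθ : 0 < θ) (hB : 0 ≤ B)
    (h1 : ∀ A ∈ Ω, u A ≤ c * ∑ e ∈ E with src e = A, F e + b)
    (h2 : ∀ e ∈ E, src e ∈ Ω → |F e| ≤ B)
    (h3 : ∀ e ∈ E, src e ∈ Ω → src (τ e) ∈ Ω → θ * |u (src e) - u (src (τ e))| ≤ L ∧
      |F e| * |u (src e) - u (src (τ e))| ≤ Z e + Z (τ e))
    (h4 : ∀ A ∈ Ω, c * ∑ e ∈ E with src e = A, Z e ≤ v)
    (h5 : ∀ A ∈ 𝒢, c * B * (E.filter fun e => src e = A).card ≤ M) :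
    ∑ A ∈ Ω, (u A - (b + θ * Real.exp L * v)) * Real.exp (θ * min (u A) t) ≤
      M * Real.exp (θ * t) * (𝒢 \ Ω).card := by
  set h : α → ℝ := fun A => Real.exp (θ * min (u A) t) with hh
  have hh0 : ∀ A, 0 ≤ h A := fun A => (Real.exp_pos _).le
  have hfib : ∀ (S : Finset α) (f : β → ℝ) (w : α → ℝ),
      ∑ A ∈ S, (∑ e ∈ E with src e = A, f e) * w A = ∑ e ∈ E with src e ∈ S, f e * w (src e) := by
    intro S f w
    rw [← Finset.sum_fiberwise_of_maps_to (s := E.filter fun e => src e ∈ S) (t := S) (g := src)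
      (fun e he => (Finset.mem_filter.1 he).2)]
    refine Finset.sum_congr rfl fun A hA => ?_
    rw [Finset.sum_mul, Finset.filter_filter]
    refine Finset.sum_congr ?_ fun e he => ?_
    · ext e
      simp only [Finset.mem_filter]
      constructor
      · rintro ⟨a, rfl⟩; exact ⟨a, hA, rfl⟩
      · rintro ⟨a, -, b⟩; exact ⟨a, b⟩
    · rw [(Finset.mem_filter.1 he).2.2]
  set E₂ := E.filter fun e => src e ∈ Ω ∧ src (τ e) ∈ Ω with hE₂
  set E₁ := E.filter fun e => src e ∈ Ω ∧ src (τ e) ∉ Ω with hE₁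
  have hsplit : ∑ e ∈ E with src e ∈ Ω, F e * h (src e) =
      ∑ e ∈ E₂, F e * h (src e) + ∑ e ∈ E₁, F e * h (src e) := by
    rw [← Finset.sum_filter_add_sum_filter_not (E.filter fun e => src e ∈ Ω)
      (fun e => src (τ e) ∈ Ω), Finset.filter_filter, Finset.filter_filter]
  have hinv : ∀ f : β → ℝ, ∑ e ∈ E₂, f (τ e) = ∑ e ∈ E₂, f e := by
    intro f
    refine Finset.sum_bij' (fun e _ => τ e) (fun e _ => τ e) ?_ ?_ ?_ ?_ ?_
    · intro e he
      simp only [hE₂, Finset.mem_filter] at he ⊢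
      rw [hττ e he.1]
      exact ⟨hτ e he.1, he.2.2, he.2.1⟩
    · intro e he
      simp only [hE₂, Finset.mem_filter] at he ⊢
      rw [hττ e he.1]
      exact ⟨hτ e he.1, he.2.2, he.2.1⟩
    · intro e he
      exact hττ e (Finset.mem_filter.1 he).1
    · intro e he
      exact hττ e (Finset.mem_filter.1 he).1
    · intro e he
      rfl
  have hE2bound : ∑ e ∈ E₂, F e * h (src e) ≤
      θ * Real.exp L * ∑ e ∈ E with src e ∈ Ω, Z e * h (src e) := by
    have a1 : ∑ e ∈ E₂, F e * h (src e) = ∑ e ∈ E₂, -(F e * h (src (τ e))) := by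
      rw [← hinv]
      refine Finset.sum_congr rfl fun e he => ?_
      rw [hF e (Finset.mem_filter.1 he).1]
      ring
    have a2 : 2 * ∑ e ∈ E₂, F e * h (src e) =
        ∑ e ∈ E₂, F e * (h (src e) - h (src (τ e))) := by
      rw [two_mul]
      nth_rewrite 2 [a1]
      rw [← Finset.sum_add_distrib]
      exact Finset.sum_congr rfl fun e he => by ring
    have a3 : ∑ e ∈ E₂, F e * (h (src e) - h (src (τ e))) ≤
        ∑ e ∈ E₂, θ * Real.exp L * (Z e * h (src e) + Z (τ e) * h (src (τ e))) := by
      refine Finset.sum_le_sum fun e he => ?_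
      obtain ⟨he1, he2, he3⟩ := Finset.mem_filter.1 he
      exact abs_mul_exp_min_sub_le hθ (hZ e he1) (hZ _ (hτ e he1)) (h3 e he1 he2 he3).1
        (h3 e he1 he2 he3).2
    rw [← Finset.mul_sum, Finset.sum_add_distrib, hinv fun e => Z e * h (src e)] at a3
    have a4 : ∑ e ∈ E₂, Z e * h (src e) ≤ ∑ e ∈ E with src e ∈ Ω, Z e * h (src e) := by
      refine Finset.sum_le_sum_of_subset_of_nonneg ?_ ?_
      · intro e he
        have := Finset.mem_filter.1 he
        exact Finset.mem_filter.2 ⟨this.1, this.2.1⟩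
      · intro e he _
        exact mul_nonneg (hZ e (Finset.mem_filter.1 he).1) (hh0 _)
    have a5 : 0 < θ * Real.exp L := by positivity
    nlinarith
  have hE1bound : c * ∑ e ∈ E₁, F e * h (src e) ≤ M * Real.exp (θ * t) * (𝒢 \ Ω).card := by
    have a1 : ∑ e ∈ E₁, F e * h (src e) ≤ E₁.card • (B * Real.exp (θ * t)) := by
      refine Finset.sum_le_card_nsmul _ _ _ fun e he => ?_
      obtain ⟨he1, he2, he3⟩ := Finset.mem_filter.1 he
      have := (le_abs_self _).trans (h2 e he1 he2)
      have b2 : h (src e) ≤ Real.exp (θ * t) :=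
        Real.exp_le_exp.2 (mul_le_mul_of_nonneg_left (min_le_right _ _) hθ.le)
      exact mul_le_mul this b2 (hh0 _) hB
    have a2 : E₁.card ≤ (E.filter fun e => src e ∈ 𝒢 \ Ω).card := by
      refine Finset.card_le_card_of_injOn τ ?_ ?_
      · intro e he
        obtain ⟨he1, he2, he3⟩ := Finset.mem_filter.1 (Finset.mem_coe.1 he)
        exact Finset.mem_coe.2 (Finset.mem_filter.2 ⟨hτ e he1,
          Finset.mem_sdiff.2 ⟨hsrc _ (hτ e he1), he3⟩⟩)
      · intro e he e' he' hee
        have g1 := hττ e (Finset.mem_filter.1 (Finset.mem_coe.1 he)).1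
        have g2 := hττ e' (Finset.mem_filter.1 (Finset.mem_coe.1 he')).1
        rw [← g1, ← g2]
        exact congrArg τ hee
    have a3 : c * B * (E.filter fun e => src e ∈ 𝒢 \ Ω).card ≤ M * (𝒢 \ Ω).card := by
      have := hfib (𝒢 \ Ω) (fun _ => 1) (fun _ => 1)
      simp only [mul_one, Finset.sum_const, nsmul_eq_mul] at this
      rw [← this, Finset.mul_sum]
      calc _ ≤ ∑ A ∈ 𝒢 \ Ω, M := Finset.sum_le_sum fun A hA => h5 A (Finset.mem_sdiff.1 hA).1
        _ = _ := by rw [Finset.sum_const, nsmul_eq_mul, mul_comm]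
    calc _ ≤ c * (E₁.card • (B * Real.exp (θ * t))) := by gcongr
      _ = c * B * E₁.card * Real.exp (θ * t) := by rw [nsmul_eq_mul]; ring
      _ ≤ c * B * (E.filter fun e => src e ∈ 𝒢 \ Ω).card * Real.exp (θ * t) := by
          gcongr
      _ ≤ M * (𝒢 \ Ω).card * Real.exp (θ * t) := by gcongr
      _ = _ := by ring
  have hZbound : c * ∑ e ∈ E with src e ∈ Ω, Z e * h (src e) ≤ v * ∑ A ∈ Ω, h A := by
    rw [← hfib, Finset.mul_sum, Finset.mul_sum]
    refine Finset.sum_le_sum fun A hA => ?_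
    rw [← mul_assoc]
    exact mul_le_mul_of_nonneg_right (h4 A hA) (hh0 A)
  have hmain : ∑ A ∈ Ω, u A * h A ≤ c * ∑ e ∈ E with src e ∈ Ω, F e * h (src e) +
      b * ∑ A ∈ Ω, h A := by
    rw [← hfib, Finset.mul_sum, Finset.mul_sum, ← Finset.sum_add_distrib]
    refine Finset.sum_le_sum fun A hA => ?_
    have := mul_le_mul_of_nonneg_right (h1 A hA) (hh0 A)
    linarith
  have hfin : ∑ A ∈ Ω, (u A - (b + θ * Real.exp L * v)) * h A =
      ∑ A ∈ Ω, u A * h A - (b + θ * Real.exp L * v) * ∑ A ∈ Ω, h A := by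
    rw [Finset.mul_sum, ← Finset.sum_sub_distrib]
    exact Finset.sum_congr rfl fun A _ => by ring
  rw [hfin]
  rw [hsplit, mul_add] at hmain
  have g1 := mul_le_mul_of_nonneg_left hE2bound hc.le
  have g2 := mul_le_mul_of_nonneg_left hZbound (by positivity : 0 ≤ θ * Real.exp L)
  linarith

/-- A tail bound for a function satisfying an approximate exchangeable-pair identity. -/
lemma exchangeable_tail {𝒢 Ω : Finset α} (hΩ : Ω ⊆ 𝒢) {u : α → ℝ} {M θ t a : ℝ} (hθ : 0 < θ)
    (ht : 0 < t) (hat : a ≤ t / 2)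
    (hsum : ∑ A ∈ Ω, (u A - a) * Real.exp (θ * min (u A) t) ≤
      M * Real.exp (θ * t) * (𝒢 \ Ω).card) :
    ((Ω.filter fun A => t ≤ u A).card : ℝ) ≤
      2 / (t * θ) * Real.exp (-(θ * t / 2)) * 𝒢.card + 2 * M / t * (𝒢 \ Ω).card := by
  have hpt : ∀ A ∈ Ω, (if t ≤ u A then t / 2 * Real.exp (θ * t) else 0) - Real.exp (θ * a) / θ ≤
      (u A - a) * Real.exp (θ * min (u A) t) := by
    intro A _
    have h0 : 0 < Real.exp (θ * a) / θ := by positivity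
    split_ifs with h
    · rw [min_eq_right h]
      have : t / 2 * Real.exp (θ * t) ≤ (u A - a) * Real.exp (θ * t) := by
        gcongr
        linarith
      linarith
    · push Not at h
      rw [min_eq_left h.le, zero_sub]
      have h1 := Real.add_one_le_exp (θ * (a - u A))
      have h2 : Real.exp (θ * (a - u A)) * Real.exp (θ * u A) = Real.exp (θ * a) := by
        rw [← Real.exp_add]; ring_nf
      have h3 := Real.exp_pos (θ * u A)
      rw [neg_le, ← neg_mul, le_div_iff₀ hθ]
      nlinarith
  have h1 := (Finset.sum_le_sum hpt).trans hsum
  rw [Finset.sum_sub_distrib, ← Finset.sum_filter, Finset.sum_const, Finset.sum_const,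
    nsmul_eq_mul, nsmul_eq_mul] at h1
  have h2 : (Ω.card : ℝ) ≤ 𝒢.card := by exact_mod_cast Finset.card_le_card hΩ
  have h3 : (Ω.card : ℝ) * (Real.exp (θ * a) / θ) ≤ 𝒢.card * (Real.exp (θ * (t / 2)) / θ) := by
    gcongr
  have h4 : Real.exp (θ * (t / 2)) = Real.exp (θ * t) * Real.exp (-(θ * t / 2)) := by
    rw [← Real.exp_add]; ring_nf
  rw [h4] at h3
  have h5 := Real.exp_pos (θ * t)
  have h6 : ((Ω.filter fun A => t ≤ u A).card : ℝ) * (t / 2) * Real.exp (θ * t) ≤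
      (𝒢.card * Real.exp (-(θ * t / 2)) / θ + M * (𝒢 \ Ω).card) * Real.exp (θ * t) := by
    calc _ ≤ 𝒢.card * (Real.exp (θ * t) * Real.exp (-(θ * t / 2)) / θ) +
          M * Real.exp (θ * t) * (𝒢 \ Ω).card := by linarith
      _ = _ := by ring
  have h7 := le_of_mul_le_mul_right h6 h5
  calc _ = ((Ω.filter fun A => t ≤ u A).card : ℝ) * (t / 2) * (2 / t) := by field_simp
    _ ≤ (𝒢.card * Real.exp (-(θ * t / 2)) / θ + M * (𝒢 \ Ω).card) * (2 / t) := by gcongr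
    _ = _ := by field_simp

end ExchangeablePairs

section EntrywiseTail

variable {N d : ℕ} {G : Fin N → Fin N → Bool}

/-- The error in the self-consistent equation for the entry `i j`. -/
def selfErr (d : ℕ) (G : Fin N → Fin N → Bool) (z : ℂ) (i j : Fin N) : ℂ :=
  (if i = j then 1 else 0) + (z + graphS d G z) * graphRes d G z i j

/-- A priori bounds on the entries of the resolvent. -/
def Tame (d : ℕ) (G : Fin N → Fin N → Bool) (z : ℂ) : Prop :=
  ∀ x y, ‖graphRes d G z x y‖ ≤ 8 ∧ ‖z‖ * ‖graphRes d G z x y‖ ≤ 24 ∧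
    (3 ≤ ‖z‖ → ‖z‖ * ‖graphRes d G z x y‖ ≤ 4)

lemma norm_graphS_le (hN : 0 < N) {z : ℂ} {γ : ℝ} (h : ∀ x, ‖graphRes d G z x x‖ ≤ γ) :
    ‖graphS d G z‖ ≤ γ := by
  have hNR : (0 : ℝ) < N := by exact_mod_cast hN
  rw [graphS, norm_mul, norm_div, norm_one, Complex.norm_natCast]
  have : ‖∑ k, graphRes d G z k k‖ ≤ N * γ := by
    refine (norm_sum_le _ _).trans ((Finset.sum_le_sum fun k _ => h k).trans (le_of_eq ?_))
    simp
  calc _ ≤ 1 / (N : ℝ) * (N * γ) := by gcongr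
    _ = γ := by field_simp

lemma norm_graphS_switch_sub_le (hN : 0 < N) (hG : IsRegGraph N d G) {i k p q : Fin N}
    (h : Switchable G i k p q) {z : ℂ} (hz : 0 < z.im) (hd : 128 ≤ √((d : ℝ) - 1))
    (hT : Tame d G z) (hT' : Tame d (switch G i k p q) z) :
    ‖graphS d (switch G i k p q) z - graphS d G z‖ ≤ 64 / (√((d : ℝ) - 1) * (N * z.im)) := by
  have : Nonempty (Fin N) := ⟨⟨0, hN⟩⟩
  have hNR : (0 : ℝ) < N := by exact_mod_cast hN
  set Q := √((d : ℝ) - 1)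
  have hQ0 : 0 < Q := by linarith
  have hG' := hG.switch h
  set R := graphRes d G z with hR
  set R' := graphRes d (switch G i k p q) z with hR'
  have hW : ∀ a b, ∑ x, ‖R x a‖ * ‖R' x b‖ ≤ 8 / z.im := by
    intro a b
    refine (sum_mul_le_of_ward (HmatR_isHermitian hG) (HmatR_isHermitian hG') hz hz
      (HmatR_row_sum hN hG) (HmatR_row_sum hN hG') a b).trans ?_
    have e1 : √((R a a).im / z.im) ≤ √(8 / z.im) := by
      gcongr
      exact ((le_abs_self _).trans (Complex.abs_im_le_norm _)).trans (hT a a).1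
    have e2 : √((R' b b).im / z.im) ≤ √(8 / z.im) := by
      gcongr
      exact ((le_abs_self _).trans (Complex.abs_im_le_norm _)).trans (hT' b b).1
    calc _ ≤ √(8 / z.im) * √(8 / z.im) := by
          exact mul_le_mul e1 e2 (Real.sqrt_nonneg _) (Real.sqrt_nonneg _)
      _ = _ := Real.mul_self_sqrt (by positivity)
  have hsymm : ∀ a b, R' a b = R' b a := projRes_symm (HmatR_isHermitian hG')
  have hterm : ∀ x, ‖R' x x - R x x‖ ≤ Q⁻¹ * (‖R x i‖ * ‖R' x q‖ + ‖R x i‖ * ‖R' x k‖ +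
      ‖R x p‖ * ‖R' x q‖ + ‖R x p‖ * ‖R' x k‖ + ‖R x q‖ * ‖R' x i‖ + ‖R x q‖ * ‖R' x p‖ +
      ‖R x k‖ * ‖R' x i‖ + ‖R x k‖ * ‖R' x p‖) := by
    intro x
    rw [hR, hR', graphRes_switch_sub hN hG h hz.ne' x x, ← hR, ← hR', hsymm q x, hsymm k x,
      hsymm i x, hsymm p x, norm_mul, norm_neg, Complex.norm_real,
      Real.norm_of_nonneg (by positivity)]
    refine mul_le_mul_of_nonneg_left ?_ (by positivity)
    refine (norm_add_le _ _).trans ?_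
    rw [norm_mul, norm_mul]
    have a1 := mul_le_mul (norm_sub_le (R x i) (R x p)) (norm_sub_le (R' x q) (R' x k))
      (norm_nonneg _) (by positivity)
    have a2 := mul_le_mul (norm_sub_le (R x q) (R x k)) (norm_sub_le (R' x i) (R' x p))
      (norm_nonneg _) (by positivity)
    linarith
  have hsum : ‖∑ x, R' x x - ∑ x, R x x‖ ≤ Q⁻¹ * (64 / z.im) := by
    rw [← Finset.sum_sub_distrib]
    refine (norm_sum_le _ _).trans ((Finset.sum_le_sum fun x _ => hterm x).trans ?_)
    rw [← Finset.mul_sum]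
    refine mul_le_mul_of_nonneg_left ?_ (by positivity)
    simp only [Finset.sum_add_distrib]
    have h8 : 64 / z.im = 8 * (8 / z.im) := by ring
    have := hW i q
    have := hW i k
    have := hW p q
    have := hW p k
    have := hW q i
    have := hW q p
    have := hW k i
    have := hW k p
    linarith
  rw [graphS, graphS, ← mul_sub, norm_mul, norm_div, norm_one, Complex.norm_natCast]
  calc _ ≤ 1 / (N : ℝ) * (Q⁻¹ * (64 / z.im)) := by gcongr
    _ = _ := by field_simp

lemma norm_add_graphS_mul_le (hN : 0 < N) {G' : Fin N → Fin N → Bool} {z : ℂ}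
    (hT : Tame d G z) (hT' : Tame d G' z) (x y : Fin N) :
    ‖z + graphS d G z‖ * ‖graphRes d G' z x y‖ ≤ 88 := by
  have h1 := norm_graphS_le hN (fun x => (hT x x).1)
  have h2 := (hT' x y).1
  have h3 := (hT' x y).2.1
  have h4 := norm_add_le z (graphS d G z)
  have h5 := norm_nonneg (graphRes d G' z x y)
  calc _ ≤ (‖z‖ + 8) * ‖graphRes d G' z x y‖ := by gcongr; linarith
    _ ≤ _ := by linarith

lemma norm_selfErr_switch_sub_le (hN : 0 < N) (hG : IsRegGraph N d G) {i k p q : Fin N}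
    (h : Switchable G i k p q) {z : ℂ} (hz : 0 < z.im) (hd : 128 ≤ √((d : ℝ) - 1))
    (hT : Tame d G z) (hT' : Tame d (switch G i k p q) z) (j : Fin N) :
    ‖selfErr d G z i j - selfErr d (switch G i k p q) z i j‖ ≤
      176 / √((d : ℝ) - 1) * (‖graphRes d (switch G i k p q) z q j‖ +
        ‖graphRes d (switch G i k p q) z k j‖ + ‖graphRes d G z i q‖ + ‖graphRes d G z i k‖) +
      512 / (√((d : ℝ) - 1) * (N * z.im)) := by
  have hs := norm_graphS_switch_sub_le hN hG h hz hd hT hT'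
  have hNR : (0 : ℝ) < N := by exact_mod_cast hN
  set Q := √((d : ℝ) - 1) with hQ
  have hQ0 : 0 < Q := by linarith
  set R := graphRes d G z with hR
  set R' := graphRes d (switch G i k p q) z with hR'
  set s := graphS d G z with hsdef
  set s' := graphS d (switch G i k p q) z with hs'def
  have hQ' : ‖(-((Q⁻¹ : ℝ) : ℂ))‖ = Q⁻¹ := by
    rw [norm_neg, Complex.norm_real, Real.norm_of_nonneg (by positivity)]
  have e : selfErr d G z i j - selfErr d (switch G i k p q) z i j =
      -(-((Q⁻¹ : ℝ) : ℂ)) * (((z + s) * R i i - (z + s) * R i p) * (R' q j - R' k j) +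
        (R i q - R i k) * ((z + s) * R' i j - (z + s) * R' p j)) - (s' - s) * R' i j := by
    have := graphRes_switch_sub hN hG h hz.ne' i j
    rw [← hR, ← hR', ← hQ] at this
    simp only [selfErr, ← hR, ← hR', ← hsdef, ← hs'def]
    linear_combination -(z + s) * this
  rw [e]
  refine (norm_sub_le _ _).trans (add_le_add ?_ ?_)
  · rw [norm_mul, norm_neg, hQ']
    have m1 := norm_add_graphS_mul_le hN hT hT i i
    have m2 := norm_add_graphS_mul_le hN hT hT i p
    have m3 := norm_add_graphS_mul_le hN hT hT' i j
    have m4 := norm_add_graphS_mul_le hN hT hT' p j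
    rw [← norm_mul] at m1 m2 m3 m4
    have n1 : ‖(z + s) * R i i - (z + s) * R i p‖ ≤ 176 := (norm_sub_le _ _).trans (by linarith)
    have n2 : ‖(z + s) * R' i j - (z + s) * R' p j‖ ≤ 176 := (norm_sub_le _ _).trans (by linarith)
    have n3 := norm_sub_le (R' q j) (R' k j)
    have n4 := norm_sub_le (R i q) (R i k)
    rw [div_mul_eq_mul_div, div_eq_inv_mul]
    refine mul_le_mul_of_nonneg_left ?_ (by positivity)
    refine (norm_add_le _ _).trans ?_
    rw [norm_mul, norm_mul]
    calc _ ≤ 176 * (‖R' q j‖ + ‖R' k j‖) + (‖R i q‖ + ‖R i k‖) * 176 := by gcongr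
      _ = _ := by ring
  · rw [norm_mul]
    calc _ ≤ 64 / (Q * (N * z.im)) * 8 := by
          gcongr
          exact (hT' i j).1
      _ = _ := by ring

lemma Tame.norm_selfErr_switch_sub_le (hN : 0 < N) (hG : IsRegGraph N d G) {i k p q : Fin N}
    (h : Switchable G i k p q) {z : ℂ} (hz : 0 < z.im) (hNz : 1 ≤ N * z.im)
    (hd : 128 ≤ √((d : ℝ) - 1)) (hT : Tame d G z) (hT' : Tame d (switch G i k p q) z)
    (j : Fin N) :
    ‖selfErr d G z i j - selfErr d (switch G i k p q) z i j‖ ≤ 6144 / √((d : ℝ) - 1) := by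
  refine (_root_.norm_selfErr_switch_sub_le hN hG h hz hd hT hT' j).trans ?_
  set Q := √((d : ℝ) - 1) with hQ
  have hQ0 : 0 < Q := by linarith
  have h1 := (hT' q j).1
  have h2 := (hT' k j).1
  have h3 := (hT i q).1
  have h4 := (hT i k).1
  calc _ ≤ 176 / Q * (8 + 8 + 8 + 8) + 512 / (Q * 1) := by gcongr
    _ = _ := by field_simp; norm_num

lemma add_five_sq_le (a b c d e : ℝ) :
    (a + b + c + d + e) ^ 2 ≤ 5 * (a ^ 2 + b ^ 2 + c ^ 2 + d ^ 2 + e ^ 2) := by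
  linarith [sq_nonneg (a - b), sq_nonneg (a - c), sq_nonneg (a - d), sq_nonneg (a - e),
    sq_nonneg (b - c), sq_nonneg (b - d), sq_nonneg (b - e), sq_nonneg (c - d),
    sq_nonneg (c - e), sq_nonneg (d - e)]

/-- The quantity controlling the conditional variance of the switching dynamics. -/
def switchVar (d : ℕ) (G : Fin N → Fin N → Bool) (z : ℂ) (i j q : Fin N) : ℝ :=
  880 / √((d : ℝ) - 1) * (‖graphRes d G z q j‖ ^ 2 + ‖graphRes d G z q i‖ ^ 2 +
    (4194304 / √((d : ℝ) - 1) ^ 2 + 9 / (N * z.im)))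

lemma norm_switchObs_mul_le (hN : 0 < N) (hG : IsRegGraph N d G) {i k p q : Fin N}
    (h : Switchable G i k p q) {z : ℂ} (hz : 0 < z.im) (hNz : 1 ≤ N * z.im)
    (hd : 128 ≤ √((d : ℝ) - 1)) (hT : Tame d G z) (hT' : Tame d (switch G i k p q) z)
    (j : Fin N) :
    ‖switchObs d G z i j k p q‖ * ‖selfErr d G z i j - selfErr d (switch G i k p q) z i j‖ ≤
      switchVar d G z i j q + switchVar d (switch G i k p q) z i j k := by
  have h1 := norm_selfErr_switch_sub_le hN hG h hz hd hT hT' j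
  have hb := fun x y => (graphRes_switch_bound hN hG h hz.ne' hd (fun x y => (hT x y).1) x y).2
  have hobs : ‖switchObs d G z i j k p q‖ ≤ ‖graphRes d G z k j‖ +
    ‖graphRes d (switch G i k p q) z q j‖ := norm_sub_le _ _
  have hs1 : graphRes d G z i q = graphRes d G z q i := projRes_symm (HmatR_isHermitian hG) _ _
  have hs2 : graphRes d G z i k = graphRes d G z k i := projRes_symm (HmatR_isHermitian hG) _ _
  rw [hs1, hs2] at h1
  simp only [switchVar]
  set Q := √((d : ℝ) - 1) with hQ
  have hQ0 : 0 < Q := by linarith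
  set R := graphRes d G z with hR
  set R' := graphRes d (switch G i k p q) z with hR'
  have t1 : ‖R k j‖ ≤ ‖R' k j‖ + 1024 / Q := by
    have := hb k j
    have := norm_sub_norm_le (R k j) (R' k j)
    rw [norm_sub_rev] at this
    linarith
  have t2 : ‖R' q j‖ ≤ ‖R q j‖ + 1024 / Q := by
    have := hb q j
    have := norm_sub_norm_le (R' q j) (R q j)
    linarith
  have t3 : ‖R k i‖ ≤ ‖R' k i‖ + 1024 / Q := by
    have := hb k i
    have := norm_sub_norm_le (R k i) (R' k i)
    rw [norm_sub_rev] at this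
    linarith
  set X := ‖R q j‖
  set Y := ‖R' k j‖
  set V := ‖R q i‖
  set W := ‖R' k i‖
  have hX : 0 ≤ X := norm_nonneg _
  have hY : 0 ≤ Y := norm_nonneg _
  have hV : 0 ≤ V := norm_nonneg _
  have hW : 0 ≤ W := norm_nonneg _
  set δ := 1024 / Q with hδ
  set y := (N * z.im)⁻¹ with hy
  have hy0 : 0 ≤ y := by positivity
  have hy1 : y ≤ 1 := inv_le_one_of_one_le₀ hNz
  have hδ0 : 0 ≤ δ := by positivity
  have e1 : 512 / (Q * (N * z.im)) ≤ 176 / Q * (3 * y) := by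
    calc _ = 512 / Q * y := by rw [hy]; field_simp
      _ ≤ 528 / Q * y := by gcongr; norm_num
      _ = _ := by ring
  have hA : ‖selfErr d G z i j - selfErr d (switch G i k p q) z i j‖ ≤
      176 / Q * (X + Y + V + W + (2 * δ + 3 * y)) := by
    calc _ ≤ 176 / Q * (X + δ + Y + V + (W + δ)) + 176 / Q * (3 * y) := by
          refine h1.trans (add_le_add ?_ e1)
          gcongr
      _ = _ := by ring
  have hB : ‖switchObs d G z i j k p q‖ ≤ X + Y + V + W + (2 * δ + 3 * y) := by linarith
  have hδ2 : δ ^ 2 * 4 = 4194304 / Q ^ 2 := by rw [hδ]; field_simp; norm_num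
  have h9 : 9 / (N * z.im) = 9 * y := by rw [hy]; field_simp
  rw [h9, ← hδ2]
  calc _ ≤ (X + Y + V + W + (2 * δ + 3 * y)) * (176 / Q * (X + Y + V + W + (2 * δ + 3 * y))) := by
        gcongr
    _ = 176 / Q * (X + Y + V + W + (2 * δ + 3 * y)) ^ 2 := by ring
    _ ≤ 176 / Q * (5 * (X ^ 2 + Y ^ 2 + V ^ 2 + W ^ 2 + 2 * (4 * δ ^ 2 + 9 * y))) := by
        gcongr
        have c1 := add_five_sq_le X Y V W (2 * δ + 3 * y)
        have c2 : (2 * δ + 3 * y) ^ 2 ≤ 2 * (4 * δ ^ 2 + 9 * y) := by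
          nlinarith [sq_nonneg (2 * δ - 3 * y)]
        linarith
    _ = _ := by ring

end EntrywiseTail

section GraphTail

variable {N d : ℕ} {G : Fin N → Fin N → Bool}

open scoped Classical in
/-- The finite set of `d`-regular graphs on `N` vertices. -/
def regSet (N d : ℕ) : Finset (Fin N → Fin N → Bool) :=
  Finset.univ.filter fun G => IsRegGraph N d G

lemma mem_regSet : G ∈ regSet N d ↔ IsRegGraph N d G := by simp [regSet]

open scoped Classical in
/-- The finite set of regular graphs satisfying a priori resolvent bounds at `z`. -/
def tameSet (N d : ℕ) (z : ℂ) : Finset (Fin N → Fin N → Bool) :=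
  (regSet N d).filter fun G => Tame d G z

lemma mem_tameSet {z : ℂ} : G ∈ tameSet N d z ↔ IsRegGraph N d G ∧ Tame d G z := by
  simp [tameSet, mem_regSet]

open scoped Classical in
/-- The finite set of all pairs consisting of a regular graph and an admissible switching at `i`. -/
def switchings (N d : ℕ) (i : Fin N) : Finset ((Fin N → Fin N → Bool) × Fin N × Fin N × Fin N) :=
  Finset.univ.filter fun e => IsRegGraph N d e.1 ∧ Switchable e.1 i e.2.1 e.2.2.1 e.2.2.2

/-- The involution on switchings. -/
def switchFlip (i : Fin N) (e : (Fin N → Fin N → Bool) × Fin N × Fin N × Fin N) :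
    (Fin N → Fin N → Bool) × Fin N × Fin N × Fin N :=
  (switch e.1 i e.2.1 e.2.2.1 e.2.2.2, e.2.2.2, e.2.2.1, e.2.1)

lemma mem_switchings {i : Fin N} {e : (Fin N → Fin N → Bool) × Fin N × Fin N × Fin N} :
    e ∈ switchings N d i ↔ IsRegGraph N d e.1 ∧ Switchable e.1 i e.2.1 e.2.2.1 e.2.2.2 := by
  simp [switchings]

open scoped Classical in
lemma sum_switchings {V : Type*} [AddCommMonoid V] (hG : IsRegGraph N d G) (i : Fin N)
    (f : (Fin N → Fin N → Bool) × Fin N × Fin N × Fin N → V) :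
    ∑ e ∈ switchings N d i with e.1 = G, f e =
      ∑ k, ∑ p, ∑ q, if Switchable G i k p q then f (G, k, p, q) else 0 := by
  have h1 : ∑ e ∈ switchings N d i with e.1 = G, f e =
      ∑ x : Fin N × Fin N × Fin N with Switchable G i x.1 x.2.1 x.2.2, f (G, x) := by
    refine Finset.sum_bij' (fun e _ => e.2) (fun x _ => (G, x)) ?_ ?_ ?_ ?_ ?_
    · rintro ⟨A, x⟩ he
      simp only [Finset.mem_filter, mem_switchings] at he
      obtain ⟨⟨-, h⟩, rfl⟩ := he
      simpa using h
    · rintro x hx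
      simp only [Finset.mem_filter, mem_switchings] at hx ⊢
      exact ⟨⟨hG, hx.2⟩, trivial⟩
    · rintro ⟨A, x⟩ he
      simp only [Finset.mem_filter] at he
      simp [← he.2]
    · rintro x hx; rfl
    · rintro ⟨A, x⟩ he
      simp only [Finset.mem_filter] at he
      simp [← he.2]
  rw [h1, Finset.sum_filter, Fintype.sum_prod_type]
  refine Finset.sum_congr rfl fun k _ => ?_
  rw [Fintype.sum_prod_type]

open scoped Classical in
lemma sum_switchings_le (hG : IsRegGraph N d G) (i : Fin N)
    {f : (Fin N → Fin N → Bool) × Fin N × Fin N × Fin N → ℝ} {g : Fin N → ℝ}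
    (hg : ∀ q, 0 ≤ g q) (hfg : ∀ k p q, Switchable G i k p q → f (G, k, p, q) ≤ g q) :
    ∑ e ∈ switchings N d i with e.1 = G, f e ≤ d ^ 2 * ∑ q, g q := by
  rw [sum_switchings hG]
  calc _ ≤ ∑ k, ∑ p, ∑ q, adjOf G i k * (adjOf G p q * g q) := by
        refine Finset.sum_le_sum fun k _ => Finset.sum_le_sum fun p _ =>
          Finset.sum_le_sum fun q _ => ?_
        split_ifs with h
        · have h1 : adjOf G i k = 1 := by simp [adjOf, h.1]
          have h2 : adjOf G p q = 1 := by simp [adjOf, h.2.1]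
          rw [h1, h2, one_mul, one_mul]
          exact hfg k p q h
        · exact mul_nonneg (adjOf_nonneg _ _ _) (mul_nonneg (adjOf_nonneg _ _ _) (hg q))
    _ = _ := by
        simp only [← Finset.mul_sum, ← Finset.sum_mul, sum_adjOf hG]
        rw [Finset.sum_comm]
        simp only [← Finset.sum_mul, sum_adjOf_col hG, ← Finset.mul_sum]
        ring

lemma switchObs_flip (i j : Fin N) (z : ℂ) (e : (Fin N → Fin N → Bool) × Fin N × Fin N × Fin N) :
    switchObs d (switchFlip i e).1 z i j (switchFlip i e).2.1 (switchFlip i e).2.2.1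
      (switchFlip i e).2.2.2 = -switchObs d e.1 z i j e.2.1 e.2.2.1 e.2.2.2 := by
  simp only [switchObs, switchFlip, switch_switch]
  ring

lemma sum_switchVar_le (hN : 0 < N) (hG : IsRegGraph N d G) {z : ℂ} (hz : 0 < z.im)
    (hd : 128 ≤ √((d : ℝ) - 1)) (hT : Tame d G z) (i j : Fin N) :
    ∑ q, switchVar d G z i j q ≤
      880 / √((d : ℝ) - 1) * (25 / z.im + N * (4194304 / √((d : ℝ) - 1) ^ 2)) := by
  have : Nonempty (Fin N) := ⟨⟨0, hN⟩⟩
  have hNR : (0 : ℝ) < N := by exact_mod_cast hN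
  have hw : ∀ a, ∑ q, ‖graphRes d G z q a‖ ^ 2 ≤ 8 / z.im := by
    intro a
    have := ward_identity (HmatR_isHermitian hG) hz.ne' (HmatR_row_sum hN hG) a
    rw [show ∑ q, ‖graphRes d G z q a‖ ^ 2 = _ from this]
    gcongr
    exact ((le_abs_self _).trans (Complex.abs_im_le_norm _)).trans (hT a a).1
  simp only [switchVar, ← Finset.mul_sum, Finset.sum_add_distrib]
  refine mul_le_mul_of_nonneg_left ?_ (by positivity)
  have h1 := hw j
  have h2 := hw i
  simp only [Finset.sum_const, Finset.card_univ, Fintype.card_fin, nsmul_eq_mul]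
  have h3 : (N : ℝ) * (9 / (N * z.im)) = 9 / z.im := by field_simp
  have h4 : 25 / z.im = 8 / z.im + 8 / z.im + 9 / z.im := by ring
  linarith

lemma sqrt_sub_one_bounds (hd : 128 ≤ √((d : ℝ) - 1)) :
    (128 : ℝ) ≤ d - 1 ∧ √((d : ℝ) - 1) ^ 2 = d - 1 ∧ (d : ℝ) / √((d : ℝ) - 1) ^ 2 ≤ 2 ∧
      (√((d : ℝ) - 1))⁻¹ ≤ 2 * (√(d : ℝ))⁻¹ ∧ (√((d : ℝ) - 1) ^ 2)⁻¹ ≤ 2 * (√(d : ℝ))⁻¹ ^ 2 := by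
  have h0 : (128 : ℝ) ≤ d - 1 := by
    by_contra! hc
    have h1 : √((d : ℝ) - 1) ≤ √128 := Real.sqrt_le_sqrt hc.le
    have h2 : √(128 : ℝ) < 128 := by
      rw [Real.sqrt_lt' (by norm_num)]; norm_num
    linarith
  have hsq : √((d : ℝ) - 1) ^ 2 = d - 1 := Real.sq_sqrt (by linarith)
  refine ⟨h0, hsq, ?_, ?_, ?_⟩
  · rw [hsq, div_le_iff₀ (by linarith)]
    linarith
  · rw [← div_eq_mul_inv, inv_eq_one_div, div_le_div_iff₀ (by linarith)
      (Real.sqrt_pos.2 (by linarith)), one_mul]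
    refine Real.sqrt_le_iff.2 ⟨by positivity, ?_⟩
    rw [mul_pow, hsq]
    linarith
  · rw [hsq, inv_pow, Real.sq_sqrt (by linarith), ← div_eq_mul_inv, inv_eq_one_div,
      div_le_div_iff₀ (by linarith) (by linarith)]
    linarith

/-- The control parameter of the self-consistent equation. -/
def ctrl (N : ℕ) (η ε : ℝ) : ℝ := (√(N * η))⁻¹ + ε

set_option maxHeartbeats 1000000 in
lemma selfErr_tail (hdN : d ≤ N) (hd : 128 ≤ √((d : ℝ) - 1)) {z : ℂ} (hz : 0 < z.im)
    (hNz : 1 ≤ N * z.im) {ε : ℝ} (h1 : (√(d : ℝ))⁻¹ ≤ ε) (h2 : √(d : ℝ) ^ 3 / N ≤ ε)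
    {ξ : ℝ} (hξ : 1 ≤ ξ) (hp : 1 ≤ ξ * Real.log ξ) (i j : Fin N) {ω : ℂ} (hω : ‖ω‖ = 1) :
    (((tameSet N d z).filter fun G =>
        10000000 * ξ * ctrl N z.im ε ≤ (ω * selfErr d G z i j).re).card : ℝ) ≤
      Real.exp (-(100 * (ξ * Real.log ξ))) * (regSet N d).card +
        N ^ 2 * (regSet N d \ tameSet N d z).card := by
  classical
  have hN : 0 < N := i.pos
  have hNR : (0 : ℝ) < N := by exact_mod_cast hN
  obtain ⟨hd0, hQsq, hdQ, hQ1, hQ2⟩ := sqrt_sub_one_bounds hd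
  have hdNR : (d : ℝ) ≤ N := by exact_mod_cast hdN
  have hd1 : (1 : ℝ) ≤ d := by linarith
  set Q := √((d : ℝ) - 1) with hQ
  have hQ0 : 0 < Q := by linarith
  set l := Real.log ξ with hl
  have hl0 : 0 < l := by
    by_contra! hc
    have : ξ * l ≤ 0 := mul_nonpos_of_nonneg_of_nonpos (by linarith) hc
    linarith
  set Φ := ctrl N z.im ε with hΦ
  have hNη : 0 < √(N * z.im) := Real.sqrt_pos.2 (by linarith)
  have hε0 : 0 < ε := lt_of_lt_of_le (inv_pos.2 (Real.sqrt_pos.2 (by linarith))) h1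
  have hεΦ : ε ≤ Φ := by
    have : 0 < (√(N * z.im))⁻¹ := by positivity
    rw [hΦ, ctrl]; linarith
  have hΦ0 : 0 < Φ := lt_of_lt_of_le hε0 hεΦ
  have hQΦ : Q⁻¹ ≤ 2 * Φ := by linarith
  have hΦsq : (N * z.im)⁻¹ + ε ^ 2 ≤ Φ ^ 2 := by
    have e : (√(N * z.im))⁻¹ ^ 2 = (N * z.im)⁻¹ := by
      rw [inv_pow, Real.sq_sqrt (by linarith)]
    rw [hΦ, ctrl, add_sq, e]
    have : 0 < 2 * (√(N * z.im))⁻¹ * ε := by positivity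
    linarith
  set θ := l / (49152 * Φ) with hθdef
  have hθ : 0 < θ := by positivity
  set t := 10000000 * ξ * Φ with htdef
  have ht : 0 < t := by positivity
  set c := 1 / (Q * N * d) with hcdef
  have hc : 0 < c := by positivity
  have habs : ∀ w : ℂ, |(ω * w).re| ≤ ‖w‖ := fun w => by
    refine (Complex.abs_re_le_norm _).trans ?_
    rw [norm_mul, hω, one_mul]
  set F : (Fin N → Fin N → Bool) × Fin N × Fin N × Fin N → ℝ := fun e =>
    (ω * switchObs d e.1 z i j e.2.1 e.2.2.1 e.2.2.2).re with hF
  set Z : (Fin N → Fin N → Bool) × Fin N × Fin N × Fin N → ℝ := fun e =>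
    switchVar d e.1 z i j e.2.2.2 with hZ
  have hZ0 : ∀ e, 0 ≤ Z e := fun e => by
    simp only [hZ, switchVar]
    positivity
  set b := 530000 * Φ with hb
  set v := 15000000000 * Φ ^ 2 with hv
  set L := l / 4 with hL
  have key := exchangeable_sum_le (𝒢 := regSet N d) (Ω := tameSet N d z)
    (E := switchings N d i) (τ := switchFlip i) (src := Prod.fst) (F := F) (Z := Z)
    (u := fun G => (ω * selfErr d G z i j).re) (c := c) (B := 24) (M := 24 * d) (θ := θ) (t := t)
    (b := b) (v := v) (L := L) ?_ ?_ ?_ ?_ (fun e _ => hZ0 e) hc hθ (by norm_num) ?_ ?_ ?_ ?_ ?_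
  · have tail := exchangeable_tail (𝒢 := regSet N d) (Ω := tameSet N d z)
      (Finset.filter_subset _ _) hθ ht ?_ key
    · have hpl : 0 < ξ * l := by linarith
      have hθt : θ * t / 2 = 10000000 / 98304 * (ξ * l) := by
        rw [hθdef, htdef]; field_simp; norm_num
      have e1 : 2 / (t * θ) ≤ 1 := by
        rw [div_le_one (by positivity)]
        linarith
      have e2 : Real.exp (-(θ * t / 2)) ≤ Real.exp (-(100 * (ξ * l))) := by
        rw [hθt]
        gcongr
        norm_num
      have e3 : 2 * (24 * (d : ℝ)) / t ≤ N ^ 2 := by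
        have hs : √(d : ℝ) ≤ d := by
          rw [Real.sqrt_le_left (by linarith)]
          nlinarith
        have hs0 : 0 < √(d : ℝ) := Real.sqrt_pos.2 (by linarith)
        have g1 : (48 : ℝ) * (√(d : ℝ))⁻¹ ≤ t := by
          calc (48 : ℝ) * (√(d : ℝ))⁻¹ ≤ 10000000 * 1 * Φ := by
                have := h1.trans hεΦ
                linarith
            _ ≤ t := by rw [htdef]; gcongr
        rw [div_le_iff₀ ht]
        calc 2 * (24 * (d : ℝ)) = 48 * (√(d : ℝ))⁻¹ * (d * √(d : ℝ)) := by field_simp; norm_num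
          _ ≤ t * (N * N) := by gcongr; exact hs.trans hdNR
          _ = _ := by ring
      calc _ ≤ _ := tail
        _ ≤ 1 * Real.exp (-(100 * (ξ * l))) * (regSet N d).card +
            N ^ 2 * (regSet N d \ tameSet N d z).card := by gcongr
        _ = _ := by rw [one_mul]
    · have e1 : l * Real.exp L ≤ 4 * ξ := by
        have g1 : L ≤ Real.exp L := by
          have := Real.add_one_le_exp L
          linarith
        have g2 : Real.exp L * Real.exp L ≤ ξ := by
          rw [← Real.exp_add]
          calc Real.exp (L + L) ≤ Real.exp l := Real.exp_le_exp.2 (by rw [hL]; linarith)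
            _ = ξ := Real.exp_log (by linarith)
        have g3 : L * Real.exp L ≤ Real.exp L * Real.exp L := by gcongr
        calc l * Real.exp L = 4 * (L * Real.exp L) := by rw [hL]; ring
          _ ≤ _ := by linarith
      calc b + θ * Real.exp L * v = 530000 * Φ + 15000000000 / 49152 * Φ * (l * Real.exp L) := by
            rw [hb, hv, hθdef]; field_simp
        _ ≤ 530000 * Φ * ξ + 15000000000 / 49152 * Φ * (4 * ξ) := by
            have : 530000 * Φ ≤ 530000 * Φ * ξ := le_mul_of_one_le_right (by positivity) hξ
            gcongr
        _ ≤ t / 2 := by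
            rw [htdef]
            have : 0 < Φ * ξ := by positivity
            linarith
  · intro e he
    rw [mem_switchings] at he ⊢
    exact ⟨he.1.switch he.2, he.2.symm he.1⟩
  · intro e he
    simp [switchFlip, switch_switch]
  · intro e he
    exact mem_regSet.2 (mem_switchings.1 he).1
  · intro e he
    simp only [hF, switchObs_flip]
    simp
  · intro G hG
    obtain ⟨hG, hT⟩ := mem_tameSet.1 hG
    have := switchSum_expansion hN hG hz hd (fun x y => (hT x y).1) (fun x y => (hT x y).2.1)
      h1 h2 i j
    rw [norm_sub_rev, ← hQ] at this
    have h3 := (le_abs_self _).trans ((habs _).trans this)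
    rw [mul_sub, Complex.sub_re] at h3
    have e : c * ∑ e ∈ switchings N d i with e.1 = G, F e =
        (ω * (switchSum d G z i j / ((Q : ℝ) * N * d))).re := by
      have e1 : ∑ e ∈ switchings N d i with e.1 = G, F e = (ω * switchSum d G z i j).re := by
        rw [switchSum, ← sum_switchings hG i (fun e => switchObs d e.1 z i j e.2.1 e.2.2.1 e.2.2.2),
          Finset.mul_sum, Complex.re_sum]
      rw [e1, hcdef, ← Complex.re_ofReal_mul]
      congr 1
      push_cast
      ring
    rw [e]
    change (ω * selfErr d G z i j).re ≤ _
    have hbe : b = 530000 * ((√(N * z.im))⁻¹ + ε) := by rw [hb, hΦ, ctrl]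
    rw [hbe]
    rw [selfErr]
    linarith
  · intro e he hT
    obtain ⟨hG, h⟩ := mem_switchings.1 he
    have hT := (mem_tameSet.1 hT).2
    refine (habs _).trans ((norm_sub_le _ _).trans ?_)
    have g1 := (hT e.2.1 j).1
    have g2 := (graphRes_switch_bound hN hG h hz.ne' hd (fun x y => (hT x y).1) e.2.2.2 j).1
    linarith
  · intro e he hT hT'
    obtain ⟨hG, h⟩ := mem_switchings.1 he
    have hT := (mem_tameSet.1 hT).2
    have hT' := (mem_tameSet.1 hT').2
    have e1 : |(ω * selfErr d e.1 z i j).re - (ω * selfErr d (switchFlip i e).1 z i j).re| ≤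
        ‖selfErr d e.1 z i j - selfErr d (switchFlip i e).1 z i j‖ := by
      rw [← Complex.sub_re, ← mul_sub]
      exact habs _
    constructor
    · have g1 := Tame.norm_selfErr_switch_sub_le hN hG h hz hNz hd hT hT' j
      calc _ ≤ θ * (6144 * Q⁻¹) := by
            gcongr
            rw [← div_eq_mul_inv]
            exact e1.trans g1
        _ ≤ θ * (6144 * (2 * Φ)) := by gcongr
        _ = L := by rw [hθdef, hL]; field_simp; norm_num
    · refine le_trans ?_ (norm_switchObs_mul_le hN hG h hz hNz hd hT hT' j)
      exact mul_le_mul (habs _) e1 (abs_nonneg _) (norm_nonneg _)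
  · intro G hG
    obtain ⟨hG, hT⟩ := mem_tameSet.1 hG
    have g1 := sum_switchings_le hG i (f := Z) (g := switchVar d G z i j)
      (fun q => by simp only [switchVar]; positivity) (fun k p q _ => le_rfl)
    have g2 := sum_switchVar_le hN hG hz hd hT i j
    rw [← hQ] at g2
    calc _ ≤ c * (d ^ 2 * (880 / Q * (25 / z.im + N * (4194304 / Q ^ 2)))) := by
          refine mul_le_mul_of_nonneg_left (g1.trans ?_) hc.le
          gcongr
      _ = 880 * (d / Q ^ 2) * (25 * (N * z.im)⁻¹ + 4194304 * (Q ^ 2)⁻¹) := by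
          rw [hcdef]; field_simp
      _ ≤ 880 * 2 * (25 * (N * z.im)⁻¹ + 4194304 * (2 * ε ^ 2)) := by
          have : (√(d : ℝ))⁻¹ ^ 2 ≤ ε ^ 2 := by gcongr
          have hQ2' : (Q ^ 2)⁻¹ ≤ 2 * ε ^ 2 := by linarith
          have : 0 < (N * z.im)⁻¹ := by positivity
          gcongr
      _ ≤ v := by
          have : 0 < (N * z.im)⁻¹ := by positivity
          rw [hv]
          linarith [sq_nonneg ε]
  · intro G hG
    have hG := mem_regSet.1 hG
    have g1 := sum_switchings_le hG i (f := fun _ => 1) (g := fun _ => 1)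
      (fun q => by norm_num) (fun k p q _ => le_rfl)
    simp only [Finset.sum_const, nsmul_eq_mul, mul_one, Finset.card_univ, Fintype.card_fin] at g1
    calc _ ≤ c * 24 * (d ^ 2 * N) := by gcongr
      _ = 24 * d * Q⁻¹ := by rw [hcdef]; field_simp
      _ ≤ 24 * d * 1 := by
          gcongr
          exact inv_le_one_of_one_le₀ (by linarith)
      _ = _ := by ring

end GraphTail

section Bootstrap

variable {N d : ℕ} {G : Fin N → Fin N → Bool}

/-- Self-improved bounds on the entries of the resolvent. -/
def Good (d : ℕ) (G : Fin N → Fin N → Bool) (z : ℂ) : Prop :=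
  ∀ x y, ‖graphRes d G z x y‖ ≤ 4 ∧ (3 ≤ ‖z‖ → ‖z‖ * ‖graphRes d G z x y‖ ≤ 2)

lemma norm_mk_le_norm_mk_two_mul (E η : ℝ) :
    ‖(⟨E, η⟩ : ℂ)‖ ≤ ‖(⟨E, 2 * η⟩ : ℂ)‖ := by
  rw [← sq_le_sq₀ (norm_nonneg _) (norm_nonneg _), ← Complex.normSq_eq_norm_sq,
    ← Complex.normSq_eq_norm_sq, Complex.normSq_mk, Complex.normSq_mk]
  nlinarith

lemma Good.tame (hN : 0 < N) (hG : IsRegGraph N d G) {E η : ℝ} (hη : 0 < η)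
    (h : Good d G ⟨E, 2 * η⟩) : Tame d G ⟨E, η⟩ := by
  have : Nonempty (Fin N) := ⟨⟨0, hN⟩⟩
  have hH := HmatR_isHermitian hG
  have hr := HmatR_row_sum hN hG
  have hle := norm_mk_le_norm_mk_two_mul E η
  set z : ℂ := ⟨E, η⟩ with hz
  set w : ℂ := ⟨E, 2 * η⟩ with hw
  intro x y
  have a1 : ‖graphRes d G z x y‖ ≤ 8 := by
    have h1 := projRes_half hH hr hη (fun i => (h i i).1) x y
    have h2 := (h x y).1
    have h3 := norm_le_norm_add_norm_sub' (graphRes d G z x y) (graphRes d G w x y)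
    have h4 : ‖graphRes d G z x y - graphRes d G w x y‖ ≤ 4 := h1
    linarith
  have a2 : 3 ≤ ‖z‖ → ‖z‖ * ‖graphRes d G z x y‖ ≤ 4 := by
    intro h3z
    have hw3 : 3 ≤ ‖w‖ := h3z.trans hle
    have hb : ∀ a b, ‖graphRes d G w a b‖ ≤ 2 / ‖w‖ := fun a b => by
      rw [le_div_iff₀ (by linarith), mul_comm]
      exact (h a b).2 hw3
    have h1 : ‖graphRes d G z x y - graphRes d G w x y‖ ≤ 2 / ‖w‖ :=
      projRes_half hH hr hη (fun i => hb i i) x y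
    have h2 := hb x y
    have h3 := norm_le_norm_add_norm_sub' (graphRes d G z x y) (graphRes d G w x y)
    calc _ ≤ ‖w‖ * (2 / ‖w‖ + 2 / ‖w‖) := by gcongr; linarith
      _ = 4 := by field_simp; norm_num
  refine ⟨a1, ?_, a2⟩
  rcases le_total 3 ‖z‖ with h3 | h3
  · linarith [a2 h3]
  · calc _ ≤ 3 * (8 : ℝ) := by gcongr
      _ = 24 := by norm_num

lemma sum_selfErr (hN : 0 < N) (z : ℂ) :
    (1 / (N : ℂ)) * ∑ i, selfErr d G z i i = 1 + z * graphS d G z + graphS d G z ^ 2 := by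
  have hNC : (N : ℂ) ≠ 0 := by exact_mod_cast hN.ne'
  have h1 : ∑ i, selfErr d G z i i = N + (z + graphS d G z) * ∑ k, graphRes d G z k k := by
    simp only [selfErr, if_true, Finset.sum_add_distrib, ← Finset.mul_sum]
    simp
  have h2 : ∑ k, graphRes d G z k k = N * graphS d G z := by
    rw [graphS]; field_simp
  rw [h1, h2]
  field_simp
  ring

lemma norm_self_consistent_le (hN : 0 < N) {z : ℂ} {δ : ℝ}
    (h : ∀ i j, ‖selfErr d G z i j‖ ≤ δ) :
    ‖1 + z * graphS d G z + graphS d G z ^ 2‖ ≤ δ := by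
  have hNR : (0 : ℝ) < N := by exact_mod_cast hN
  rw [← sum_selfErr hN, norm_mul, norm_div, norm_one, Complex.norm_natCast]
  have : ‖∑ i, selfErr d G z i i‖ ≤ N * δ := by
    refine (norm_sum_le _ _).trans ((Finset.sum_le_sum fun k _ => h k k).trans (le_of_eq ?_))
    simp
  calc _ ≤ 1 / (N : ℝ) * (N * δ) := by gcongr
    _ = δ := by field_simp

lemma Tame.good (hN : 0 < N) {z : ℂ} (hT : Tame d G z)
    (h : ∀ i j, ‖selfErr d G z i j‖ ≤ 1 / 100) : Good d G z := by
  have hs := norm_self_consistent_le hN h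
  set s := graphS d G z with hsdef
  have hs' : ‖1 + (z + s) * s‖ ≤ 1 / 100 := by
    rwa [show 1 + (z + s) * s = 1 + z * s + s ^ 2 by ring]
  have hR : ∀ x y, ‖z + s‖ * ‖graphRes d G z x y‖ ≤ 101 / 100 := by
    intro x y
    have h1 := h x y
    rw [← norm_mul]
    have h2 : ‖(if x = y then 1 else 0 : ℂ)‖ ≤ 1 := by split_ifs <;> simp
    have h3 := norm_sub_le (selfErr d G z x y) (if x = y then 1 else 0 : ℂ)
    have h4 : selfErr d G z x y - (if x = y then 1 else 0 : ℂ) =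
      (z + s) * graphRes d G z x y := by
      rw [selfErr]; ring
    rw [h4] at h3
    linarith
  have hss : ‖z + s‖ * ‖s‖ ≤ 101 / 100 := by
    rw [← norm_mul]
    have := norm_sub_le (1 + (z + s) * s) 1
    rw [add_sub_cancel_left, norm_one] at this
    linarith
  have hss' : 99 / 100 ≤ ‖z + s‖ * ‖s‖ := by
    rw [← norm_mul]
    have := norm_sub_le (1 + (z + s) * s) ((z + s) * s)
    rw [add_sub_cancel_right, norm_one] at this
    linarith
  have htri : ‖z‖ ≤ ‖z + s‖ + ‖s‖ := by
    have := norm_sub_le (z + s) s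
    rwa [add_sub_cancel_right] at this
  have htri' : ‖s‖ ≤ ‖z + s‖ + ‖z‖ := by
    have := norm_sub_le (z + s) z
    rwa [add_sub_cancel_left] at this
  have hzs0 := norm_nonneg (z + s)
  have hs0 := norm_nonneg s
  rcases le_or_gt 3 ‖z‖ with h3 | h3
  · have hs4 : ‖s‖ ≤ 4 / 3 := by
      refine norm_graphS_le hN fun x => ?_
      have := (hT x x).2.2 h3
      have h0 := norm_nonneg (graphRes d G z x x)
      nlinarith
    have h5 : 5 / 3 ≤ ‖z + s‖ := by linarith
    have hs6 : ‖s‖ ≤ 61 / 100 := by nlinarith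
    have h6 : 3 / 4 * ‖z‖ ≤ ‖z + s‖ := by linarith
    intro x y
    have h0 := norm_nonneg (graphRes d G z x y)
    have h7 : ‖z‖ * ‖graphRes d G z x y‖ ≤ 2 := by
      have := hR x y
      have h8 : 3 / 4 * ‖z‖ * ‖graphRes d G z x y‖ ≤ ‖z + s‖ * ‖graphRes d G z x y‖ := by gcongr
      linarith
    refine ⟨?_, fun _ => h7⟩
    nlinarith
  · have h29 : 29 / 100 ≤ ‖z + s‖ := by
      by_contra! hc
      nlinarith
    intro x y
    refine ⟨?_, fun h => absurd h (by linarith)⟩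
    have := hR x y
    have h0 := norm_nonneg (graphRes d G z x y)
    nlinarith

lemma good_of_le_im (hN : 0 < N) (hG : IsRegGraph N d G) {E η : ℝ} (hη : 1 ≤ η)
    (hE : |E| ≤ η) : Good d G ⟨E, η⟩ := by
  have : Nonempty (Fin N) := ⟨⟨0, hN⟩⟩
  intro x y
  have h1 : ‖graphRes d G ⟨E, η⟩ x y‖ ≤ 1 / η := projRes_norm_le (HmatR_isHermitian hG)
    (show 0 < (⟨E, η⟩ : ℂ).im by show 0 < η; linarith) (HmatR_row_sum hN hG) x y
  have h2 : 1 / η ≤ 1 := by rw [div_le_one (by linarith)]; exact hη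
  have h3 : ‖(⟨E, η⟩ : ℂ)‖ ≤ 2 * η := by
    refine (Complex.norm_le_abs_re_add_abs_im _).trans ?_
    show |E| + |η| ≤ _
    rw [abs_of_nonneg (by linarith : 0 ≤ η)]
    linarith
  refine ⟨by linarith, fun _ => ?_⟩
  calc _ ≤ (2 * η) * (1 / η) := by gcongr
    _ = 2 := by field_simp

end Bootstrap

section Recursion

variable {N d : ℕ} {G : Fin N → Fin N → Bool}

open scoped Classical in
lemma card_filter_exists_le {α ι : Type*} [Fintype ι] (S : Finset α) (P : ι → α → Prop) {B : ℝ}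
    (h : ∀ i, ((S.filter fun a => P i a).card : ℝ) ≤ B) :
    ((S.filter fun a => ∃ i, P i a).card : ℝ) ≤ Fintype.card ι * B := by
  have h1 : (S.filter fun a => ∃ i, P i a) =
      Finset.univ.biUnion fun i => S.filter fun a => P i a := by
    ext a
    simp
  rw [h1]
  calc _ ≤ ((∑ i, (S.filter fun a => P i a).card : ℕ) : ℝ) := by
        exact_mod_cast Finset.card_biUnion_le
    _ ≤ ∑ _i : ι, B := by
        push_cast
        exact Finset.sum_le_sum fun i _ => h i
    _ = _ := by simp

/-- The four directions `1, -1, I, -I`. -/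
def fourDir (x : Bool × Bool) : ℂ := (if x.1 then 1 else -1) * (if x.2 then 1 else Complex.I)

lemma norm_fourDir (x : Bool × Bool) : ‖fourDir x‖ = 1 := by
  rw [fourDir, norm_mul]
  split_ifs <;> simp

lemma exists_fourDir {w : ℂ} {t : ℝ} (h : 2 * t ≤ ‖w‖) : ∃ x, t ≤ (fourDir x * w).re := by
  have h1 := Complex.norm_le_abs_re_add_abs_im w
  rcases le_or_gt t |w.re| with h2 | h2
  · rcases le_abs.1 h2 with h3 | h3
    · exact ⟨(true, true), by simpa [fourDir] using h3⟩
    · exact ⟨(false, true), by simpa [fourDir] using h3⟩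
  · have h4 : t ≤ |w.im| := by linarith
    rcases le_abs.1 h4 with h3 | h3
    · exact ⟨(false, false), by simpa [fourDir] using h3⟩
    · exact ⟨(true, false), by simpa [fourDir] using h3⟩

open scoped Classical in
lemma card_selfErr_large_le (hdN : d ≤ N) (hd : 128 ≤ √((d : ℝ) - 1)) {z : ℂ} (hz : 0 < z.im)
    (hNz : 1 ≤ N * z.im) {ε : ℝ} (h1 : (√(d : ℝ))⁻¹ ≤ ε) (h2 : √(d : ℝ) ^ 3 / N ≤ ε)
    {ξ : ℝ} (hξ : 1 ≤ ξ) (hp : 1 ≤ ξ * Real.log ξ) :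
    (((tameSet N d z).filter fun G =>
        ∃ i j, 2 * (10000000 * ξ * ctrl N z.im ε) ≤ ‖selfErr d G z i j‖).card : ℝ) ≤
      4 * N ^ 2 * (Real.exp (-(100 * (ξ * Real.log ξ))) * (regSet N d).card +
        N ^ 2 * (regSet N d \ tameSet N d z).card) := by
  have h := card_filter_exists_le (ι := Fin N × Fin N × Bool × Bool) (tameSet N d z)
    (fun x G => 10000000 * ξ * ctrl N z.im ε ≤ (fourDir x.2.2 * selfErr d G z x.1 x.2.1).re)
    (fun x => selfErr_tail hdN hd hz hNz h1 h2 hξ hp x.1 x.2.1 (norm_fourDir x.2.2))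
  calc _ ≤ _ := by
        refine Nat.cast_le.2 (Finset.card_le_card ?_)
        refine Finset.monotone_filter_right _ fun G _ => ?_
        rintro ⟨i, j, hij⟩
        obtain ⟨x, hx⟩ := exists_fourDir hij
        exact ⟨(i, j, x), hx⟩
    _ ≤ _ := h
    _ = _ := by
        simp only [Fintype.card_prod, Fintype.card_fin, Fintype.card_bool]
        push_cast
        ring

open scoped Classical in
/-- The finite set of regular graphs which fail the improved bounds at `z`. -/
def badSet (N d : ℕ) (z : ℂ) : Finset (Fin N → Fin N → Bool) :=
  (regSet N d).filter fun G => ¬ Good d G z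

open scoped Classical in
lemma card_step (hN5 : 5 ≤ N) (hdN : d ≤ N) (hd : 128 ≤ √((d : ℝ) - 1)) {E η : ℝ} (hη : 0 < η)
    (hNη : 1 ≤ N * η) {ε : ℝ} (h1 : (√(d : ℝ))⁻¹ ≤ ε) (h2 : √(d : ℝ) ^ 3 / N ≤ ε)
    {ξ : ℝ} (hξ : 1 ≤ ξ) (hp : 1 ≤ ξ * Real.log ξ)
    (hsmall : 2 * (10000000 * ξ * ctrl N η ε) ≤ 1 / 100) :
    (((regSet N d).filter fun G => ¬ (Good d G ⟨E, η⟩ ∧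
        ∀ i j, ‖selfErr d G ⟨E, η⟩ i j‖ ≤ 2 * (10000000 * ξ * ctrl N η ε))).card : ℝ) ≤
      N ^ 5 * ((badSet N d ⟨E, 2 * η⟩).card +
        Real.exp (-(100 * (ξ * Real.log ξ))) * (regSet N d).card) := by
  have hN : 0 < N := by omega
  have hNR : (5 : ℝ) ≤ N := by exact_mod_cast hN5
  have key := card_selfErr_large_le (z := ⟨E, η⟩) hdN hd hη hNη h1 h2 hξ hp
  set T := 2 * (10000000 * ξ * ctrl N η ε) with hTdef
  set e := Real.exp (-(100 * (ξ * Real.log ξ))) with he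
  set z : ℂ := ⟨E, η⟩ with hzdef
  set w : ℂ := ⟨E, 2 * η⟩ with hw
  have hsub : regSet N d \ tameSet N d z ⊆ badSet N d w := by
    intro G hG
    rw [Finset.mem_sdiff, mem_tameSet, mem_regSet] at hG
    rw [badSet, Finset.mem_filter, mem_regSet]
    refine ⟨hG.1, fun hgood => hG.2 ⟨hG.1, hgood.tame hN hG.1 hη⟩⟩
  have hb : ((regSet N d \ tameSet N d z).card : ℝ) ≤ (badSet N d w).card := by
    exact_mod_cast Finset.card_le_card hsub
  have hcov : ((regSet N d).filter fun G => ¬ (Good d G z ∧ ∀ i j, ‖selfErr d G z i j‖ ≤ T)) ⊆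
      (regSet N d \ tameSet N d z) ∪
        ((tameSet N d z).filter fun G => ∃ i j, T ≤ ‖selfErr d G z i j‖) := by
    intro G hG
    rw [Finset.mem_filter, mem_regSet] at hG
    rw [Finset.mem_union, Finset.mem_sdiff, mem_regSet, Finset.mem_filter, mem_tameSet]
    by_cases hT : Tame d G z
    · right
      refine ⟨⟨hG.1, hT⟩, ?_⟩
      by_contra! hc
      exact hG.2 ⟨hT.good hN fun i j => (hc i j).le.trans hsmall, fun i j => (hc i j).le⟩
    · left
      exact ⟨hG.1, fun h => hT h.2⟩
  have hcard : (((regSet N d).filter fun G =>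
      ¬ (Good d G z ∧ ∀ i j, ‖selfErr d G z i j‖ ≤ T)).card : ℝ) ≤
      (regSet N d \ tameSet N d z).card +
        ((tameSet N d z).filter fun G => ∃ i j, T ≤ ‖selfErr d G z i j‖).card := by
    exact_mod_cast (Finset.card_le_card hcov).trans (Finset.card_union_le _ _)
  set B : ℝ := ((badSet N d w).card : ℝ) with hB
  set R : ℝ := ((regSet N d).card : ℝ) with hR
  have hB0 : 0 ≤ B := Nat.cast_nonneg _
  have hR0 : 0 ≤ R := Nat.cast_nonneg _
  have he0 : 0 < e := Real.exp_pos _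
  calc _ ≤ B + 4 * N ^ 2 * (e * R + N ^ 2 * B) := by
        refine hcard.trans (add_le_add hb (key.trans ?_))
        gcongr
    _ = (1 + 4 * N ^ 4) * B + 4 * N ^ 2 * (e * R) := by ring
    _ ≤ N ^ 5 * B + N ^ 5 * (e * R) := by
        have g1 : (1 : ℝ) ≤ N ^ 4 := one_le_pow₀ (by linarith)
        have g2 : (1 : ℝ) ≤ N ^ 2 := one_le_pow₀ (by linarith)
        have g3 : (N : ℝ) ^ 5 = N * N ^ 4 := by ring
        have g4 : (5 : ℝ) * N ^ 4 ≤ N * N ^ 4 := by gcongr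
        have g5 : (N : ℝ) ^ 4 = N ^ 2 * N ^ 2 := by ring
        have g6 : 1 * (N : ℝ) ^ 2 ≤ N ^ 2 * N ^ 2 := by gcongr
        gcongr
        · linarith
        · linarith
    _ = _ := by ring

lemma ctrl_anti {η η' ε : ℝ} (hN : 0 < N) (hη : 0 < η) (h : η ≤ η') :
    ctrl N η' ε ≤ ctrl N η ε := by
  have hNR : (0 : ℝ) < N := by exact_mod_cast hN
  unfold ctrl
  have : 0 < √(N * η) := Real.sqrt_pos.2 (by positivity)
  gcongr

lemma card_badSet_le (hN5 : 5 ≤ N) (hdN : d ≤ N) (hd : 128 ≤ √((d : ℝ) - 1)) {ε : ℝ}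
    (h1 : (√(d : ℝ))⁻¹ ≤ ε) (h2 : √(d : ℝ) ^ 3 / N ≤ ε)
    {ξ : ℝ} (hξ : 1 ≤ ξ) (hp : 1 ≤ ξ * Real.log ξ) (E : ℝ) (k : ℕ) :
    ∀ η : ℝ, 0 < η → 1 ≤ N * η → 2 * (10000000 * ξ * ctrl N η ε) ≤ 1 / 100 →
      1 ≤ 2 ^ k * η → |E| ≤ 2 ^ k * η →
      ((badSet N d ⟨E, η⟩).card : ℝ) ≤
        N ^ (6 * k) * (Real.exp (-(100 * (ξ * Real.log ξ))) * (regSet N d).card) := by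
  classical
  have hN : 0 < N := by omega
  have hNR : (5 : ℝ) ≤ N := by exact_mod_cast hN5
  induction k with
  | zero =>
    intro η hη _ _ h3 h4
    rw [pow_zero, one_mul] at h3 h4
    have : badSet N d ⟨E, η⟩ = ∅ := by
      rw [badSet, Finset.filter_eq_empty_iff]
      intro G hG
      rw [not_not]
      exact good_of_le_im hN (mem_regSet.1 hG) h3 h4
    rw [this]
    simp only [Finset.card_empty, Nat.cast_zero]
    positivity
  | succ k ih =>
    intro η hη hNη hsm h3 h4
    have hstep := card_step (E := E) hN5 hdN hd hη hNη h1 h2 hξ hp hsm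
    have hle : 2 * (10000000 * ξ * ctrl N (2 * η) ε) ≤ 1 / 100 := by
      refine le_trans ?_ hsm
      have := ctrl_anti (ε := ε) hN hη (by linarith : η ≤ 2 * η)
      gcongr
    have ih' := ih (2 * η) (by linarith) (by nlinarith) hle (by rw [pow_succ] at h3; linarith)
      (by rw [pow_succ] at h4; linarith)
    set B := Real.exp (-(100 * (ξ * Real.log ξ))) * (regSet N d).card with hB
    have hB0 : 0 ≤ B := by positivity
    have hmono : ((badSet N d ⟨E, η⟩).card : ℝ) ≤ (((regSet N d).filter fun G =>
        ¬ (Good d G ⟨E, η⟩ ∧ ∀ i j, ‖selfErr d G ⟨E, η⟩ i j‖ ≤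
          2 * (10000000 * ξ * ctrl N η ε))).card : ℝ) := by
      refine Nat.cast_le.2 (Finset.card_le_card ?_)
      exact Finset.monotone_filter_right _ fun G _ h h' => h h'.1
    have g1 : (1 : ℝ) ≤ N ^ (6 * k) := one_le_pow₀ (by linarith)
    calc _ ≤ N ^ 5 * (N ^ (6 * k) * B + B) := by
          refine hmono.trans (hstep.trans ?_)
          gcongr
      _ ≤ N ^ 5 * (N ^ (6 * k) * B + N ^ (6 * k) * B) := by
          gcongr
          exact le_mul_of_one_le_left hB0 g1
      _ = N ^ 5 * N ^ (6 * k) * B * 2 := by ring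
      _ ≤ N ^ 5 * N ^ (6 * k) * B * N := by gcongr; linarith
      _ = _ := by ring

end Recursion

section Stieltjes

variable {N d : ℕ} {G : Fin N → Fin N → Bool}

/-- The Stieltjes transform of the empirical measure of a finite family of real numbers. -/
def stieltjes (ev : Fin N → ℝ) (z : ℂ) : ℂ := (1 / (N : ℂ)) * ∑ α, 1 / ((ev α : ℂ) - z)

lemma im_le_norm_ofReal_sub (x : ℝ) (z : ℂ) : z.im ≤ ‖(x : ℂ) - z‖ := by
  refine le_trans ?_ (Complex.abs_im_le_norm _)
  rw [Complex.sub_im, Complex.ofReal_im, zero_sub, abs_neg]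
  exact le_abs_self _

lemma norm_avg_le (hN : 0 < N) {f : Fin N → ℂ} {γ : ℝ} (h : ∀ x, ‖f x‖ ≤ γ) :
    ‖(1 / (N : ℂ)) * ∑ α, f α‖ ≤ γ := by
  have hNR : (0 : ℝ) < N := by exact_mod_cast hN
  rw [norm_mul, norm_div, norm_one, Complex.norm_natCast]
  have : ‖∑ k, f k‖ ≤ N * γ := by
    refine (norm_sum_le _ _).trans ((Finset.sum_le_sum fun k _ => h k).trans (le_of_eq ?_))
    simp
  calc _ ≤ 1 / (N : ℝ) * (N * γ) := by gcongr
    _ = γ := by field_simp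

lemma norm_stieltjes_le (hN : 0 < N) (ev : Fin N → ℝ) {z : ℂ} (hz : 0 < z.im) :
    ‖stieltjes ev z‖ ≤ 1 / z.im := by
  refine norm_avg_le hN fun α => ?_
  rw [norm_div, norm_one]
  exact one_div_le_one_div_of_le hz (im_le_norm_ofReal_sub _ _)

lemma norm_stieltjes_sub_le (hN : 0 < N) (ev : Fin N → ℝ) {z w : ℂ} (hz : 0 < z.im)
    (hw : 0 < w.im) : ‖stieltjes ev z - stieltjes ev w‖ ≤ ‖z - w‖ / (z.im * w.im) := by
  rw [stieltjes, stieltjes, ← mul_sub, ← Finset.sum_sub_distrib]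
  refine norm_avg_le hN fun α => ?_
  have h1 := im_le_norm_ofReal_sub (ev α) z
  have h2 := im_le_norm_ofReal_sub (ev α) w
  have n1 : (ev α : ℂ) - z ≠ 0 := norm_pos_iff.1 (by linarith)
  have n2 : (ev α : ℂ) - w ≠ 0 := norm_pos_iff.1 (by linarith)
  rw [div_sub_div _ _ n1 n2, norm_div, norm_mul]
  have : (1 : ℂ) * ((ev α : ℂ) - w) - ((ev α : ℂ) - z) * 1 = z - w := by ring
  rw [this]
  gcongr

lemma graphS_eq (hN : 0 < N) (hG : IsRegGraph N d G) {z : ℂ} (hz : z.im ≠ 0) :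
    graphS d G z = stieltjes (HmatR_isHermitian hG).eigenvalues z + 1 / (N * z) := by
  have : Nonempty (Fin N) := ⟨⟨0, hN⟩⟩
  have h := projRes_trace (HmatR_isHermitian hG) hz
  have hNC : (N : ℂ) ≠ 0 := by exact_mod_cast hN.ne'
  have hz0 : z ≠ 0 := by rintro rfl; simp at hz
  rw [graphS, stieltjes, show ∑ k, graphRes d G z k k = _ from h]
  field_simp

/-- The approximate self-consistent equation for a Stieltjes transform. -/
def scErr (ev : Fin N → ℝ) (z : ℂ) : ℂ := 1 + z * stieltjes ev z + stieltjes ev z ^ 2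

lemma norm_scErr_sub_le (hN5 : 5 ≤ N) (ev : Fin N → ℝ) {z w : ℂ} (hz : 1 ≤ N * z.im)
    (hw : 1 ≤ N * w.im) (hzw : ‖z - w‖ ≤ 2 / N ^ 5) (hwN : ‖z‖ ≤ 2 * N) :
    ‖scErr ev z - scErr ev w‖ ≤ 10 / N := by
  have hN : 0 < N := by omega
  have hNR : (5 : ℝ) ≤ N := by exact_mod_cast hN5
  have hz0 : 0 < z.im := by
    by_contra! hc
    nlinarith
  have hw0 : 0 < w.im := by
    by_contra! hc
    nlinarith
  have iz : 1 / z.im ≤ N := by rw [div_le_iff₀ hz0]; exact hz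
  have iw : 1 / w.im ≤ N := by rw [div_le_iff₀ hw0]; exact hw
  have b1 := (norm_stieltjes_le hN ev hz0).trans iz
  have b2 := (norm_stieltjes_le hN ev hw0).trans iw
  have b3 : ‖stieltjes ev z - stieltjes ev w‖ ≤ 2 / N ^ 3 := by
    refine (norm_stieltjes_sub_le hN ev hz0 hw0).trans ?_
    calc _ = ‖z - w‖ * ((1 / z.im) * (1 / w.im)) := by field_simp
      _ ≤ 2 / N ^ 5 * (N * N) := by gcongr
      _ = _ := by field_simp
  have e : scErr ev z - scErr ev w = z * (stieltjes ev z - stieltjes ev w) +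
      (z - w) * stieltjes ev w + (stieltjes ev z - stieltjes ev w) *
        (stieltjes ev z + stieltjes ev w) := by
    simp only [scErr]; ring
  rw [e]
  refine (norm_add₃_le).trans ?_
  rw [norm_mul, norm_mul, norm_mul]
  have b4 := (norm_add_le (stieltjes ev z) (stieltjes ev w))
  calc _ ≤ (2 * N) * (2 / (N : ℝ) ^ 3) + 2 / (N : ℝ) ^ 5 * N + 2 / (N : ℝ) ^ 3 * (N + N) := by
        gcongr
        linarith
    _ = (8 * N ^ 2 + 2) / (N : ℝ) ^ 4 := by field_simp; ring
    _ ≤ 10 / N := by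
        rw [div_le_div_iff₀ (by positivity) (by positivity)]
        have h1 : (1 : ℝ) ≤ N ^ 2 := one_le_pow₀ (by linarith)
        have h2 : (8 : ℝ) * N ^ 2 + 2 ≤ 10 * N ^ 2 := by linarith
        calc _ ≤ (10 : ℝ) * N ^ 2 * N := by gcongr
          _ = 10 * N ^ 3 * 1 := by ring
          _ ≤ 10 * N ^ 3 * N := by gcongr; linarith
          _ = _ := by ring

lemma norm_scErr_le_of_good (hN5 : 5 ≤ N) (hdN : d ≤ N) (hd1 : 1 ≤ d) (hG : IsRegGraph N d G)
    {z : ℂ} (hz : 0 < z.im) (hNz : 1 ≤ N * z.im) {ε : ℝ} (h1 : (√(d : ℝ))⁻¹ ≤ ε) {ξ : ℝ}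
    (hξ : 1 ≤ ξ) (hgood : Good d G z)
    (hsm : ∀ i j, ‖selfErr d G z i j‖ ≤ 2 * (10000000 * ξ * ctrl N z.im ε)) :
    ‖scErr (HmatR_isHermitian hG).eigenvalues z‖ ≤ 30000000 * ξ * ctrl N z.im ε := by
  have hN : 0 < N := by omega
  have hNR : (5 : ℝ) ≤ N := by exact_mod_cast hN5
  have hr := norm_self_consistent_le hN hsm
  have hs := norm_graphS_le hN fun x => (hgood x x).1
  have heq := graphS_eq hN hG hz.ne'
  set m := stieltjes (HmatR_isHermitian hG).eigenvalues z
  set s := graphS d G z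
  set y := (√(N * z.im))⁻¹ with hy
  have hsq : 1 ≤ √(N * z.im) := Real.one_le_sqrt.2 hNz
  have hy0 : 0 < y := by positivity
  have hy1 : y ≤ 1 := inv_le_one_of_one_le₀ hsq
  have hyy : y * y = (N * z.im)⁻¹ := by
    rw [hy, ← mul_inv, Real.mul_self_sqrt (by linarith)]
  have hz0 : z ≠ 0 := by rintro rfl; simp at hz
  have hNC : (N : ℂ) ≠ 0 := by exact_mod_cast hN.ne'
  set u : ℂ := 1 / (N * z) with hu
  have hun : ‖u‖ ≤ y * y := by
    rw [hyy, hu, norm_div, norm_one, norm_mul, Complex.norm_natCast, ← one_div]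
    have := (le_abs_self _).trans (Complex.abs_im_le_norm z)
    gcongr
  have hu1 : ‖u‖ ≤ y := hun.trans (by nlinarith)
  have e : scErr (HmatR_isHermitian hG).eigenvalues z =
      1 + z * s + s ^ 2 - (1 / (N : ℂ) + 2 * s * u - u ^ 2) := by
    have hm : m = s - u := by rw [heq]; ring
    have hzu : z * u = 1 / N := by rw [hu]; field_simp
    rw [scErr, show stieltjes (HmatR_isHermitian hG).eigenvalues z = s - u from hm]
    linear_combination -hzu
  have hd1R : (1 : ℝ) ≤ d := by exact_mod_cast hd1
  have hdNR : (d : ℝ) ≤ N := by exact_mod_cast hdN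
  have hNε : 1 / (N : ℝ) ≤ ε := by
    refine le_trans ?_ h1
    rw [one_div]
    gcongr
    rw [Real.sqrt_le_left (by linarith)]
    nlinarith
  have hctrl : ctrl N z.im ε = y + ε := rfl
  rw [e]
  refine (norm_sub_le _ _).trans ?_
  have g1 : ‖1 / (N : ℂ) + 2 * s * u - u ^ 2‖ ≤ 1 / N + 2 * 4 * y + y * 1 := by
    refine (norm_sub_le _ _).trans (add_le_add ((norm_add_le _ _).trans (add_le_add ?_ ?_)) ?_)
    · rw [norm_div, norm_one, Complex.norm_natCast]
    · rw [norm_mul, norm_mul, Complex.norm_ofNat]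
      gcongr
    · rw [sq, norm_mul]
      gcongr
      linarith
  have hε0 : 0 ≤ ε := le_trans (by positivity) hNε
  have hpos : 0 ≤ ctrl N z.im ε := by rw [hctrl]; linarith
  have hc : ctrl N z.im ε ≤ ξ * ctrl N z.im ε := le_mul_of_one_le_left hpos hξ
  linarith

end Stieltjes

section Uniform

variable {N d : ℕ} {G : Fin N → Fin N → Bool}

lemma pow_mul_exp_le (hN5 : 5 ≤ N) {p : ℝ} (hp : 100 * Real.log N ^ 2 ≤ p) :
    ∃ k : ℕ, (N : ℝ) ^ 2 ≤ 2 ^ k ∧ (N : ℝ) ^ (6 * k + 20) ≤ Real.exp p := by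
  have hNR : (5 : ℝ) ≤ N := by exact_mod_cast hN5
  have hL : 1 ≤ Real.log N := by
    rw [Real.le_log_iff_exp_le (by linarith)]
    have := Real.exp_one_lt_d9
    linarith
  set L := Real.log N with hLdef
  have hNe : (N : ℝ) = Real.exp L := (Real.exp_log (by linarith)).symm
  refine ⟨⌈4 * L⌉₊, ?_, ?_⟩
  · have h1 : 4 * L ≤ (⌈4 * L⌉₊ : ℝ) := Nat.le_ceil _
    have h2 := Real.log_two_gt_d9
    have h3 : (2 : ℝ) ^ ⌈4 * L⌉₊ = Real.exp (⌈4 * L⌉₊ * Real.log 2) := by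
      rw [← Real.log_pow, Real.exp_log (by positivity)]
    rw [h3, hNe, ← Real.exp_nat_mul]
    apply Real.exp_le_exp.2
    push_cast
    nlinarith
  · have h1 : (⌈4 * L⌉₊ : ℝ) < 4 * L + 1 := Nat.ceil_lt_add_one (by linarith)
    rw [hNe, ← Real.exp_nat_mul]
    apply Real.exp_le_exp.2
    push_cast
    nlinarith

open scoped Classical in
lemma card_pointwise_le (hN5 : 5 ≤ N) (hdN : d ≤ N) (hd : 128 ≤ √((d : ℝ) - 1)) {ε : ℝ}
    (h1 : (√(d : ℝ))⁻¹ ≤ ε) (h2 : √(d : ℝ) ^ 3 / N ≤ ε) {ξ : ℝ} (hξ : 1 ≤ ξ)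
    (hp : 100 * Real.log N ^ 2 ≤ ξ * Real.log ξ) {z : ℂ} (hz : 0 < z.im) (hNz : 1 ≤ N * z.im)
    (hre : |z.re| ≤ N) (hsmall : 2 * (10000000 * ξ * ctrl N z.im ε) ≤ 1 / 100) :
    (((regSet N d).filter fun G => ∃ hG : IsRegGraph N d G,
      30000000 * ξ * ctrl N z.im ε < ‖scErr (HmatR_isHermitian hG).eigenvalues z‖).card : ℝ) ≤
      (N ^ 14 : ℝ)⁻¹ * (Real.exp (-(99 * (ξ * Real.log ξ))) * (regSet N d).card) := by
  have hN : 0 < N := by omega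
  have hNR : (5 : ℝ) ≤ N := by exact_mod_cast hN5
  obtain ⟨k, hk1, hk2⟩ := pow_mul_exp_le hN5 hp
  set p := ξ * Real.log ξ with hpdef
  have hL : 1 ≤ Real.log N := by
    rw [Real.le_log_iff_exp_le (by linarith)]
    have := Real.exp_one_lt_d9
    linarith
  have hp1 : 1 ≤ p := by nlinarith
  have hd1 : 1 ≤ d := by
    have := (sqrt_sub_one_bounds hd).1
    have : (1 : ℝ) ≤ d := by linarith
    exact_mod_cast this
  obtain ⟨E, η⟩ := z
  simp only at hz hNz hre hsmall ⊢
  have hctrl2 : 2 * (10000000 * ξ * ctrl N (2 * η) ε) ≤ 1 / 100 := by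
    refine le_trans ?_ hsmall
    have := ctrl_anti (ε := ε) hN hz (by linarith : η ≤ 2 * η)
    gcongr
  have hkη : (N : ℝ) ≤ 2 ^ k * (2 * η) := by
    calc (N : ℝ) ≤ N * (N * η) := le_mul_of_one_le_right (by linarith) hNz
      _ = N ^ 2 * η := by ring
      _ ≤ 2 ^ k * (2 * η) := by gcongr; linarith
  have hbad := card_badSet_le hN5 hdN hd h1 h2 hξ hp1 E k (2 * η) (by linarith) (by nlinarith)
    hctrl2 (by linarith) (hre.trans hkη)
  have hstep := card_step (E := E) hN5 hdN hd hz hNz h1 h2 hξ hp1 hsmall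
  set M : ℝ := ((regSet N d).card : ℝ) with hM
  set B := Real.exp (-(100 * p)) * M with hB
  have hB0 : 0 ≤ B := by positivity
  have hsub : ((regSet N d).filter fun G => ∃ hG : IsRegGraph N d G, 30000000 * ξ * ctrl N η ε <
      ‖scErr (HmatR_isHermitian hG).eigenvalues ⟨E, η⟩‖) ⊆
      ((regSet N d).filter fun G => ¬ (Good d G ⟨E, η⟩ ∧
        ∀ i j, ‖selfErr d G ⟨E, η⟩ i j‖ ≤ 2 * (10000000 * ξ * ctrl N η ε))) := by
    refine Finset.monotone_filter_right _ fun G _ => ?_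
    rintro ⟨hG, h⟩ ⟨h3, h4⟩
    exact absurd (norm_scErr_le_of_good hN5 hdN hd1 hG (z := ⟨E, η⟩) hz hNz h1 hξ h3 h4)
      (not_le.2 h)
  have hcard := (Nat.cast_le (α := ℝ)).2 (Finset.card_le_card hsub)
  refine hcard.trans (hstep.trans ?_)
  have g1 : (1 : ℝ) ≤ N ^ (6 * k) := one_le_pow₀ (by linarith)
  rw [inv_mul_eq_div, le_div_iff₀ (by positivity)]
  calc _ ≤ N ^ 5 * (N ^ (6 * k) * B + B) * N ^ 14 := by gcongr
    _ ≤ N ^ 5 * (N ^ (6 * k) * B + N ^ (6 * k) * B) * N ^ 14 := by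
        gcongr
        exact le_mul_of_one_le_left hB0 g1
    _ = N ^ 5 * N ^ (6 * k) * N ^ 14 * B * 2 := by ring
    _ ≤ N ^ 5 * N ^ (6 * k) * N ^ 14 * B * N := by gcongr; linarith
    _ = N ^ (6 * k + 20) * B := by ring
    _ ≤ Real.exp p * B := by gcongr
    _ = Real.exp (-(99 * p)) * M := by
        rw [hB, ← mul_assoc, ← Real.exp_add]
        ring_nf

/-- The approximate self-consistent equation holds throughout the spectral domain. -/
def LocalLaw (ε ξ : ℝ) (ev : Fin N → ℝ) : Prop :=
  ∀ z : ℂ, |z.re| ≤ N - 1 → z.im ≤ N - 1 → 0 < z.im → 1 ≤ N * z.im →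
    2 * (10000000 * ξ * ctrl N z.im ε) ≤ 1 / 100 →
    ‖scErr ev z‖ ≤ 40000000 * ξ * ctrl N z.im ε

/-- A point of a fine grid in the upper half-plane. -/
def gridPt (N : ℕ) (x : Fin (2 * N ^ 6 + 1) × Fin (N ^ 6 + 1)) : ℂ :=
  ⟨((x.1 : ℕ) : ℝ) / N ^ 5 - N, ((x.2 : ℕ) : ℝ) / N ^ 5⟩

lemma exists_gridPt (hN5 : 5 ≤ N) {z : ℂ} (hre : |z.re| ≤ N - 1) (him : z.im ≤ N - 1)
    (h0 : 0 < z.im) : ∃ x, z.im ≤ (gridPt N x).im ∧ |(gridPt N x).re| ≤ N ∧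
      ‖z - gridPt N x‖ ≤ 2 / N ^ 5 := by
  have hNR : (5 : ℝ) ≤ N := by exact_mod_cast hN5
  have hP : (1 : ℝ) ≤ N ^ 5 := one_le_pow₀ (by linarith)
  obtain ⟨hr1, hr2⟩ := abs_le.1 hre
  have a0 : 0 ≤ (z.re + N) * N ^ 5 := mul_nonneg (by linarith) (by linarith)
  have b0 : 0 ≤ z.im * (N : ℝ) ^ 5 := by positivity
  have a1 := Nat.floor_le a0
  have a2 := Nat.lt_floor_add_one ((z.re + N) * (N : ℝ) ^ 5)
  have b1 := Nat.le_ceil (z.im * (N : ℝ) ^ 5)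
  have b2 := Nat.ceil_lt_add_one b0
  set m := ⌊(z.re + N) * (N : ℝ) ^ 5⌋₊
  set n := ⌈z.im * (N : ℝ) ^ 5⌉₊
  have hm : m < 2 * N ^ 6 + 1 := by
    have : (m : ℝ) < (2 * N ^ 6 + 1 : ℕ) := by
      push_cast
      calc (m : ℝ) ≤ (z.re + N) * N ^ 5 := a1
        _ ≤ (2 * N) * N ^ 5 := by gcongr; linarith
        _ < _ := by ring_nf; linarith
    exact_mod_cast this
  have hn : n < N ^ 6 + 1 := by
    have : (n : ℝ) < (N ^ 6 + 1 : ℕ) := by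
      push_cast
      calc (n : ℝ) < z.im * N ^ 5 + 1 := b2
        _ ≤ N * N ^ 5 + 1 := by gcongr; linarith
        _ = _ := by ring
    exact_mod_cast this
  have hA1 : (m : ℝ) / N ^ 5 ≤ z.re + N := by rw [div_le_iff₀ (by linarith)]; exact a1
  have hA2 : z.re + N ≤ (m : ℝ) / N ^ 5 + 1 / N ^ 5 := by
    rw [← add_div, le_div_iff₀ (by linarith)]; exact a2.le
  have hB1 : z.im ≤ (n : ℝ) / N ^ 5 := by rw [le_div_iff₀ (by linarith)]; exact b1
  have hB2 : (n : ℝ) / N ^ 5 ≤ z.im + 1 / N ^ 5 := by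
    rw [div_le_iff₀ (by linarith), add_mul, one_div_mul_cancel (by linarith)]; exact b2.le
  have hP1 : 1 / (N : ℝ) ^ 5 ≤ 1 := by rw [div_le_one (by linarith)]; exact hP
  refine ⟨(⟨m, hm⟩, ⟨n, hn⟩), hB1, ?_, ?_⟩
  · have hm0 : 0 ≤ (m : ℝ) / N ^ 5 := by positivity
    show |(m : ℝ) / N ^ 5 - N| ≤ N
    rw [abs_le]
    constructor <;> linarith
  · refine (Complex.norm_le_abs_re_add_abs_im _).trans ?_
    have c1 : |(z - gridPt N (⟨m, hm⟩, ⟨n, hn⟩)).re| ≤ 1 / N ^ 5 := by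
      show |z.re - ((m : ℝ) / N ^ 5 - N)| ≤ _
      rw [abs_le]
      have : 0 < 1 / (N : ℝ) ^ 5 := by positivity
      constructor <;> linarith
    have c2 : |(z - gridPt N (⟨m, hm⟩, ⟨n, hn⟩)).im| ≤ 1 / N ^ 5 := by
      show |z.im - (n : ℝ) / N ^ 5| ≤ _
      rw [abs_le]
      have : 0 < 1 / (N : ℝ) ^ 5 := by positivity
      constructor <;> linarith
    calc _ ≤ 1 / (N : ℝ) ^ 5 + 1 / N ^ 5 := add_le_add c1 c2
      _ = _ := by ring

open scoped Classical in
lemma card_not_localLaw_le (hN5 : 5 ≤ N) (hdN : d ≤ N) (hd : 128 ≤ √((d : ℝ) - 1)) {ε : ℝ}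
    (h1 : (√(d : ℝ))⁻¹ ≤ ε) (h2 : √(d : ℝ) ^ 3 / N ≤ ε) {ξ : ℝ} (hξ : 1 ≤ ξ)
    (hp : 100 * Real.log N ^ 2 ≤ ξ * Real.log ξ) :
    (((regSet N d).filter fun G => ∃ hG : IsRegGraph N d G,
      ¬ LocalLaw ε ξ (HmatR_isHermitian hG).eigenvalues).card : ℝ) ≤
      Real.exp (-(ξ * Real.log ξ)) * (regSet N d).card := by
  have hN : 0 < N := by omega
  have hNR : (5 : ℝ) ≤ N := by exact_mod_cast hN5
  have hd1 : (1 : ℝ) ≤ d := by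
    have := (sqrt_sub_one_bounds hd).1
    linarith
  have hdNR : (d : ℝ) ≤ N := by exact_mod_cast hdN
  have hNε : 1 / (N : ℝ) ≤ ε := by
    refine le_trans ?_ h1
    rw [one_div]
    gcongr
    rw [Real.sqrt_le_left (by linarith)]
    nlinarith
  have hL : 1 ≤ Real.log N := by
    rw [Real.le_log_iff_exp_le (by linarith)]
    have := Real.exp_one_lt_d9
    linarith
  have hp1 : 1 ≤ ξ * Real.log ξ := by nlinarith
  set p := ξ * Real.log ξ with hpdef
  set M : ℝ := ((regSet N d).card : ℝ) with hM
  set B := (N ^ 14 : ℝ)⁻¹ * (Real.exp (-(99 * p)) * M) with hB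
  have hB0 : 0 ≤ B := by positivity
  obtain ⟨P, hP⟩ : ∃ P : (Fin (2 * N ^ 6 + 1) × Fin (N ^ 6 + 1)) → (Fin N → Fin N → Bool) → Prop,
      ∀ x G, P x G ↔ (0 < (gridPt N x).im ∧ 1 ≤ N * (gridPt N x).im ∧ |(gridPt N x).re| ≤ N ∧
        2 * (10000000 * ξ * ctrl N (gridPt N x).im ε) ≤ 1 / 100) ∧
      ∃ hG : IsRegGraph N d G, 30000000 * ξ * ctrl N (gridPt N x).im ε <
        ‖scErr (HmatR_isHermitian hG).eigenvalues (gridPt N x)‖ := ⟨_, fun _ _ => Iff.rfl⟩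
  have hgrid := card_filter_exists_le (regSet N d) P (B := B) fun x => by
    by_cases hx : 0 < (gridPt N x).im ∧ 1 ≤ N * (gridPt N x).im ∧ |(gridPt N x).re| ≤ N ∧
      2 * (10000000 * ξ * ctrl N (gridPt N x).im ε) ≤ 1 / 100
    · refine le_trans (Nat.cast_le.2 (Finset.card_le_card ?_))
        (card_pointwise_le hN5 hdN hd h1 h2 hξ hp hx.1 hx.2.1 hx.2.2.1 hx.2.2.2)
      exact Finset.monotone_filter_right _ fun G _ h => ((hP _ _).1 h).2
    · have : ((regSet N d).filter fun a => P x a) = ∅ := by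
        rw [Finset.filter_eq_empty_iff]
        exact fun G _ h => hx ((hP _ _).1 h).1
      rw [this]
      simpa using hB0
  have hsub : ((regSet N d).filter fun G => ∃ hG : IsRegGraph N d G,
      ¬ LocalLaw ε ξ (HmatR_isHermitian hG).eigenvalues) ⊆
      (regSet N d).filter fun G => ∃ x, P x G := by
    refine Finset.monotone_filter_right _ fun G _ => ?_
    rintro ⟨hG, hLL⟩
    by_contra! hc
    refine hLL fun z hre him h0 hNz hsm => ?_
    obtain ⟨x, hx1, hx2, hx3⟩ := exists_gridPt hN5 hre him h0
    have hanti := ctrl_anti (ε := ε) hN h0 hx1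
    have hw0 : 0 < (gridPt N x).im := by linarith
    have hNw : 1 ≤ N * (gridPt N x).im := hNz.trans (by gcongr)
    have hw : ‖scErr (HmatR_isHermitian hG).eigenvalues (gridPt N x)‖ ≤
        30000000 * ξ * ctrl N (gridPt N x).im ε := by
      by_contra! h
      refine hc x ((hP _ _).2 ⟨⟨hw0, hNw, hx2, le_trans ?_ hsm⟩, hG, h⟩)
      gcongr
    have hz2 : ‖z‖ ≤ 2 * N := by
      refine (Complex.norm_le_abs_re_add_abs_im _).trans ?_
      rw [abs_of_pos h0]
      linarith
    have hdiff := norm_scErr_sub_le hN5 (HmatR_isHermitian hG).eigenvalues hNz hNw hx3 hz2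
    have htri := norm_le_norm_add_norm_sub' (scErr (HmatR_isHermitian hG).eigenvalues z)
      (scErr (HmatR_isHermitian hG).eigenvalues (gridPt N x))
    have hc1 : ε ≤ ctrl N z.im ε := by
      unfold ctrl
      have : 0 ≤ (√(N * z.im))⁻¹ := by positivity
      linarith
    have hc0 : 0 < ctrl N z.im ε := lt_of_lt_of_le (by positivity) (hNε.trans hc1)
    have hc2 : 10 / (N : ℝ) ≤ 10 * (ξ * ctrl N z.im ε) := by
      calc 10 / (N : ℝ) = 10 * (1 / N) := by ring
        _ ≤ 10 * (1 * ctrl N z.im ε) := by rw [one_mul]; gcongr; exact hNε.trans hc1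
        _ ≤ _ := by gcongr
    have hc3 : 30000000 * ξ * ctrl N (gridPt N x).im ε ≤ 30000000 * ξ * ctrl N z.im ε := by
      gcongr
    have hc4 : 0 ≤ ξ * ctrl N z.im ε := by positivity
    linarith
  refine (Nat.cast_le.2 (Finset.card_le_card hsub)).trans (hgrid.trans ?_)
  rw [Fintype.card_prod, Fintype.card_fin, Fintype.card_fin]
  have hcount : (((2 * N ^ 6 + 1) * (N ^ 6 + 1) : ℕ) : ℝ) ≤ N ^ 14 := by
    push_cast
    have g1 : (1 : ℝ) ≤ N ^ 6 := one_le_pow₀ (by linarith)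
    calc (2 * (N : ℝ) ^ 6 + 1) * ((N : ℝ) ^ 6 + 1) ≤
        (2 * (N : ℝ) ^ 6 + (N : ℝ) ^ 6) * ((N : ℝ) ^ 6 + (N : ℝ) ^ 6) := by gcongr
      _ = 6 * (N : ℝ) ^ 12 := by ring
      _ ≤ (N : ℝ) * N * (N : ℝ) ^ 12 := by
          gcongr
          nlinarith
      _ = _ := by ring
  calc _ ≤ (N : ℝ) ^ 14 * B := by gcongr
    _ = Real.exp (-(99 * p)) * M := by
        rw [hB, mul_inv_cancel_left₀]
        positivity
    _ ≤ _ := by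
        gcongr
        linarith

end Uniform

section Existence

lemma exists_symmetric_finset {N d : ℕ} (hd : d < N) (h : Even (N * d)) :
    ∃ T : Finset ℕ, T.card = d ∧ (∀ t ∈ T, 1 ≤ t ∧ t < N) ∧ ∀ t ∈ T, N - t ∈ T := by
  rcases Nat.even_or_odd' d with ⟨k, hk | hk⟩
  · refine ⟨Finset.Icc 1 k ∪ Finset.Ico (N - k) N, ?_, ?_, ?_⟩
    · rw [Finset.card_union_of_disjoint, Nat.card_Icc, Nat.card_Ico]
      · omega
      · rw [Finset.disjoint_left]
        intro t
        simp only [Finset.mem_Icc, Finset.mem_Ico]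
        omega
    · intro t
      simp only [Finset.mem_union, Finset.mem_Icc, Finset.mem_Ico]
      omega
    · intro t
      simp only [Finset.mem_union, Finset.mem_Icc, Finset.mem_Ico]
      omega
  · have hN : Even N := by
      rcases Nat.even_mul.1 h with h | h
      · exact h
      · obtain ⟨m, hm⟩ := h
        omega
    obtain ⟨m, hm⟩ := hN
    refine ⟨Finset.Icc 1 k ∪ Finset.Ico (N - k) N ∪ {m}, ?_, ?_, ?_⟩
    · rw [Finset.card_union_of_disjoint, Finset.card_union_of_disjoint, Nat.card_Icc, Nat.card_Ico,
        Finset.card_singleton]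
      · omega
      · rw [Finset.disjoint_left]
        intro t
        simp only [Finset.mem_Icc, Finset.mem_Ico]
        omega
      · rw [Finset.disjoint_left]
        intro t
        simp only [Finset.mem_union, Finset.mem_Icc, Finset.mem_Ico, Finset.mem_singleton]
        omega
    · intro t
      simp only [Finset.mem_union, Finset.mem_Icc, Finset.mem_Ico, Finset.mem_singleton]
      omega
    · intro t
      simp only [Finset.mem_union, Finset.mem_Icc, Finset.mem_Ico, Finset.mem_singleton]
      omega

lemma exists_isRegGraph {N d : ℕ} (hd : d < N) (h : Even (N * d)) :
    ∃ G, IsRegGraph N d G := by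
  obtain ⟨T, hT, hT1, hT2⟩ := exists_symmetric_finset hd h
  refine ⟨fun i j => decide (((i : ℕ) - j) + (j - i) ∈ T), fun i j => ?_, fun i => ?_, fun i => ?_⟩
  · dsimp only
    rw [Nat.add_comm]
  · simp only [Nat.sub_self, decide_eq_false_iff_not]
    intro h0
    have := hT1 _ h0
    omega
  · rw [← hT]
    refine Finset.card_bij' (fun j _ => if (i : ℕ) ≤ j then (j : ℕ) - i else N + j - i)
      (fun t ht => ⟨if i + t < N then i + t else i + t - N, ?_⟩) ?_ ?_ ?_ ?_
    · have := hT1 t ht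
      split_ifs <;> omega
    · intro j hj
      simp only [decide_eq_true_eq, Finset.mem_filter, Finset.mem_univ, true_and] at hj
      split_ifs with hij
      · convert hj using 1
        omega
      · convert hT2 _ hj using 1
        omega
    · intro t ht
      have h1 := hT1 t ht
      simp only [decide_eq_true_eq, Finset.mem_filter, Finset.mem_univ, true_and]
      split_ifs with hij
      · convert ht using 1
        omega
      · convert hT2 t ht using 1
        omega
    · intro j hj
      ext
      have := i.2
      have := j.2
      dsimp only
      split_ifs <;> omega
    · intro t ht
      have h1 := hT1 t ht
      have := i.2
      dsimp only
      split_ifs <;> omega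

lemma card_regSet_pos {N d : ℕ} (hd : d < N) (h : Even (N * d)) : 0 < (regSet N d).card := by
  obtain ⟨G, hG⟩ := exists_isRegGraph hd h
  exact Finset.card_pos.2 ⟨G, mem_regSet.2 hG⟩

end Existence

section SemicircleTransform

/-- The branch of the square root which is continuous on the closed upper half-plane. -/
def usqrt (w : ℂ) : ℂ := ⟨√((‖w‖ + w.re) / 2), √((‖w‖ - w.re) / 2)⟩

lemma continuous_usqrt : Continuous usqrt := by
  have h : usqrt = fun w => ((√((‖w‖ + w.re) / 2) : ℝ) : ℂ) +
      ((√((‖w‖ - w.re) / 2) : ℝ) : ℂ) * Complex.I := by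
    funext w
    apply Complex.ext <;> simp [usqrt]
  rw [h]
  have h1 : Continuous Complex.re := Complex.continuous_re
  fun_prop

lemma usqrt_sq {w : ℂ} (hw : 0 ≤ w.im) : usqrt w ^ 2 = w := by
  have h1 : 0 ≤ (‖w‖ + w.re) / 2 := by linarith [neg_abs_le w.re, Complex.abs_re_le_norm w]
  have h2 : 0 ≤ (‖w‖ - w.re) / 2 := by linarith [le_abs_self w.re, Complex.abs_re_le_norm w]
  have h3 : √((‖w‖ + w.re) / 2) * √((‖w‖ - w.re) / 2) = w.im / 2 := by
    rw [← Real.sqrt_mul h1, Real.sqrt_eq_iff_mul_self_eq (by positivity) (by linarith)]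
    have := Complex.sq_norm w
    rw [Complex.normSq_apply] at this
    linarith
  rw [sq]
  apply Complex.ext
  · simp only [Complex.mul_re, usqrt, Real.mul_self_sqrt h1, Real.mul_self_sqrt h2]
    ring
  · simp only [Complex.mul_im, usqrt]
    linarith

lemma differentiableAt_usqrt {w : ℂ} (hw : 0 < w.im) : DifferentiableAt ℂ usqrt w := by
  have hne : usqrt w ≠ 0 := fun h => by
    have := usqrt_sq hw.le
    rw [h] at this
    rw [← this] at hw
    simp at hw
  refine (HasDerivAt.of_local_left_inverse (f := fun x : ℂ => x ^ 2) (f' := 2 * usqrt w)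
    continuous_usqrt.continuousAt ?_ (by simpa using hne) ?_).differentiableAt
  · simpa using hasDerivAt_pow 2 (usqrt w)
  · filter_upwards [(isOpen_lt continuous_const Complex.continuous_im).mem_nhds hw] with y hy
    exact usqrt_sq (le_of_lt hy)

lemma norm_usqrt_sq {w : ℂ} (hw : 0 ≤ w.im) : ‖usqrt w‖ ^ 2 = ‖w‖ := by
  rw [← norm_pow, usqrt_sq hw]

/-- A continuous branch of `√(z² - 4)` on the closed upper half-plane. -/
def edgeSqrt (z : ℂ) : ℂ := usqrt (z + 2) * usqrt (z - 2)

/-- The Stieltjes transform of the semicircle law. -/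
def scTransform (z : ℂ) : ℂ := (edgeSqrt z - z) / 2

lemma continuous_scTransform : Continuous scTransform := by
  have := continuous_usqrt
  unfold scTransform edgeSqrt
  fun_prop

lemma differentiableAt_scTransform {z : ℂ} (hz : 0 < z.im) :
    DifferentiableAt ℂ scTransform z := by
  have h1 : DifferentiableAt ℂ usqrt (z + 2) := differentiableAt_usqrt (by simpa using hz)
  have h2 : DifferentiableAt ℂ usqrt (z - 2) := differentiableAt_usqrt (by simpa using hz)
  unfold scTransform edgeSqrt
  have h3 : DifferentiableAt ℂ (fun z => usqrt (z + 2)) z :=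
    h1.comp z (differentiableAt_id.add_const 2)
  have h4 : DifferentiableAt ℂ (fun z => usqrt (z - 2)) z :=
    h2.comp z (differentiableAt_id.sub_const 2)
  exact ((h3.mul h4).sub differentiableAt_id).div_const 2

lemma edgeSqrt_sq {z : ℂ} (hz : 0 ≤ z.im) : edgeSqrt z ^ 2 = z ^ 2 - 4 := by
  rw [edgeSqrt, mul_pow, usqrt_sq (by simpa using hz), usqrt_sq (by simpa using hz)]
  ring

lemma scTransform_mul {z : ℂ} (hz : 0 ≤ z.im) (s : ℂ) :
    (s - scTransform z) * (s - scTransform z + edgeSqrt z) = 1 + z * s + s ^ 2 := by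
  have := edgeSqrt_sq hz
  unfold scTransform
  linear_combination (-1 / 4) * this

lemma scTransform_eq {z : ℂ} (hz : 0 ≤ z.im) :
    scTransform z = -((usqrt (z + 2) - usqrt (z - 2)) ^ 2 / 4) := by
  have h1 := usqrt_sq (w := z + 2) (by simpa using hz)
  have h2 := usqrt_sq (w := z - 2) (by simpa using hz)
  unfold scTransform edgeSqrt
  linear_combination (1 / 4) * h1 + 1 / 4 * h2

lemma norm_scTransform_le {z : ℂ} (hz : 0 ≤ z.im) : ‖scTransform z‖ ≤ 1 := by
  have h1 := usqrt_sq (w := z + 2) (by simpa using hz)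
  have h2 := usqrt_sq (w := z - 2) (by simpa using hz)
  set a := usqrt (z + 2) with ha
  set b := usqrt (z - 2) with hb
  have hre : 0 ≤ a.re * b.re + a.im * b.im := by
    simp only [ha, hb, usqrt]
    positivity
  have hle : ‖a - b‖ ^ 2 ≤ ‖a + b‖ ^ 2 := by
    rw [Complex.sq_norm, Complex.sq_norm, Complex.normSq_apply, Complex.normSq_apply]
    simp only [Complex.sub_re, Complex.sub_im, Complex.add_re, Complex.add_im]
    nlinarith
  have hprod : ‖a - b‖ * ‖a + b‖ = 4 := by
    rw [← norm_mul, show (a - b) * (a + b) = 4 by linear_combination h1 - h2]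
    norm_num
  rw [scTransform_eq hz, norm_neg, norm_div, norm_pow]
  have hle' : ‖a - b‖ ≤ ‖a + b‖ := 
    (pow_le_pow_iff_left₀ (norm_nonneg _) (norm_nonneg _) two_ne_zero).1 hle
  have : ‖a - b‖ ^ 2 ≤ 4 := by nlinarith [norm_nonneg (a - b)]
  rw [← ha, ← hb, Complex.norm_ofNat, div_le_one (by norm_num)]
  exact this

lemma norm_edgeSqrt_sq {z : ℂ} (hz : 0 ≤ z.im) : ‖edgeSqrt z‖ ^ 2 = ‖z - 2‖ * ‖z + 2‖ := by
  rw [edgeSqrt, norm_mul, mul_pow, norm_usqrt_sq (by simpa using hz),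
    norm_usqrt_sq (by simpa using hz), mul_comm]

lemma usqrt_ofReal (x : ℝ) : usqrt (x : ℂ) = ⟨√(max x 0), √(max (-x) 0)⟩ := by
  unfold usqrt
  rcases le_total 0 x with h | h
  · simp [abs_of_nonneg h, h]
  · simp only [Complex.norm_real, Real.norm_eq_abs, Complex.ofReal_re, abs_of_nonpos h,
      max_eq_right h, max_eq_left (neg_nonneg.2 h)]
    ring_nf
    rw [Real.sqrt_zero]

lemma scTransform_ofReal_im (x : ℝ) :
    (scTransform (x : ℂ)).im = √(max (4 - x ^ 2) 0) / 2 := by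
  have h1 : usqrt ((x : ℂ) + 2) = ⟨√(max (x + 2) 0), √(max (-(x + 2)) 0)⟩ := by
    rw [← usqrt_ofReal]
    push_cast
    rfl
  have h2 : usqrt ((x : ℂ) - 2) = ⟨√(max (x - 2) 0), √(max (-(x - 2)) 0)⟩ := by
    rw [← usqrt_ofReal]
    push_cast
    rfl
  unfold scTransform edgeSqrt
  rw [h1, h2, Complex.div_ofNat_im, Complex.sub_im, Complex.mul_im, Complex.ofReal_im, sub_zero]
  dsimp only
  congr 1
  rcases le_total x (-2) with h | h
  · rw [max_eq_right (by linarith : x + 2 ≤ 0), max_eq_right (by linarith : x - 2 ≤ 0),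
      max_eq_right (by nlinarith : 4 - x ^ 2 ≤ 0)]
    simp
  rcases le_total x 2 with h' | h'
  · rw [max_eq_left (by linarith : 0 ≤ x + 2), max_eq_right (by linarith : x - 2 ≤ 0),
      max_eq_left (by nlinarith : 0 ≤ 4 - x ^ 2), max_eq_left (by linarith : 0 ≤ -(x - 2)),
      ← Real.sqrt_mul (by linarith), Real.sqrt_zero, mul_zero, add_zero]
    ring_nf
  · rw [max_eq_right (by linarith : -(x - 2) ≤ 0), max_eq_right (by linarith : -(x + 2) ≤ 0),
      max_eq_right (by nlinarith : 4 - x ^ 2 ≤ 0)]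
    simp

end SemicircleTransform

section Stability

variable {N : ℕ}

lemma differentiableAt_stieltjes (ev : Fin N → ℝ) {z : ℂ} (hz : 0 < z.im) :
    DifferentiableAt ℂ (stieltjes ev) z := by
  unfold stieltjes
  have h : ∀ α, (ev α : ℂ) - z ≠ 0 := fun α h => by
    have := congrArg Complex.im h
    simp at this
    linarith
  refine DifferentiableAt.const_mul ?_ _
  refine DifferentiableAt.fun_sum fun α _ => ?_
  exact (differentiableAt_const _).div ((differentiableAt_const _).sub differentiableAt_id) (h α)

/-- The difference between the empirical and the semicircle Stieltjes transforms. -/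
def stieltjesDiff (ev : Fin N → ℝ) (z : ℂ) : ℂ := stieltjes ev z - scTransform z

lemma differentiableAt_stieltjesDiff (ev : Fin N → ℝ) {z : ℂ} (hz : 0 < z.im) :
    DifferentiableAt ℂ (stieltjesDiff ev) z :=
  (differentiableAt_stieltjes ev hz).sub (differentiableAt_scTransform hz)

lemma stieltjesDiff_mul (ev : Fin N → ℝ) {z : ℂ} (hz : 0 ≤ z.im) :
    stieltjesDiff ev z * (stieltjesDiff ev z + edgeSqrt z) = scErr ev z :=
  scTransform_mul hz _

lemma norm_edgeSqrt_mono {E y y' : ℝ} (hy : 0 ≤ y) (h : y ≤ y') :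
    ‖edgeSqrt ⟨E, y⟩‖ ≤ ‖edgeSqrt ⟨E, y'⟩‖ := by
  rw [← pow_le_pow_iff_left₀ (norm_nonneg _) (norm_nonneg _) two_ne_zero,
    norm_edgeSqrt_sq (show 0 ≤ (⟨E, y⟩ : ℂ).im from hy),
    norm_edgeSqrt_sq (show 0 ≤ (⟨E, y'⟩ : ℂ).im from hy.trans h)]
  have key : ∀ c : ℂ, c.im = 0 → ‖(⟨E, y⟩ : ℂ) + c‖ ≤ ‖(⟨E, y'⟩ : ℂ) + c‖ := fun c hc => by
    rw [Complex.norm_def, Complex.norm_def, Complex.normSq_apply, Complex.normSq_apply]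
    simp only [Complex.add_re, Complex.add_im, hc, add_zero]
    gcongr
    linarith
  have h1 := key 2 (by simp)
  have h2 := key (-2) (by simp)
  rw [← sub_eq_add_neg, ← sub_eq_add_neg] at h2
  gcongr

lemma norm_stieltjesDiff_lt (hN : 0 < N) (ev : Fin N → ℝ) {z : ℂ} (hz : 4 ≤ z.im) :
    ‖stieltjesDiff ev z‖ < ‖edgeSqrt z‖ / 2 := by
  have hz0 : 0 < z.im := by linarith
  have h1 := norm_stieltjes_le hN ev hz0
  have h2 : 1 / z.im ≤ 1 / 4 := by gcongr
  have h3 := norm_scTransform_le hz0.le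
  have h4 : 4 ≤ ‖z‖ := hz.trans ((le_abs_self _).trans (Complex.abs_im_le_norm z))
  have h5 := norm_sub_le (stieltjes ev z) (scTransform z)
  have h6 : ‖z‖ ≤ ‖edgeSqrt z‖ + 2 * ‖scTransform z‖ := by
    have : z = edgeSqrt z - 2 * scTransform z := by
      unfold scTransform
      ring
    calc ‖z‖ = ‖edgeSqrt z - 2 * scTransform z‖ := by rw [← this]
      _ ≤ ‖edgeSqrt z‖ + ‖2 * scTransform z‖ := norm_sub_le _ _
      _ = _ := by rw [norm_mul, Complex.norm_ofNat]
  have h7 := scTransform_mul hz0.le 0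
  rw [zero_sub, mul_zero, add_zero, zero_pow two_ne_zero, add_zero] at h7
  have h8 : ‖scTransform z‖ * ‖-scTransform z + edgeSqrt z‖ = 1 := by
    rw [← norm_neg (scTransform z), ← norm_mul, h7, norm_one]
  have h9 : -scTransform z + edgeSqrt z = z + scTransform z := by
    unfold scTransform
    ring
  have h10 : ‖z‖ ≤ ‖z + scTransform z‖ + ‖scTransform z‖ := by
    simpa using norm_sub_le (z + scTransform z) (scTransform z)
  rw [h9] at h8
  have h11 : ‖scTransform z‖ ≤ 1 / 3 := by
    nlinarith [norm_nonneg (scTransform z)]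
  have : ‖stieltjesDiff ev z‖ ≤ ‖stieltjes ev z‖ + ‖scTransform z‖ := h5
  linarith

lemma norm_stieltjesDiff_le (hN : 0 < N) (ev : Fin N → ℝ) {E y τ : ℝ} (hy : 0 < y) (hτ : 0 ≤ τ)
    (h : ∀ t, y ≤ t → t ≤ max y 4 → ‖scErr ev ⟨E, t⟩‖ ≤ τ) :
    ‖stieltjesDiff ev ⟨E, y⟩‖ ≤ 4 * √τ ∧
      ‖stieltjesDiff ev ⟨E, y⟩‖ * ‖edgeSqrt ⟨E, y⟩‖ ≤ 12 * τ := by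
  set q : ℝ → ℝ := fun t => ‖edgeSqrt ⟨E, t⟩‖ with hq
  set u : ℝ → ℝ := fun t => ‖stieltjesDiff ev ⟨E, t⟩‖ with hu
  have hprod : ∀ t, y ≤ t → t ≤ max y 4 → u t * ‖stieltjesDiff ev ⟨E, t⟩ + edgeSqrt ⟨E, t⟩‖ ≤ τ :=
    fun t h1 h2 => by
      rw [hu, ← norm_mul, stieltjesDiff_mul ev (show 0 ≤ (⟨E, t⟩ : ℂ).im from hy.le.trans h1)]
      exact h t h1 h2
  have htri : ∀ t, q t ≤ ‖stieltjesDiff ev ⟨E, t⟩ + edgeSqrt ⟨E, t⟩‖ + u t := fun t => by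
    simpa using norm_sub_le (stieltjesDiff ev ⟨E, t⟩ + edgeSqrt ⟨E, t⟩) (stieltjesDiff ev ⟨E, t⟩)
  have htri' : u y ≤ ‖stieltjesDiff ev ⟨E, y⟩ + edgeSqrt ⟨E, y⟩‖ + q y := by
    simpa using norm_sub_le (stieltjesDiff ev ⟨E, y⟩ + edgeSqrt ⟨E, y⟩) (edgeSqrt ⟨E, y⟩)
  have hu0 : ∀ t, 0 ≤ u t := fun t => norm_nonneg _
  have hq0 : ∀ t, 0 ≤ q t := fun t => norm_nonneg _
  change u y ≤ 4 * √τ ∧ u y * q y ≤ 12 * τ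
  set r := √τ with hr
  have hr0 : 0 ≤ r := Real.sqrt_nonneg _
  have hr2 : r * r = τ := Real.mul_self_sqrt hτ
  have hymax : y ≤ max y 4 := le_max_left _ _
  have hpy := hprod y le_rfl hymax
  rcases le_or_gt (q y) (3 * r) with hc | hc
  · have h1 : u y ≤ 4 * r := by
      by_contra! hlt
      have : r < u y - q y := by linarith
      have h3 : u y * (u y - q y) ≤ τ := le_trans (by gcongr; linarith) hpy
      nlinarith
    exact ⟨h1, by nlinarith [hu0 y, hq0 y]⟩
  · have hne : ∀ t ∈ Set.Icc y (max y 4), u t - q t / 2 ≠ 0 := fun t ht h0 => by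
      have h1 : q y ≤ q t := norm_edgeSqrt_mono hy.le ht.1
      have h2 := hprod t ht.1 ht.2
      have h3 := htri t
      have h4 : u t = q t / 2 := by linarith
      have h5 : q t / 2 * (q t / 2) ≤ τ := by
        refine le_trans ?_ h2
        rw [h4]
        have := hq0 t
        gcongr
        linarith
      nlinarith
    have hcont : ContinuousOn (fun t => u t - q t / 2) (Set.Icc y (max y 4)) := by
      have hline : Continuous fun t : ℝ => (⟨E, t⟩ : ℂ) := by
        have : (fun t : ℝ => (⟨E, t⟩ : ℂ)) = fun t : ℝ => (E : ℂ) + t * Complex.I := by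
          funext t
          apply Complex.ext <;> simp
        rw [this]
        fun_prop
      have hsq : Continuous edgeSqrt := by
        have := continuous_usqrt
        unfold edgeSqrt
        fun_prop
      refine ContinuousOn.sub ?_ ((hsq.comp hline).norm.div_const 2).continuousOn
      refine ContinuousOn.norm fun t ht => ?_
      have : ContinuousAt (stieltjesDiff ev) (⟨E, t⟩ : ℂ) :=
        (differentiableAt_stieltjesDiff ev
          (show 0 < (⟨E, t⟩ : ℂ).im from hy.trans_le ht.1)).continuousAt
      exact (ContinuousAt.comp (f := fun t : ℝ => (⟨E, t⟩ : ℂ)) this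
        hline.continuousAt).continuousWithinAt
    have hend : u (max y 4) - q (max y 4) / 2 < 0 :=
      sub_neg.2 (norm_stieltjesDiff_lt hN ev (z := ⟨E, max y 4⟩) (le_max_right y 4))
    have hlt : u y - q y / 2 < 0 := by
      by_contra! hge
      obtain ⟨t, ht, h0⟩ := intermediate_value_Icc' hymax hcont ⟨hend.le, hge⟩
      exact hne t ht h0
    have h1 : q y / 2 ≤ ‖stieltjesDiff ev ⟨E, y⟩ + edgeSqrt ⟨E, y⟩‖ := by
      have := htri y
      linarith
    have h2 : u y * (q y / 2) ≤ τ := le_trans (by have := hu0 y; gcongr) hpy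
    refine ⟨?_, by linarith⟩
    by_contra! hlt'
    nlinarith [hu0 y]

lemma edge_le_norm_edgeSqrt_sq {E y κ : ℝ} (hy : 0 ≤ y) (h1 : κ ≤ |E - 2|) (h2 : κ ≤ |E + 2|) :
    2 * max κ y ≤ ‖edgeSqrt ⟨E, y⟩‖ ^ 2 := by
  rw [norm_edgeSqrt_sq (show 0 ≤ (⟨E, y⟩ : ℂ).im from hy)]
  have a1 : max κ y ≤ ‖(⟨E, y⟩ : ℂ) - 2‖ := by
    refine max_le (h1.trans ?_) ((le_abs_self _).trans ?_)
    · simpa using Complex.abs_re_le_norm ((⟨E, y⟩ : ℂ) - 2)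
    · simpa using Complex.abs_im_le_norm ((⟨E, y⟩ : ℂ) - 2)
  have a2 : max κ y ≤ ‖(⟨E, y⟩ : ℂ) + 2‖ := by
    refine max_le (h2.trans ?_) ((le_abs_self _).trans ?_)
    · simpa using Complex.abs_re_le_norm ((⟨E, y⟩ : ℂ) + 2)
    · simpa using Complex.abs_im_le_norm ((⟨E, y⟩ : ℂ) + 2)
  have a3 : 4 ≤ ‖(⟨E, y⟩ : ℂ) + 2‖ + ‖(⟨E, y⟩ : ℂ) - 2‖ := by
    have := norm_sub_le ((⟨E, y⟩ : ℂ) + 2) ((⟨E, y⟩ : ℂ) - 2)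
    rw [show ((⟨E, y⟩ : ℂ) + 2) - ((⟨E, y⟩ : ℂ) - 2) = 4 by ring, Complex.norm_ofNat] at this
    exact this
  have a0 : 0 ≤ max κ y := le_max_of_le_right hy
  rcases le_total 2 ‖(⟨E, y⟩ : ℂ) + 2‖ with h | h
  · nlinarith
  · have : 2 ≤ ‖(⟨E, y⟩ : ℂ) - 2‖ := by linarith
    nlinarith

end Stability

section Contour

lemma continuous_mk_left (y : ℝ) : Continuous fun x : ℝ => (⟨x, y⟩ : ℂ) := by
  simp_rw [Complex.mk_eq_add_mul_I]
  fun_prop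

lemma continuous_mk_right (x : ℝ) : Continuous fun y : ℝ => (⟨x, y⟩ : ℂ) := by
  simp_rw [Complex.mk_eq_add_mul_I]
  fun_prop

lemma norm_integral_sub_integral_le {f : ℂ → ℂ} {a b y₁ y₂ : ℝ} (hy : y₁ ≤ y₂)
    (hc : ContinuousOn f {z | y₁ ≤ z.im}) (hd : ∀ z : ℂ, y₁ < z.im → DifferentiableAt ℂ f z) :
    ‖(∫ x in a..b, f ⟨x, y₁⟩) - ∫ x in a..b, f ⟨x, y₂⟩‖ ≤
      (∫ y in y₁..y₂, ‖f ⟨a, y⟩‖) + ∫ y in y₁..y₂, ‖f ⟨b, y⟩‖ := by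
  have key := Complex.integral_boundary_rect_eq_zero_of_continuousOn_of_differentiableOn f
    ⟨a, y₁⟩ ⟨b, y₂⟩ (hc.mono fun z hz => ?_) fun z hz => ?_
  · simp only [← Complex.mk_eq_add_mul_I] at key
    have h1 : (∫ x in a..b, f ⟨x, y₁⟩) - ∫ x in a..b, f ⟨x, y₂⟩ =
        Complex.I • (∫ y in y₁..y₂, f ⟨a, y⟩) - Complex.I • ∫ y in y₁..y₂, f ⟨b, y⟩ := by
      linear_combination key
    rw [h1]
    refine (norm_sub_le _ _).trans ?_
    rw [norm_smul, norm_smul, Complex.norm_I, one_mul, one_mul]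
    exact add_le_add (intervalIntegral.norm_integral_le_integral_norm hy)
      (intervalIntegral.norm_integral_le_integral_norm hy)
  · rw [Complex.mem_reProdIm, Set.uIcc_of_le hy] at hz
    exact hz.2.1
  · rw [Complex.mem_reProdIm, min_eq_left hy] at hz
    exact (hd z hz.2.1).differentiableWithinAt

lemma integral_const_add_div_sqrt_le {P Q y₁ y₂ : ℝ} (hP : 0 ≤ P) (hQ : 0 ≤ Q) (h0 : 0 < y₁)
    (hy : y₁ ≤ y₂) : ∫ y in y₁..y₂, (P + Q / √y) ≤ P * y₂ + 2 * Q * √y₂ := by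
  have hpos : ∀ y ∈ Set.uIcc y₁ y₂, 0 < y := fun y h => by
    rw [Set.uIcc_of_le hy] at h
    exact h0.trans_le h.1
  rw [intervalIntegral.integral_eq_sub_of_hasDerivAt (f := fun y => P * y + 2 * Q * √y)]
  · have h1 : 0 ≤ P * y₁ := by positivity
    have h2 : 0 ≤ 2 * Q * √y₁ := by positivity
    linarith
  · intro y hy'
    have h1 := (hasDerivAt_id y).const_mul P
    have h2 := (Real.hasDerivAt_sqrt (hpos y hy').ne').const_mul (2 * Q)
    refine (h1.fun_add h2).congr_deriv ?_
    have : √y ≠ 0 := (Real.sqrt_pos.2 (hpos y hy')).ne'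
    field_simp
  · refine ContinuousOn.intervalIntegrable fun y hy' => ContinuousAt.continuousWithinAt ?_
    have : √y ≠ 0 := (Real.sqrt_pos.2 (hpos y hy')).ne'
    fun_prop (disch := assumption)

lemma norm_integral_le_of_norm_le {f : ℂ → ℂ} {a b η P Q : ℝ} (hP : 0 ≤ P) (hQ : 0 ≤ Q)
    (hη : 0 < η) (hℓ : η ≤ b - a) (hd : ∀ z : ℂ, 0 < z.im → DifferentiableAt ℂ f z)
    (hf : ∀ x y, a ≤ x → x ≤ b → η ≤ y → y ≤ b - a → ‖f ⟨x, y⟩‖ ≤ P + Q / √y) :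
    ‖∫ x in a..b, f ⟨x, η⟩‖ ≤ 3 * P * (b - a) + 5 * Q * √(b - a) := by
  have hab : a ≤ b := by linarith
  have hℓ0 : 0 < b - a := by linarith
  have h1 := norm_integral_sub_integral_le (f := f) (a := a) (b := b) hℓ
    (fun z hz => (hd z (hη.trans_le hz)).continuousAt.continuousWithinAt)
    fun z hz => hd z (hη.trans hz)
  have h2 : ‖∫ x in a..b, f ⟨x, b - a⟩‖ ≤ (P + Q / √(b - a)) * |b - a| :=
    intervalIntegral.norm_integral_le_of_norm_le_const fun x hx => by
      rw [Set.uIoc_of_le hab] at hx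
      exact hf x _ hx.1.le hx.2 hℓ le_rfl
  have h3 : ∀ c, a ≤ c → c ≤ b →
      ∫ y in η..(b - a), ‖f ⟨c, y⟩‖ ≤ P * (b - a) + 2 * Q * √(b - a) := fun c hc hc' => by
    refine le_trans (intervalIntegral.integral_mono_on hℓ ?_ ?_ fun y hy =>
      hf c y hc hc' hy.1 hy.2) (integral_const_add_div_sqrt_le hP hQ hη hℓ)
    · refine ContinuousOn.intervalIntegrable fun y hy => ContinuousAt.continuousWithinAt ?_
      rw [Set.uIcc_of_le hℓ] at hy
      have : ContinuousAt f (⟨c, y⟩ : ℂ) := (hd _ (hη.trans_le hy.1)).continuousAt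
      exact (ContinuousAt.comp (f := fun t : ℝ => (⟨c, t⟩ : ℂ)) this
        (continuous_mk_right c).continuousAt).norm
    · refine ContinuousOn.intervalIntegrable fun y hy => ContinuousAt.continuousWithinAt ?_
      rw [Set.uIcc_of_le hℓ] at hy
      have : √y ≠ 0 := (Real.sqrt_pos.2 (hη.trans_le hy.1)).ne'
      fun_prop (disch := assumption)
  have h4 := h3 a le_rfl hab
  have h5 := h3 b hab le_rfl
  have h6 := norm_le_norm_add_norm_sub' (∫ x in a..b, f ⟨x, η⟩) (∫ x in a..b, f ⟨x, b - a⟩)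
  have h7 : (P + Q / √(b - a)) * |b - a| = P * (b - a) + Q * √(b - a) := by
    rw [abs_of_pos hℓ0, add_mul, div_mul_eq_mul_div, mul_div_assoc, Real.div_sqrt]
  linarith

lemma norm_integral_scTransform_sub_le (a b : ℝ) {η : ℝ} (hη : 0 ≤ η) :
    ‖(∫ x in a..b, scTransform x) - ∫ x in a..b, scTransform ⟨x, η⟩‖ ≤ 2 * η := by
  have h1 := norm_integral_sub_integral_le (f := scTransform) (a := a) (b := b) hη
    continuous_scTransform.continuousOn fun z hz => differentiableAt_scTransform hz
  have h2 : ∀ c : ℝ, ∫ y in (0 : ℝ)..η, ‖scTransform ⟨c, y⟩‖ ≤ η := fun c => by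
    calc _ ≤ ∫ y in (0 : ℝ)..η, (1 : ℝ) := by
          refine intervalIntegral.integral_mono_on hη ?_ (by simp) fun y hy =>
            norm_scTransform_le hy.1
          exact (continuous_scTransform.comp (continuous_mk_right c)).norm.intervalIntegrable _ _
      _ = η := by simp
  have h3 := h2 a
  have h4 := h2 b
  refine le_trans h1 ?_
  linarith

lemma semicircleMeasure_eq {a b : ℝ} (hab : a ≤ b) :
    semicircleMeasure a b = (1 / Real.pi) * (∫ x in a..b, scTransform x).im := by
  have h : (∫ x in a..b, scTransform x).im = ∫ x in a..b, (scTransform x).im :=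
    (intervalIntegral.intervalIntegral_im
      ((continuous_scTransform.comp Complex.continuous_ofReal).intervalIntegrable _ _)).symm
  rw [h, ← intervalIntegral.integral_const_mul, semicircleMeasure,
    intervalIntegral.integral_of_le hab, integral_Icc_eq_integral_Ioc]
  congr 1
  funext x
  rw [scTransform_ofReal_im]
  have := Real.pi_ne_zero
  field_simp

end Contour

section Smoothing

/-- A smoothed version of the step function `(sgn u) / 2`. -/
def smoothStep (u : ℝ) : ℝ := (2 * Real.arctan u - Real.arctan (u / 2)) / Real.pi

lemma hasDerivAt_two_arctan_sub (v : ℝ) :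
    HasDerivAt (fun v => 2 * Real.arctan v - Real.arctan (2 * v))
      (6 * v ^ 2 / ((1 + v ^ 2) * (1 + 4 * v ^ 2))) v := by
  have h1 := (Real.hasDerivAt_arctan v).const_mul 2
  have h2 := ((hasDerivAt_id v).const_mul 2).arctan
  refine (h1.fun_sub h2).congr_deriv ?_
  have : 1 + v ^ 2 ≠ 0 := by positivity
  have : 1 + 4 * v ^ 2 ≠ 0 := by positivity
  have : 1 + (2 * v) ^ 2 ≠ 0 := by positivity
  simp only [id_eq]
  field_simp
  ring

lemma two_arctan_sub_nonneg {v : ℝ} (hv : 0 ≤ v) :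
    0 ≤ 2 * Real.arctan v - Real.arctan (2 * v) := by
  have := monotone_of_hasDerivAt_nonneg hasDerivAt_two_arctan_sub (fun v => by positivity) hv
  simpa using this

lemma two_arctan_sub_le {v : ℝ} (hv : 0 ≤ v) :
    2 * Real.arctan v - Real.arctan (2 * v) ≤ 2 * v ^ 3 := by
  have := monotone_of_hasDerivAt_nonneg
    (fun v => ((hasDerivAt_pow 3 v).const_mul 2).sub (hasDerivAt_two_arctan_sub v))
    (fun v => by
      have h1 : 6 * v ^ 2 / ((1 + v ^ 2) * (1 + 4 * v ^ 2)) ≤ 6 * v ^ 2 :=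
        div_le_self (by positivity) (by nlinarith [sq_nonneg v, sq_nonneg (v ^ 2)])
      simp only [Pi.zero_apply]
      norm_num
      linarith) hv
  simp at this
  linarith

lemma abs_half_sub_smoothStep_le {u : ℝ} (hu : 0 ≤ u) :
    |1 / 2 - smoothStep u| ≤ 2 / (1 + u ^ 2) := by
  have hpi := Real.pi_gt_three
  rcases hu.eq_or_lt with rfl | hu
  · norm_num [smoothStep]
  have h1 := Real.arctan_inv_of_pos hu
  have h2 := Real.arctan_inv_of_pos (half_pos hu)
  have h3 : (u / 2)⁻¹ = 2 * u⁻¹ := by field_simp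
  rw [h3] at h2
  have h4 : 1 / 2 - smoothStep u =
      (2 * Real.arctan u⁻¹ - Real.arctan (2 * u⁻¹)) / Real.pi := by
    unfold smoothStep
    rw [h1, h2]
    field_simp
    ring
  have hv : 0 < u⁻¹ := by positivity
  have h5 := two_arctan_sub_nonneg hv.le
  have h6 := two_arctan_sub_le hv.le
  rw [h4, abs_of_nonneg (by positivity)]
  rcases le_total u 1 with hu1 | hu1
  · have h7 := Real.arctan_lt_pi_div_two u⁻¹
    have h8 : 0 ≤ Real.arctan (2 * u⁻¹) := Real.arctan_nonneg.2 (by positivity)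
    calc _ ≤ (1 : ℝ) := by
          rw [div_le_one (by positivity)]
          linarith
      _ ≤ _ := by
          rw [le_div_iff₀ (by positivity)]
          nlinarith
  · calc _ ≤ 2 * u⁻¹ ^ 3 / Real.pi := by gcongr
      _ ≤ 2 * u⁻¹ ^ 3 / 2 := by gcongr; linarith
      _ = 1 / u ^ 3 := by field_simp
      _ ≤ _ := by
          rw [div_le_div_iff₀ (by positivity) (by positivity)]
          nlinarith [mul_nonneg (sub_nonneg.2 hu1) (sq_nonneg u)]

lemma smoothStep_neg (u : ℝ) : smoothStep (-u) = -smoothStep u := by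
  unfold smoothStep
  rw [neg_div, Real.arctan_neg, Real.arctan_neg]
  ring

lemma abs_half_add_smoothStep_le {u : ℝ} (hu : u ≤ 0) :
    |1 / 2 + smoothStep u| ≤ 2 / (1 + u ^ 2) := by
  have := abs_half_sub_smoothStep_le (neg_nonneg.2 hu)
  rwa [smoothStep_neg, sub_neg_eq_add, neg_sq] at this

open scoped Classical in
lemma abs_indicator_sub_smoothStep_le {a b η t : ℝ} (hab : a ≤ b) (hη : 0 < η) :
    |(if t ∈ Set.Icc a b then (1 : ℝ) else 0) -
      (smoothStep ((b - t) / η) - smoothStep ((a - t) / η))| ≤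
      2 / (1 + ((a - t) / η) ^ 2) + 2 / (1 + ((b - t) / η) ^ 2) := by
  by_cases h : t ∈ Set.Icc a b
  · rw [if_pos h]
    have h1 := abs_half_add_smoothStep_le
      (div_nonpos_of_nonpos_of_nonneg (sub_nonpos.2 h.1) hη.le)
    have h2 := abs_half_sub_smoothStep_le (div_nonneg (sub_nonneg.2 h.2) hη.le)
    rw [abs_le] at *
    constructor <;> linarith
  · rw [if_neg h]
    rcases lt_or_ge t a with h' | h'
    · have h1 := abs_half_sub_smoothStep_le (div_nonneg (sub_nonneg.2 h'.le) hη.le)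
      have h2 := abs_half_sub_smoothStep_le
        (div_nonneg (sub_nonneg.2 (h'.le.trans hab)) hη.le)
      rw [abs_le] at *
      constructor <;> linarith
    · have h3 : b ≤ t := le_of_lt (by by_contra! hc; exact h ⟨h', hc⟩)
      have h1 := abs_half_add_smoothStep_le
        (div_nonpos_of_nonpos_of_nonneg (sub_nonpos.2 h') hη.le)
      have h2 := abs_half_add_smoothStep_le
        (div_nonpos_of_nonpos_of_nonneg (sub_nonpos.2 h3) hη.le)
      rw [abs_le] at *
      constructor <;> linarith

variable {N : ℕ}

lemma stieltjes_im (ev : Fin N → ℝ) (x t : ℝ) :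
    (stieltjes ev ⟨x, t⟩).im = (1 / N) * ∑ α, t / ((x - ev α) ^ 2 + t ^ 2) := by
  unfold stieltjes
  have h : (1 / (N : ℂ)) = ((1 / N : ℝ) : ℂ) := by push_cast; rfl
  rw [h, Complex.im_ofReal_mul, Complex.im_sum]
  congr 1
  refine Finset.sum_congr rfl fun α _ => ?_
  rw [one_div, Complex.inv_im, Complex.normSq_apply]
  simp only [Complex.sub_re, Complex.sub_im, Complex.ofReal_re, Complex.ofReal_im]
  rw [zero_sub, neg_neg]
  congr 1
  ring

lemma integral_stieltjes_im (ev : Fin N → ℝ) (a b : ℝ) {t : ℝ} (ht : 0 < t) :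
    ∫ x in a..b, (stieltjes ev ⟨x, t⟩).im =
      (1 / N) * ∑ α, (Real.arctan ((b - ev α) / t) - Real.arctan ((a - ev α) / t)) := by
  simp_rw [stieltjes_im]
  have hcont : ∀ c : ℝ, Continuous fun x : ℝ => t / ((x - c) ^ 2 + t ^ 2) := fun c => by
    have : ∀ x : ℝ, (x - c) ^ 2 + t ^ 2 ≠ 0 := fun x => by positivity
    fun_prop (disch := assumption)
  rw [intervalIntegral.integral_const_mul, intervalIntegral.integral_finsetSum]
  · congr 1
    refine Finset.sum_congr rfl fun α _ => ?_
    refine intervalIntegral.integral_eq_sub_of_hasDerivAt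
      (f := fun x => Real.arctan ((x - ev α) / t)) (fun x _ => ?_)
      ((hcont _).intervalIntegrable _ _)
    have h := (((hasDerivAt_id x).sub_const (ev α)).div_const t).arctan
    refine h.congr_deriv ?_
    have : (x - ev α) ^ 2 + t ^ 2 ≠ 0 := by positivity
    have : 1 + ((x - ev α) / t) ^ 2 ≠ 0 := by positivity
    simp only [id_eq]
    field_simp
    ring
  · exact fun α _ => (hcont _).intervalIntegrable _ _

open scoped Classical in
lemma abs_avg_sub_integral_le (ev : Fin N → ℝ) {a b η : ℝ} (hab : a ≤ b) (hη : 0 < η) :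
    |(1 / (N : ℝ)) * ∑ α, (if ev α ∈ Set.Icc a b then (1 : ℝ) else 0) -
      (1 / Real.pi) * (2 * (∫ x in a..b, (stieltjes ev ⟨x, η⟩).im) -
        ∫ x in a..b, (stieltjes ev ⟨x, 2 * η⟩).im)| ≤
      2 * η * ((stieltjes ev ⟨a, η⟩).im + (stieltjes ev ⟨b, η⟩).im) := by
  rw [integral_stieltjes_im ev a b hη, integral_stieltjes_im ev a b (by positivity),
    stieltjes_im, stieltjes_im]
  have hL : (1 / (N : ℝ)) * ∑ α, (if ev α ∈ Set.Icc a b then (1 : ℝ) else 0) -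
      (1 / Real.pi) * (2 * ((1 / N) *
        ∑ α, (Real.arctan ((b - ev α) / η) - Real.arctan ((a - ev α) / η))) -
        (1 / N) * ∑ α, (Real.arctan ((b - ev α) / (2 * η)) -
          Real.arctan ((a - ev α) / (2 * η)))) =
      (1 / N) * ∑ α, ((if ev α ∈ Set.Icc a b then (1 : ℝ) else 0) -
        (smoothStep ((b - ev α) / η) - smoothStep ((a - ev α) / η))) := by
    simp only [smoothStep, Finset.mul_sum, ← Finset.sum_sub_distrib]
    refine Finset.sum_congr rfl fun α _ => ?_
    rw [div_div, div_div, mul_comm η 2]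
    ring
  rw [hL, abs_mul, abs_of_nonneg (by positivity : (0 : ℝ) ≤ 1 / N), ← mul_add,
    ← Finset.sum_add_distrib, mul_left_comm, Finset.mul_sum (a := 2 * η)]
  refine mul_le_mul_of_nonneg_left ((Finset.abs_sum_le_sum_abs _ _).trans
    (Finset.sum_le_sum fun α _ => ?_)) (by positivity)
  refine (abs_indicator_sub_smoothStep_le hab hη).trans (le_of_eq ?_)
  have h1 : (a - ev α) ^ 2 + η ^ 2 ≠ 0 := by positivity
  have h2 : (b - ev α) ^ 2 + η ^ 2 ≠ 0 := by positivity
  have h3 : 1 + ((a - ev α) / η) ^ 2 ≠ 0 := by positivity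
  have h4 : 1 + ((b - ev α) / η) ^ 2 ≠ 0 := by positivity
  have h5 : ∀ c : ℝ, 2 / (1 + (c / η) ^ 2) = 2 * η * (η / (c ^ 2 + η ^ 2)) := fun c => by
    have : 1 + (c / η) ^ 2 ≠ 0 := by positivity
    have : c ^ 2 + η ^ 2 ≠ 0 := by positivity
    field_simp
    ring
  rw [h5, h5, mul_add]

end Smoothing

section Interval

variable {N : ℕ}

open scoped Classical in
lemma abs_avg_sub_semicircleMeasure_le (ev : Fin N → ℝ) {a b η : ℝ} (hab : a ≤ b) (hη : 0 < η)
    (ha : ‖stieltjes ev ⟨a, η⟩‖ ≤ 2) (hb : ‖stieltjes ev ⟨b, η⟩‖ ≤ 2) :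
    |(1 / (N : ℝ)) * ∑ α, (if ev α ∈ Set.Icc a b then (1 : ℝ) else 0) -
      semicircleMeasure a b| ≤
      2 * ‖∫ x in a..b, stieltjesDiff ev ⟨x, η⟩‖ +
        ‖∫ x in a..b, stieltjesDiff ev ⟨x, 2 * η⟩‖ + 16 * η := by
  have h1 := abs_avg_sub_integral_le ev hab hη
  have ha' := (Complex.abs_im_le_norm (stieltjes ev ⟨a, η⟩)).trans ha
  have hb' := (Complex.abs_im_le_norm (stieltjes ev ⟨b, η⟩)).trans hb
  have hI : ∀ t, 0 < t → |(∫ x in a..b, (stieltjes ev ⟨x, t⟩).im) -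
      (∫ x in a..b, scTransform x).im| ≤ ‖∫ x in a..b, stieltjesDiff ev ⟨x, t⟩‖ + 2 * t := by
    intro t ht
    have c1 : Continuous fun x : ℝ => stieltjes ev ⟨x, t⟩ :=
      continuous_iff_continuousAt.2 fun x =>
        ContinuousAt.comp (f := fun x : ℝ => (⟨x, t⟩ : ℂ))
          (differentiableAt_stieltjes ev (z := ⟨x, t⟩) ht).continuousAt
          (continuous_mk_left t).continuousAt
    have c2 : Continuous fun x : ℝ => scTransform ⟨x, t⟩ :=
      continuous_scTransform.comp (continuous_mk_left t)
    have e1 : (∫ x in a..b, (stieltjes ev ⟨x, t⟩).im) = (∫ x in a..b, stieltjes ev ⟨x, t⟩).im :=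
      intervalIntegral.intervalIntegral_im (c1.intervalIntegrable _ _)
    have e2 : (∫ x in a..b, stieltjesDiff ev ⟨x, t⟩) =
        (∫ x in a..b, stieltjes ev ⟨x, t⟩) - ∫ x in a..b, scTransform ⟨x, t⟩ :=
      intervalIntegral.integral_sub (c1.intervalIntegrable _ _) (c2.intervalIntegrable _ _)
    rw [e1, ← Complex.sub_im]
    refine (Complex.abs_im_le_norm _).trans ?_
    rw [e2]
    have h2 := norm_integral_scTransform_sub_le a b ht.le
    rw [norm_sub_rev] at h2
    have h3 := norm_sub_le_norm_sub_add_norm_sub (∫ x in a..b, stieltjes ev ⟨x, t⟩)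
      (∫ x in a..b, scTransform ⟨x, t⟩) (∫ x in a..b, scTransform x)
    linarith
  have h2 := hI η hη
  have h3 := hI (2 * η) (by positivity)
  rw [semicircleMeasure_eq hab]
  set J := (∫ x in a..b, scTransform x).im
  set I₁ := ∫ x in a..b, (stieltjes ev ⟨x, η⟩).im
  set I₂ := ∫ x in a..b, (stieltjes ev ⟨x, 2 * η⟩).im
  set ν := (1 / (N : ℝ)) * ∑ α, (if ev α ∈ Set.Icc a b then (1 : ℝ) else 0)
  have hpi : 1 / Real.pi ≤ 1 := by
    rw [div_le_one Real.pi_pos]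
    linarith [Real.pi_gt_three]
  have hpi0 : 0 < 1 / Real.pi := by positivity
  have h4 : |(1 / Real.pi) * (2 * (I₁ - J) - (I₂ - J))| ≤
      2 * ‖∫ x in a..b, stieltjesDiff ev ⟨x, η⟩‖ +
        ‖∫ x in a..b, stieltjesDiff ev ⟨x, 2 * η⟩‖ + 8 * η := by
    rw [abs_mul, abs_of_pos hpi0]
    refine (mul_le_of_le_one_left (abs_nonneg _) hpi).trans ?_
    refine (abs_sub _ _).trans ?_
    rw [abs_mul, abs_two]
    linarith
  have h5 : 2 * η * ((stieltjes ev ⟨a, η⟩).im + (stieltjes ev ⟨b, η⟩).im) ≤ 8 * η := by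
    have := le_abs_self (stieltjes ev ⟨a, η⟩).im
    have := le_abs_self (stieltjes ev ⟨b, η⟩).im
    nlinarith
  calc |ν - 1 / Real.pi * J| = |(ν - 1 / Real.pi * (2 * I₁ - I₂)) +
        (1 / Real.pi) * (2 * (I₁ - J) - (I₂ - J))| := by ring_nf
    _ ≤ _ := abs_add_le _ _
    _ ≤ _ := by linarith

lemma LocalLaw.norm_stieltjesDiff_le {ε ξ : ℝ} {ev : Fin N → ℝ} (hLL : LocalLaw ε ξ ev)
    (hN : 0 < N) {K E y : ℝ} (hK : 2 * K + 5 ≤ N) (hE : |E| ≤ K) (hyK : y ≤ 2 * K) (hξ : 1 ≤ ξ)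
    (hε : 0 ≤ ε) (hξε : ξ * ε ≤ 1 / 4000000000) (hy0 : 0 < y) (hy : 4000000000 * ξ ≤ √(N * y)) :
    40000000 * ξ * ctrl N y ε ≤ 1 / 50 ∧
    ‖stieltjesDiff ev ⟨E, y⟩‖ ≤ 4 * √(40000000 * ξ * ctrl N y ε) ∧
      ‖stieltjesDiff ev ⟨E, y⟩‖ * ‖edgeSqrt ⟨E, y⟩‖ ≤ 12 * (40000000 * ξ * ctrl N y ε) := by
  have hK0 : 0 ≤ K := (abs_nonneg E).trans hE
  have hsmall : 2 * (10000000 * ξ * ctrl N y ε) ≤ 1 / 100 := by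
    have h1 : ξ * (√(N * y))⁻¹ ≤ 1 / 4000000000 := by
      rw [← div_eq_mul_inv, div_le_div_iff₀ (by linarith) (by norm_num)]
      linarith
    unfold ctrl
    linarith
  have hc : 0 ≤ ctrl N y ε := by
    unfold ctrl
    positivity
  refine ⟨by linarith, _root_.norm_stieltjesDiff_le hN ev hy0 (by positivity) fun t ht ht' => ?_⟩
  have ht0 : 0 < t := hy0.trans_le ht
  have hanti := ctrl_anti (ε := ε) hN hy0 ht
  have hNt : 1 ≤ N * t := by
    have h1 : 1 ≤ √(N * t) := by
      calc 1 ≤ √(N * y) := by linarith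
        _ ≤ _ := by gcongr
    rwa [Real.one_le_sqrt] at h1
  have hmax : max y 4 ≤ N - 1 := max_le (by linarith) (by linarith)
  refine (hLL ⟨E, t⟩ ?_ (ht'.trans hmax) ht0 hNt (le_trans ?_ hsmall)).trans ?_
  · exact hE.trans (by linarith)
  · gcongr
  · gcongr

lemma kappaDist_le {a b x : ℝ} (hx : x ∈ Set.Icc a b) :
    kappaDist a b ≤ |x - 2| ∧ kappaDist a b ≤ |x + 2| := by
  constructor
  · refine (min_le_right _ _).trans ?_
    rw [abs_sub_comm]
    exact Metric.infDist_le_dist_of_mem hx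
  · refine (min_le_left _ _).trans ?_
    rw [← sub_neg_eq_add, abs_sub_comm]
    exact Metric.infDist_le_dist_of_mem hx

lemma kappaDist_nonneg (a b : ℝ) : 0 ≤ kappaDist a b :=
  le_min Metric.infDist_nonneg Metric.infDist_nonneg

/-- The leading term of the error in the semicircle law on an interval. -/
def intervalErr (N : ℕ) (ξ ε a b : ℝ) : ℝ :=
  ξ * (b - a) / √(kappaDist a b + (b - a)) * (ε + (√(N * (b - a)))⁻¹)

lemma LocalLaw.norm_integral_le {ε ξ : ℝ} {ev : Fin N → ℝ} (hLL : LocalLaw ε ξ ev)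
    (hN : 0 < N) {K a b η : ℝ} (hK : 2 * K + 5 ≤ N) (ha : -K ≤ a) (hb : b ≤ K) (hξ : 1 ≤ ξ)
    (hε : 0 < ε) (hε4 : 1 ≤ √N * ε ^ 2) (hξε : ξ * ε ≤ 1 / 4000000000) (hη0 : 0 < η)
    (hη : 4000000000 * ξ ≤ √(N * η)) (hℓ : η ≤ b - a) :
    ‖∫ x in a..b, stieltjesDiff ev ⟨x, η⟩‖ ≤
      10 ^ 10 * (1 + 2 * K) * intervalErr N ξ ε a b := by
  have hℓ0 : 0 < b - a := by linarith
  have hK0 : 0 ≤ K := by linarith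
  have hNR : (0 : ℝ) < N := by exact_mod_cast hN
  have hbound : ∀ x y, a ≤ x → x ≤ b → η ≤ y → y ≤ b - a → 0 < y ∧
      ‖stieltjesDiff ev ⟨x, y⟩‖ ≤ 4 * √(40000000 * ξ * ctrl N y ε) ∧
      ‖stieltjesDiff ev ⟨x, y⟩‖ * √(2 * max (kappaDist a b) y) ≤
        12 * (40000000 * ξ * ctrl N y ε) := fun x y hx hx' hy hy' => by
    have hy0 : 0 < y := hη0.trans_le hy
    obtain ⟨-, h1, h2⟩ := hLL.norm_stieltjesDiff_le hN hK (abs_le.2 ⟨by linarith, by linarith⟩)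
      (by linarith) hξ hε.le hξε hy0 (hη.trans (by gcongr)) (E := x)
    refine ⟨hy0, h1, le_trans ?_ h2⟩
    obtain ⟨k1, k2⟩ := kappaDist_le (Set.mem_Icc.2 ⟨hx, hx'⟩)
    gcongr
    rw [Real.sqrt_le_left (norm_nonneg _)]
    exact edge_le_norm_edgeSqrt_sq hy0.le k1 k2
  have hdiff : ∀ z : ℂ, 0 < z.im → DifferentiableAt ℂ (stieltjesDiff ev) z :=
    fun z hz => differentiableAt_stieltjesDiff ev hz
  have hκ0 := kappaDist_nonneg a b
  rcases le_or_gt (b - a) (kappaDist a b) with hκ | hκ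
  · have hκp : 0 < kappaDist a b := hℓ0.trans_le hκ
    set w := √(2 * kappaDist a b) with hw
    have hw0 : 0 < w := by positivity
    have h := norm_integral_le_of_norm_le (f := stieltjesDiff ev)
      (P := 480000000 * ξ * ε / w) (Q := 480000000 * ξ * (√N)⁻¹ / w) (by positivity)
      (by positivity) hη0 hℓ hdiff fun x y hx hx' hy hy' => by
        obtain ⟨hy0, -, h2⟩ := hbound x y hx hx' hy hy'
        rw [max_eq_left (hy'.trans hκ)] at h2
        rw [← le_div_iff₀ hw0] at h2
        refine h2.trans (le_of_eq ?_)
        unfold ctrl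
        rw [Real.sqrt_mul hNR.le]
        have : √y ≠ 0 := (Real.sqrt_pos.2 hy0).ne'
        field_simp
        ring
    refine h.trans ?_
    have hwle : √(kappaDist a b + (b - a)) ≤ w := Real.sqrt_le_sqrt (by linarith)
    have hX : ξ * (b - a) / w * (ε + (√(N * (b - a)))⁻¹) ≤ intervalErr N ξ ε a b := by
      unfold intervalErr
      gcongr
    have hs : √(b - a) ≠ 0 := (Real.sqrt_pos.2 hℓ0).ne'
    have hss : √(b - a) * √(b - a) = b - a := Real.mul_self_sqrt hℓ0.le
    have hX' : ξ * (b - a) / w * (ε + (√(N * (b - a)))⁻¹) =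
        ξ * ε / w * (b - a) + ξ * (√N)⁻¹ / w * √(b - a) := by
      rw [Real.sqrt_mul hNR.le, mul_inv]
      have : (b - a) * (√(b - a))⁻¹ = √(b - a) := by
        rw [← div_eq_mul_inv, Real.div_sqrt]
      linear_combination (ξ / w * (√N)⁻¹) * this
    rw [hX'] at hX
    have t1 : 0 ≤ ξ * ε / w * (b - a) := by positivity
    have t2 : 0 ≤ ξ * (√N)⁻¹ / w * √(b - a) := by positivity
    calc _ = 1440000000 * (ξ * ε / w * (b - a)) +
          2400000000 * (ξ * (√N)⁻¹ / w * √(b - a)) := by ring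
      _ ≤ 10 ^ 10 * 1 * (ξ * ε / w * (b - a) + ξ * (√N)⁻¹ / w * √(b - a)) := by linarith
      _ ≤ _ := by gcongr; linarith
  · have h := norm_integral_le_of_norm_le (f := stieltjesDiff ev)
      (P := 0) (Q := 960000000 * (1 + 2 * K) * ξ * ε) le_rfl
      (by positivity) hη0 hℓ hdiff fun x y hx hx' hy hy' => by
        obtain ⟨hy0, h1, h2⟩ := hbound x y hx hx' hy hy'
        have hsy : 0 < √y := Real.sqrt_pos.2 hy0
        rw [zero_add, le_div_iff₀ hsy]
        rcases le_total (√(N * y))⁻¹ ε with hc | hc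
        · have h3 : √y ≤ √(2 * max (kappaDist a b) y) :=
            Real.sqrt_le_sqrt (by linarith [le_max_right (kappaDist a b) y])
          calc _ ≤ ‖stieltjesDiff ev ⟨x, y⟩‖ * √(2 * max (kappaDist a b) y) := by gcongr
            _ ≤ _ := h2
            _ ≤ 12 * (40000000 * ξ * (ε + ε)) := by
                unfold ctrl
                gcongr
            _ = 960000000 * 1 * ξ * ε := by ring
            _ ≤ _ := by
                gcongr
                linarith
        · have h3 : ‖stieltjesDiff ev ⟨x, y⟩‖ ≤ 4 * √(80000000 * ξ * (√(N * y))⁻¹) := by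
            refine h1.trans ?_
            gcongr 4 * √?_
            unfold ctrl
            nlinarith
          refine le_trans (mul_le_mul_of_nonneg_right h3 hsy.le) ?_
          rw [mul_assoc, ← Real.sqrt_mul (by positivity)]
          have h4 : (√(N * y))⁻¹ * y = √y / √N := by
            have e : y * (√y)⁻¹ = √y := by rw [← div_eq_mul_inv, Real.div_sqrt]
            rw [Real.sqrt_mul hNR.le, mul_inv]
            linear_combination (√(N : ℝ))⁻¹ * e
          have h5 : √y / √N ≤ (1 + 2 * K) * ε ^ 2 := by
            have h6 : √y ≤ 1 + 2 * K := by
              rw [Real.sqrt_le_left (by linarith)]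
              nlinarith
            rw [div_le_iff₀ (by positivity)]
            calc √y ≤ (1 + 2 * K) * 1 := by linarith
              _ ≤ (1 + 2 * K) * (√N * ε ^ 2) := by gcongr
              _ = _ := by ring
          have h7 : √(80000000 * ξ * (√(N * y))⁻¹ * y) ≤ 10000 * (1 + 2 * K) * ξ * ε := by
            rw [Real.sqrt_le_left (by positivity)]
            calc _ = 80000000 * ξ * ((√(N * y))⁻¹ * y) := by ring
              _ ≤ 80000000 * ξ * ((1 + 2 * K) * ε ^ 2) := by
                  rw [h4]
                  gcongr
              _ ≤ 100000000 * (ξ * ξ) * (((1 + 2 * K) * (1 + 2 * K)) * ε ^ 2) := by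
                  gcongr
                  · norm_num
                  · nlinarith
                  · nlinarith
              _ = _ := by ring
          calc _ ≤ 4 * (10000 * (1 + 2 * K) * ξ * ε) := by gcongr
            _ = 40000 * (1 + 2 * K) * ξ * ε := by ring
            _ ≤ _ := by
                gcongr
                norm_num
    refine h.trans ?_
    have hX : ξ * (b - a) / √(2 * (b - a)) * ε ≤ intervalErr N ξ ε a b := by
      unfold intervalErr
      gcongr
      · linarith
      · have : 0 ≤ (√(N * (b - a)))⁻¹ := by positivity
        linarith
    have hX' : ξ * √(b - a) / 2 * ε ≤ ξ * (b - a) / √(2 * (b - a)) * ε := by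
      have h2 : √(2 : ℝ) ≤ 2 := by
        rw [Real.sqrt_le_left (by norm_num)]
        norm_num
      rw [Real.sqrt_mul (by norm_num), mul_comm √(2 : ℝ), ← div_div, mul_div_assoc ξ (b - a),
        Real.div_sqrt]
      gcongr
    calc _ = 9600000000 * (1 + 2 * K) * (ξ * √(b - a) / 2 * ε) := by ring
      _ ≤ 10 ^ 10 * (1 + 2 * K) * (ξ * √(b - a) / 2 * ε) := by
          gcongr
          norm_num
      _ ≤ _ := by
          gcongr
          exact hX'.trans hX

open scoped Classical in
lemma LocalLaw.abs_avg_sub_le {ε ξ : ℝ} {ev : Fin N → ℝ} (hLL : LocalLaw ε ξ ev)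
    (hN : 0 < N) {K a b : ℝ} (hK : 2 * K + 5 ≤ N) (hK0 : 16000000000000000000 * ξ ^ 2 / N ≤ K)
    (hab : a ≤ b) (ha : -K ≤ a) (hb : b ≤ K) (hξ : 1 ≤ ξ)
    (hε : 0 < ε) (hε4 : 1 ≤ √N * ε ^ 2) (hξε : ξ * ε ≤ 1 / 4000000000) :
    |(1 / (N : ℝ)) * ∑ α, (if ev α ∈ Set.Icc a b then (1 : ℝ) else 0) -
      semicircleMeasure a b| ≤
      10 ^ 21 * (1 + 2 * K) * (intervalErr N ξ ε a b + ξ ^ 2 / N) := by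
  have hNR : (0 : ℝ) < N := by exact_mod_cast hN
  set η := 16000000000000000000 * ξ ^ 2 / N with hη
  have hη0 : 0 < η := by positivity
  have hsq : √(N * η) = 4000000000 * ξ := by
    rw [hη, mul_div_cancel₀ _ hNR.ne', Real.sqrt_eq_iff_mul_self_eq (by positivity) (by positivity)]
    ring
  have hsq2 : 4000000000 * ξ ≤ √(N * (2 * η)) := by
    rw [← hsq]
    gcongr
    linarith
  have hdiff : ∀ x ∈ Set.Icc a b, ∀ t, η ≤ t → t ≤ 2 * η → ‖stieltjesDiff ev ⟨x, t⟩‖ ≤ 1 :=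
    fun x hx t ht ht' => by
      obtain ⟨h1, h2, -⟩ := hLL.norm_stieltjesDiff_le hN hK
        (abs_le.2 ⟨ha.trans hx.1, hx.2.trans hb⟩) (y := t) (by linarith) hξ hε.le hξε
        (hη0.trans_le ht) (by rw [← hsq]; gcongr)
      refine h2.trans ?_
      have : √(40000000 * ξ * ctrl N t ε) ≤ 1 / 4 := by
        rw [Real.sqrt_le_left (by norm_num)]
        linarith
      linarith
  have hs : ∀ x ∈ Set.Icc a b, ‖stieltjes ev ⟨x, η⟩‖ ≤ 2 := fun x hx => by
    have h1 := hdiff x hx η le_rfl (by linarith)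
    have h2 := norm_scTransform_le (z := ⟨x, η⟩) hη0.le
    have h3 := norm_add_le (stieltjesDiff ev ⟨x, η⟩) (scTransform ⟨x, η⟩)
    rw [stieltjesDiff, sub_add_cancel] at h3
    unfold stieltjesDiff at h1
    linarith
  have hmain := abs_avg_sub_semicircleMeasure_le ev hab hη0 (hs a ⟨le_rfl, hab⟩)
    (hs b ⟨hab, le_rfl⟩)
  have hX : 0 ≤ intervalErr N ξ ε a b := by
    unfold intervalErr
    have := sub_nonneg.2 hab
    positivity
  have hη' : η = 16000000000000000000 * (ξ ^ 2 / N) := by rw [hη]; ring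
  have hq : 0 ≤ ξ ^ 2 / N := by positivity
  have hKn : 0 ≤ K := hη0.le.trans hK0
  have hKX : 0 ≤ K * intervalErr N ξ ε a b := by positivity
  have hKq : 0 ≤ K * (ξ ^ 2 / N) := by positivity
  refine hmain.trans ?_
  rcases le_or_gt (b - a) (2 * η) with hℓ | hℓ
  · have hbound : ∀ t, η ≤ t → t ≤ 2 * η → ‖∫ x in a..b, stieltjesDiff ev ⟨x, t⟩‖ ≤ 2 * η :=
      fun t ht ht' => by
        have := intervalIntegral.norm_integral_le_of_norm_le_const (a := a) (b := b) (C := 1)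
          (f := fun x : ℝ => stieltjesDiff ev ⟨x, t⟩) fun x hx => by
            rw [Set.uIoc_of_le hab] at hx
            exact hdiff x ⟨hx.1.le, hx.2⟩ t ht ht'
        rw [abs_of_nonneg (sub_nonneg.2 hab)] at this
        linarith
    have i1 := hbound η le_rfl (by linarith)
    have i2 := hbound (2 * η) (by linarith) le_rfl
    nlinarith
  · have i1 := hLL.norm_integral_le hN hK ha hb hξ hε hε4 hξε hη0 hsq.ge (by linarith)
    have i2 := hLL.norm_integral_le hN hK ha hb hξ hε hε4 hξε (by positivity) hsq2 hℓ.le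
    nlinarith

end Interval

section Assembly

variable {N d : ℕ}

open scoped Classical in
lemma empiricalMeasure_eq {H : Matrix (Fin N) (Fin N) ℝ} (hH : H.IsHermitian) (a b : ℝ) :
    empiricalMeasure hH a b =
      (1 / (N : ℝ)) * ∑ α, (if hH.eigenvalues α ∈ Set.Icc a b then (1 : ℝ) else 0) := by
  rw [Finset.sum_boole, one_div_mul_eq_div]
  unfold empiricalMeasure cardOf
  congr

lemma abs_empiricalMeasure_sub_le {H : Matrix (Fin N) (Fin N) ℝ} (hH : H.IsHermitian) {a b : ℝ}
    (hab : a ≤ b) : |empiricalMeasure hH a b - semicircleMeasure a b| ≤ 1 + (b - a) := by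
  have h1 : 0 ≤ empiricalMeasure hH a b := by
    unfold empiricalMeasure
    positivity
  have h2 : empiricalMeasure hH a b ≤ 1 := by
    unfold empiricalMeasure
    refine div_le_one_of_le₀ ?_ (by positivity)
    have : cardOf (fun α : Fin N => hH.eigenvalues α ∈ Set.Icc a b) ≤ N := by
      unfold cardOf
      exact (Finset.card_le_univ _).trans (by simp)
    exact_mod_cast this
  have h3 : 0 ≤ semicircleMeasure a b :=
    setIntegral_nonneg measurableSet_Icc fun x _ => by positivity
  have h4 : semicircleMeasure a b ≤ b - a := by
    unfold semicircleMeasure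
    have h5 : ∀ x ∈ Set.Icc a b, ‖√(max (4 - x ^ 2) 0) / (2 * Real.pi)‖ ≤ 1 := fun x _ => by
      rw [Real.norm_of_nonneg (by positivity), div_le_one (by positivity)]
      have h6 : √(max (4 - x ^ 2) 0) ≤ 2 := by
        rw [Real.sqrt_le_left (by norm_num)]
        exact max_le (by nlinarith) (by norm_num)
      linarith [Real.pi_gt_three]
    have h7 := norm_setIntegral_le_of_norm_le_const (μ := volume) (s := Set.Icc a b) (C := 1)
      (f := fun x : ℝ => √(max (4 - x ^ 2) 0) / (2 * Real.pi)) (by simp) h5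
    rw [measureReal_def, Real.volume_Icc, ENNReal.toReal_ofReal (sub_nonneg.2 hab), one_mul] at h7
    exact (le_abs_self _).trans h7
  rw [abs_le]
  constructor <;> linarith

lemma cardOf_isRegGraph (N d : ℕ) : cardOf (IsRegGraph N d) = (regSet N d).card := by
  unfold cardOf
  congr 1

lemma le_unifProb {P : Matrix (Fin N) (Fin N) ℝ → Prop} {δ : ℝ} (hpos : 0 < (regSet N d).card)
    {bad : (Fin N → Fin N → Bool) → Prop} [DecidablePred bad]
    (hbad : (((regSet N d).filter bad).card : ℝ) ≤ δ * (regSet N d).card)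
    (h : ∀ G, IsRegGraph N d G → ¬ bad G → P (adjOf G)) : 1 - δ ≤ unifProb N d P := by
  unfold unifProb
  rw [show (fun G : Fin N → Fin N → Bool => IsRegGraph N d G) = IsRegGraph N d from rfl,
    cardOf_isRegGraph, le_div_iff₀ (by exact_mod_cast hpos)]
  have h1 : (regSet N d).card ≤ ((regSet N d).filter bad).card +
      cardOf (fun G : Fin N → Fin N → Bool => IsRegGraph N d G ∧ P (adjOf G)) := by
    rw [← Finset.card_filter_add_card_filter_not bad (s := regSet N d)]
    gcongr
    unfold cardOf
    refine Finset.card_le_card fun G hG => ?_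
    rw [Finset.mem_filter, mem_regSet] at hG
    simp only [Finset.mem_filter, Finset.mem_univ, true_and]
    exact ⟨hG.1, h G hG.1 hG.2⟩
  have h2 : ((regSet N d).card : ℝ) ≤ ((regSet N d).filter bad).card +
      (cardOf (fun G : Fin N → Fin N → Bool => IsRegGraph N d G ∧ P (adjOf G)) : ℝ) := by
    exact_mod_cast h1
  linarith

lemma Dunif_bounds (hd : 2 ≤ d) (hN : 0 < N) (hD : 1 ≤ Dunif N d) :
    d < N ∧ Dunif N d ≤ d ∧ Dunif N d * d ^ 3 ≤ (N : ℝ) ^ 2 ∧ Dunif N d ≤ √N := by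
  have hNR : (0 : ℝ) < N := by exact_mod_cast hN
  have h1 : Dunif N d ≤ d := min_le_left _ _
  have hd1 : (1 : ℝ) ≤ d := hD.trans h1
  have h2 : Dunif N d * d ^ 3 ≤ (N : ℝ) ^ 2 := by
    rw [← le_div_iff₀ (by positivity)]
    exact min_le_right _ _
  have h3 : (d : ℝ) ^ 3 ≤ (N : ℝ) ^ 2 := le_trans (le_mul_of_one_le_left (by positivity) hD) h2
  have h4 : Dunif N d ≤ √N := by
    refine Real.le_sqrt_of_sq_le ?_
    rw [← pow_le_pow_iff_left₀ (by positivity) hNR.le two_ne_zero]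
    calc (Dunif N d ^ 2) ^ 2 = Dunif N d * Dunif N d ^ 3 := by ring
      _ ≤ Dunif N d * d ^ 3 := by gcongr
      _ ≤ _ := h2
  refine ⟨?_, h1, h2, h4⟩
  by_contra! hle
  have hle' : (N : ℝ) ≤ d := by exact_mod_cast hle
  have h5 : (N : ℝ) ^ 2 ≤ (d : ℝ) ^ 2 := by gcongr
  have h6 : (d : ℝ) ^ 2 * d ≤ (d : ℝ) ^ 2 * 1 := by nlinarith
  have h7 : (d : ℝ) ≤ 1 := le_of_mul_le_mul_left h6 (by positivity)
  have h8 : d ≤ 1 := by exact_mod_cast h7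
  omega

end Assembly

/-- **Semicircle law on small scales** for the uniform model of random `d`-regular
graphs. -/
theorem semicircle_law_small_scales :
    ∃ c0 : ℝ, 0 < c0 ∧
      ∀ K : ℝ, 0 < K → ∃ C : ℝ, 0 < C ∧
        ∀ N d : ℕ, 0 < N → 3 ≤ d → Even (N * d) →
          ∀ ξ : ℝ, 0 < ξ → c0 * Real.log N ^ 2 ≤ ξ * Real.log ξ →
            c0 * ξ ^ 2 ≤ Dunif N d →
            ∀ a b : ℝ, a ≤ b → -K ≤ a → b ≤ K →
              1 - Real.exp (-(ξ * Real.log ξ)) ≤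
                unifProb N d fun A =>
                  ∀ hH : (HmatR N d A).IsHermitian,
                    |empiricalMeasure hH a b - semicircleMeasure a b| ≤
                      C * (ξ * (b - a) / Real.sqrt (kappaDist a b + (b - a)) *
                            ((Real.sqrt (Dunif N d))⁻¹ + (Real.sqrt (N * (b - a)))⁻¹) +
                          ξ ^ 2 / N) := by
  refine ⟨16000000000000000000, by norm_num, fun K hK =>
    ⟨10 ^ 21 * (1 + 2 * (K + 1)) * (1 + 2 * (K + 1)), by positivity, ?_⟩⟩
  intro N d hN hd3 hev ξ hξ0 hp hD a b hab ha hb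
  have hNR : (0 : ℝ) < N := by exact_mod_cast hN
  have hξ : 1 ≤ ξ := by
    have h1 : 0 ≤ ξ * Real.log ξ := le_trans (by positivity) hp
    exact (Real.log_nonneg_iff hξ0).1 (nonneg_of_mul_nonneg_right h1 hξ0)
  have hD0 : 16000000000000000000 ≤ Dunif N d := by nlinarith
  obtain ⟨hdN, hDd, hDd3, hDN⟩ := Dunif_bounds (d := d) (by omega) hN (by linarith)
  have hdR : (16000000000000000000 : ℝ) ≤ d := hD0.trans hDd
  have hDpos : 0 < Dunif N d := by linarith
  have hsD : 4000000000 * ξ ≤ √(Dunif N d) := by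
    refine Real.le_sqrt_of_sq_le ?_
    linarith
  have hsD0 : 0 < √(Dunif N d) := Real.sqrt_pos.2 hDpos
  have hdN' : (d : ℝ) ≤ N := by exact_mod_cast hdN.le
  have hN5 : 5 ≤ N := by
    have : (5 : ℝ) ≤ N := by linarith
    exact_mod_cast this
  have hd128 : 128 ≤ √((d : ℝ) - 1) := by
    refine Real.le_sqrt_of_sq_le ?_
    linarith
  have h1 : (√(d : ℝ))⁻¹ ≤ (√(Dunif N d))⁻¹ :=
    inv_anti₀ hsD0 (Real.sqrt_le_sqrt hDd)
  have h2 : √(d : ℝ) ^ 3 / N ≤ (√(Dunif N d))⁻¹ := by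
    rw [div_le_iff₀ hNR, inv_mul_eq_div, le_div_iff₀ hsD0,
      ← pow_le_pow_iff_left₀ (by positivity) hNR.le two_ne_zero]
    calc (√(d : ℝ) ^ 3 * √(Dunif N d)) ^ 2 = (√(d : ℝ) ^ 2) ^ 3 * √(Dunif N d) ^ 2 := by ring
      _ = Dunif N d * d ^ 3 := by
          rw [Real.sq_sqrt hDpos.le, Real.sq_sqrt (by positivity), mul_comm]
      _ ≤ _ := hDd3
  have hX : 0 ≤ intervalErr N ξ (√(Dunif N d))⁻¹ a b := by
    unfold intervalErr
    have := sub_nonneg.2 hab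
    positivity
  have hp' : 100 * Real.log N ^ 2 ≤ ξ * Real.log ξ :=
    le_trans (mul_le_mul_of_nonneg_right (by norm_num) (sq_nonneg _)) hp
  classical
  refine le_unifProb (card_regSet_pos hdN hev)
    (card_not_localLaw_le hN5 hdN.le hd128 h1 h2 hξ hp') ?_
  intro G hG hgood hH
  have hLL : LocalLaw (√(Dunif N d))⁻¹ ξ hH.eigenvalues := by
    by_contra hc
    exact hgood ⟨hG, hc⟩
  change _ ≤ 10 ^ 21 * (1 + 2 * (K + 1)) * (1 + 2 * (K + 1)) *
    (intervalErr N ξ (√(Dunif N d))⁻¹ a b + ξ ^ 2 / N)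
  have hq : 1 / (N : ℝ) ≤ ξ ^ 2 / N := by
    gcongr
    nlinarith
  rcases lt_or_ge (N : ℝ) (2 * (K + 1) + 5) with hNK | hNK
  · refine (abs_empiricalMeasure_sub_le hH hab).trans ?_
    calc 1 + (b - a) ≤ (1 + 2 * (K + 1)) * 1 := by linarith
      _ ≤ (1 + 2 * (K + 1)) * ((2 * (K + 1) + 5) * (1 / N)) := by
          gcongr
          rw [mul_one_div, one_le_div hNR]
          exact hNK.le
      _ ≤ (1 + 2 * (K + 1)) * (10 ^ 21 * (1 + 2 * (K + 1)) *
          (intervalErr N ξ (√(Dunif N d))⁻¹ a b + ξ ^ 2 / N)) := by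
          gcongr
          · nlinarith
          · linarith
      _ = _ := by ring
  · rw [empiricalMeasure_eq]
    refine (hLL.abs_avg_sub_le hN hNK ?_ hab (by linarith) (by linarith) hξ (by positivity) ?_
      ?_).trans ?_
    · rw [div_le_iff₀ hNR]
      have : √(N : ℝ) ≤ N := by
        rw [Real.sqrt_le_left hNR.le]
        nlinarith
      nlinarith
    · rw [inv_pow, Real.sq_sqrt hDpos.le, ← div_eq_mul_inv, one_le_div hDpos]
      exact hDN
    · rw [← div_eq_mul_inv, div_le_div_iff₀ hsD0 (by norm_num)]
      linarith
    · have : 0 ≤ ξ ^ 2 / (N : ℝ) := by positivity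
      gcongr
      refine le_mul_of_one_le_right (by positivity) (by linarith)

end
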